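/- Let N ≥ 2, 0 < c_N < … < c_2 < c_1 = 1 with ∑_{j=2}^N (1 − c_j)² ≤ 1/16, and let u be a smooth solution of the quartic gKdV equation satisfying lim_{t→+∞} ‖u(t,·) − ∑_{j=1}^N Q_{c_j}(· − c_j t − Δ_j)‖_{H¹} = 0 for some Δ_j ∈ ℝ, and lim_{t→−∞} ‖u(t,·) − ∑_{j=1}^{N⁻} Q_{c⁻_j}(· − c⁻_j t − Δ⁻_j)‖_{H¹} = 0 for some N⁻ ≥ 2, 0 < c⁻_{N⁻} < … < c⁻_1 and Δ⁻_j ∈ ℝ. With σ₀, γ₀, j₀ and x₀(t) as defined below, for every K₀ > 1 there exists t₀(K₀) > 0 such that |u(t, x₀(t))| ≤ e^{−2σ₀ t} for all t > t₀(K₀). -/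

import Mathlib

open Real MeasureTheory Filter

noncomputable def Q (x : ℝ) : ℝ := (5 / (2 * Real.cosh (3 * x / 2) ^ 2)) ^ ((1:ℝ)/3)

noncomputable def Qc (c x : ℝ) : ℝ := c ^ ((1:ℝ)/3) * Q (Real.sqrt c * x)

noncomputable def H1norm (f : ℝ → ℝ) : ℝ :=
  Real.sqrt (∫ x : ℝ, ((f x) ^ 2 + (deriv f x) ^ 2))

noncomputable def IsGKdVSolution (u : ℝ → ℝ → ℝ) : Prop :=
  ContDiff ℝ (⊤ : ℕ∞) (Function.uncurry u) ∧
  (∀ t x : ℝ, deriv (fun s => u s x) t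
      + deriv (fun y => iteratedDeriv 2 (u t) y + (u t y) ^ 4) x = 0) ∧
  (∀ (t : ℝ) (k : ℕ), Integrable (fun x => (iteratedDeriv k (u t) x) ^ 2))

namespace GKdV

/-- Joint smoothness of a function of time and space. -/
def Sm (f : ℝ → ℝ → ℝ) : Prop := ContDiff ℝ (⊤ : ℕ∞) (Function.uncurry f)

/-- Space derivative. -/
noncomputable def px (f : ℝ → ℝ → ℝ) : ℝ → ℝ → ℝ := fun t x => deriv (f t) x

/-- Time derivative. -/
noncomputable def pt (f : ℝ → ℝ → ℝ) : ℝ → ℝ → ℝ := fun t x => deriv (fun s => f s x) t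

variable {f g : ℝ → ℝ → ℝ}

lemma Sm.diff (hf : Sm f) : Differentiable ℝ (Function.uncurry f) :=
  ContDiff.differentiable hf (by simp)

lemma Sm.hasDerivAt_x_fderiv (hf : Sm f) (t x : ℝ) :
    HasDerivAt (f t) (fderiv ℝ (Function.uncurry f) (t, x) (0, 1)) x := by
  have h1 : HasDerivAt (fun y : ℝ => (t, y)) ((0 : ℝ), (1 : ℝ)) x :=
    (hasDerivAt_const x t).prodMk (hasDerivAt_id x)
  exact (hf.diff (t, x)).hasFDerivAt.comp_hasDerivAt x h1

lemma Sm.hasDerivAt_t_fderiv (hf : Sm f) (t x : ℝ) :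
    HasDerivAt (fun s => f s x) (fderiv ℝ (Function.uncurry f) (t, x) (1, 0)) t := by
  have h1 : HasDerivAt (fun s : ℝ => (s, x)) ((1 : ℝ), (0 : ℝ)) t :=
    (hasDerivAt_id t).prodMk (hasDerivAt_const t x)
  exact (hf.diff (t, x)).hasFDerivAt.comp_hasDerivAt t h1

lemma Sm.px_eq (hf : Sm f) (t x : ℝ) :
    px f t x = fderiv ℝ (Function.uncurry f) (t, x) (0, 1) :=
  (hf.hasDerivAt_x_fderiv t x).deriv

lemma Sm.pt_eq (hf : Sm f) (t x : ℝ) :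
    pt f t x = fderiv ℝ (Function.uncurry f) (t, x) (1, 0) :=
  (hf.hasDerivAt_t_fderiv t x).deriv

lemma Sm.hasDerivAt_x (hf : Sm f) (t x : ℝ) : HasDerivAt (f t) (px f t x) x := by
  rw [hf.px_eq]; exact hf.hasDerivAt_x_fderiv t x

lemma Sm.hasDerivAt_t (hf : Sm f) (t x : ℝ) :
    HasDerivAt (fun s => f s x) (pt f t x) t := by
  rw [hf.pt_eq]; exact hf.hasDerivAt_t_fderiv t x

lemma Sm.dir (hf : Sm f) (v : ℝ × ℝ) :
    ContDiff ℝ (⊤ : ℕ∞) (fun p => fderiv ℝ (Function.uncurry f) p v) := by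
  have h : ContDiff ℝ (⊤ : ℕ∞) (fderiv ℝ (Function.uncurry f)) :=
    ContDiff.fderiv_right hf (by simp)
  exact h.clm_apply contDiff_const

lemma Sm.px (hf : Sm f) : Sm (px f) := by
  have : Function.uncurry (GKdV.px f) = fun p => fderiv ℝ (Function.uncurry f) p (0, 1) := by
    ext ⟨t, x⟩; exact hf.px_eq t x
  unfold Sm; rw [this]; exact hf.dir _

lemma Sm.pt (hf : Sm f) : Sm (pt f) := by
  have : Function.uncurry (GKdV.pt f) = fun p => fderiv ℝ (Function.uncurry f) p (1, 0) := by
    ext ⟨t, x⟩; exact hf.pt_eq t x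
  unfold Sm; rw [this]; exact hf.dir _

lemma Sm.pt_px (hf : Sm f) : GKdV.pt (GKdV.px f) = GKdV.px (GKdV.pt f) := by
  ext t x
  have e1 : Function.uncurry (GKdV.px f) = fun p => fderiv ℝ (Function.uncurry f) p (0, 1) := by
    ext ⟨t, x⟩; exact hf.px_eq t x
  have e2 : Function.uncurry (GKdV.pt f) = fun p => fderiv ℝ (Function.uncurry f) p (1, 0) := by
    ext ⟨t, x⟩; exact hf.pt_eq t x
  rw [hf.px.pt_eq, hf.pt.px_eq, e1, e2]
  have hd : DifferentiableAt ℝ (fderiv ℝ (Function.uncurry f)) (t, x) := by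
    have h : ContDiff ℝ (⊤ : ℕ∞) (fderiv ℝ (Function.uncurry f)) :=
      ContDiff.fderiv_right hf (by simp)
    exact (h.differentiable (by simp)) _
  have hs : IsSymmSndFDerivAt ℝ (Function.uncurry f) (t, x) :=
    ContDiffAt.isSymmSndFDerivAt (n := (⊤ : ℕ∞)) (ContDiff.contDiffAt hf)
      (by simpa using WithTop.coe_le_coe.2 (le_top : (2 : ℕ∞) ≤ ⊤))
  rw [fderiv_clm_apply hd (differentiableAt_const _),
    fderiv_clm_apply hd (differentiableAt_const _)]
  simpa using hs (1, 0) (0, 1)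

lemma Sm.cont (hf : Sm f) : Continuous (Function.uncurry f) := hf.continuous

lemma Sm.cont_x (hf : Sm f) (t : ℝ) : Continuous (f t) :=
  hf.cont.comp (by fun_prop : Continuous fun x : ℝ => (t, x))

lemma Sm.cont_t (hf : Sm f) (x : ℝ) : Continuous (fun t => f t x) :=
  hf.cont.comp (by fun_prop : Continuous fun t : ℝ => (t, x))

lemma Sm.add (hf : Sm f) (hg : Sm g) : Sm (fun t x => f t x + g t x) := ContDiff.add hf hg
lemma Sm.sub (hf : Sm f) (hg : Sm g) : Sm (fun t x => f t x - g t x) := ContDiff.sub hf hg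
lemma Sm.mul (hf : Sm f) (hg : Sm g) : Sm (fun t x => f t x * g t x) := ContDiff.mul hf hg
lemma Sm.pow (hf : Sm f) (n : ℕ) : Sm (fun t x => f t x ^ n) := ContDiff.pow hf n
lemma Sm.const (a : ℝ) : Sm (fun _ _ => a) := contDiff_const
lemma Sm.const_mul (a : ℝ) (hf : Sm f) : Sm (fun t x => a * f t x) := ContDiff.mul contDiff_const hf
lemma Sm.of_t {a : ℝ → ℝ} (ha : ContDiff ℝ (⊤ : ℕ∞) a) : Sm (fun t _ => a t) :=
  ContDiff.comp ha contDiff_fst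

/-- Composition with an affine change of variables. -/
lemma Sm.affine (hf : Sm f) (a b m k y : ℝ) :
    Sm (fun t x => f (a * t + b) (k * x + m * t + y)) := by
  have : ContDiff ℝ (⊤ : ℕ∞) (fun p : ℝ × ℝ => (a * p.1 + b, k * p.2 + m * p.1 + y)) := by
    fun_prop
  exact ContDiff.comp hf this

lemma Sm.affine_x (hf : Sm f) (a b m k y t x : ℝ) :
    HasDerivAt (fun x => f (a * t + b) (k * x + m * t + y))
      (k * GKdV.px f (a * t + b) (k * x + m * t + y)) x := by
  have h := hf.hasDerivAt_x (a * t + b) (k * x + m * t + y)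
  have h2 : HasDerivAt (fun x => k * x + m * t + y) k x := by
    simpa using (((hasDerivAt_id x).const_mul k).add_const (m * t)).add_const y
  have h3 := h.comp x h2

  exact h3.congr_deriv (mul_comm _ _)

lemma Sm.affine_t (hf : Sm f) (a b m k y t x : ℝ) :
    HasDerivAt (fun t => f (a * t + b) (k * x + m * t + y))
      (a * GKdV.pt f (a * t + b) (k * x + m * t + y)
        + m * GKdV.px f (a * t + b) (k * x + m * t + y)) t := by
  have h1 : HasDerivAt (fun t : ℝ => (a * t + b, k * x + m * t + y)) (a, m) t := by
    have e1 : HasDerivAt (fun t : ℝ => a * t + b) a t := by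
      simpa using ((hasDerivAt_id t).const_mul a).add_const b
    have e2 : HasDerivAt (fun t : ℝ => k * x + m * t + y) m t := by
      simpa using (((hasDerivAt_id t).const_mul m).const_add (k * x)).add_const y
    exact e1.prodMk e2
  have h := (hf.diff (a * t + b, k * x + m * t + y)).hasFDerivAt.comp_hasDerivAt t h1
  have e : ((a, m) : ℝ × ℝ) = a • ((1 : ℝ), (0 : ℝ)) + m • ((0 : ℝ), (1 : ℝ)) := by
    simp
  rw [hf.pt_eq, hf.px_eq]
  rw [e, map_add, map_smul, map_smul] at h
  exact h

end GKdV

namespace GKdV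

lemma integrable_of_compact {f : ℝ → ℝ} (hf : Continuous f) (R : ℝ)
    (h0 : ∀ x, R ≤ |x| → f x = 0) : Integrable f := by
  refine hf.integrable_of_hasCompactSupport ?_
  refine HasCompactSupport.of_support_subset_isCompact (isCompact_Icc (a := -R) (b := R)) ?_
  intro x hx
  by_contra h
  refine hx (h0 x ?_)
  by_contra h2
  push Not at h2
  exact h ⟨by linarith [neg_abs_le x], by linarith [le_abs_self x]⟩

lemma ibp_compact {F F' W W' : ℝ → ℝ} (hF : ∀ x, HasDerivAt F (F' x) x) (hF' : Continuous F')
    (hW : ∀ x, HasDerivAt W (W' x) x) (hW' : Continuous W') (R : ℝ)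
    (h0 : ∀ x, R ≤ |x| → W x = 0) (h1 : ∀ x, R ≤ |x| → W' x = 0) :
    ∫ x, F' x * W x = - ∫ x, F x * W' x := by
  have cF : Continuous F := continuous_iff_continuousAt.2 fun x => (hF x).continuousAt
  have cW : Continuous W := continuous_iff_continuousAt.2 fun x => (hW x).continuousAt
  have i1 : Integrable (F * W') :=
    integrable_of_compact (cF.mul hW') R fun x hx => by simp [h1 x hx]
  have i2 : Integrable (F' * W) :=
    integrable_of_compact (hF'.mul cW) R fun x hx => by simp [h0 x hx]
  have i3 : Integrable (F * W) :=
    integrable_of_compact (cF.mul cW) R fun x hx => by simp [h0 x hx]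
  have := integral_mul_deriv_eq_deriv_mul_of_integrable (fun x _ => hF x) (fun x _ => hW x) i1 i2 i3
  rw [this, neg_neg]

/-- A weight together with its first three derivatives, all bounded. -/
structure Wt (φ0 φ1 φ2 φ3 : ℝ → ℝ) : Prop where
  d0 : ∀ x, HasDerivAt φ0 (φ1 x) x
  d1 : ∀ x, HasDerivAt φ1 (φ2 x) x
  d2 : ∀ x, HasDerivAt φ2 (φ3 x) x
  c3 : Continuous φ3
  bdd : ∃ C, ∀ x, |φ0 x| ≤ C ∧ |φ1 x| ≤ C ∧ |φ2 x| ≤ C ∧ |φ3 x| ≤ C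

lemma Wt.c0 {φ0 φ1 φ2 φ3 : ℝ → ℝ} (h : Wt φ0 φ1 φ2 φ3) : Continuous φ0 :=
  continuous_iff_continuousAt.2 fun x => (h.d0 x).continuousAt
lemma Wt.c1 {φ0 φ1 φ2 φ3 : ℝ → ℝ} (h : Wt φ0 φ1 φ2 φ3) : Continuous φ1 :=
  continuous_iff_continuousAt.2 fun x => (h.d1 x).continuousAt
lemma Wt.c2 {φ0 φ1 φ2 φ3 : ℝ → ℝ} (h : Wt φ0 φ1 φ2 φ3) : Continuous φ2 :=
  continuous_iff_continuousAt.2 fun x => (h.d2 x).continuousAt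

/-- A density `D` with `∂ₜD = B0 + ∂ₓB1 + ∂ₓ²B2 + ∂ₓ³B3`. -/
structure CLaw (D B0 B1 B2 B3 : ℝ → ℝ → ℝ) : Prop where
  sD : Sm D
  s0 : Sm B0
  s1 : Sm B1
  s2 : Sm B2
  s3 : Sm B3
  eq : ∀ t x, pt D t x = B0 t x + px B1 t x + px (px B2) t x + px (px (px B3)) t x

variable {D B0 B1 B2 B3 : ℝ → ℝ → ℝ} {φ0 φ1 φ2 φ3 : ℝ → ℝ}

lemma CLaw.compact (h : CLaw D B0 B1 B2 B3) (w : Wt φ0 φ1 φ2 φ3) (R : ℝ)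
    (z0 : ∀ x, R ≤ |x| → φ0 x = 0) (z1 : ∀ x, R ≤ |x| → φ1 x = 0)
    (z2 : ∀ x, R ≤ |x| → φ2 x = 0) (z3 : ∀ x, R ≤ |x| → φ3 x = 0) (a b : ℝ) :
    (∫ x, D b x * φ0 x) - ∫ x, D a x * φ0 x =
      ∫ t in a..b, ∫ x, (B0 t x * φ0 x - B1 t x * φ1 x + B2 t x * φ2 x - B3 t x * φ3 x) := by
  have step : ∀ t, ∫ x, pt D t x * φ0 x =
      ∫ x, (B0 t x * φ0 x - B1 t x * φ1 x + B2 t x * φ2 x - B3 t x * φ3 x) := by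
    intro t
    have e1 := ibp_compact (h.s1.hasDerivAt_x t) (h.s1.px.cont_x t) w.d0 w.c1 R z0 z1
    have e2 := ibp_compact (h.s2.px.hasDerivAt_x t) (h.s2.px.px.cont_x t) w.d0 w.c1 R z0 z1
    have e2' := ibp_compact (h.s2.hasDerivAt_x t) (h.s2.px.cont_x t) w.d1 w.c2 R z1 z2
    have e3 := ibp_compact (h.s3.px.px.hasDerivAt_x t) (h.s3.px.px.px.cont_x t) w.d0 w.c1 R z0 z1
    have e3' := ibp_compact (h.s3.px.hasDerivAt_x t) (h.s3.px.px.cont_x t) w.d1 w.c2 R z1 z2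
    have e3'' := ibp_compact (h.s3.hasDerivAt_x t) (h.s3.px.cont_x t) w.d2 w.c3 R z2 z3
    have I : ∀ (f ψ : ℝ → ℝ), Continuous f → Continuous ψ → (∀ x, R ≤ |x| → ψ x = 0) →
        Integrable (fun x => f x * ψ x) := fun f ψ hf hψ h0 =>
      integrable_of_compact (hf.mul hψ) R fun x hx => by simp [h0 x hx]
    have i0 := I _ _ (h.s0.cont_x t) w.c0 z0
    have i1 := I _ _ (h.s1.cont_x t) w.c1 z1
    have i2 := I _ _ (h.s2.cont_x t) w.c2 z2
    have i3 := I _ _ (h.s3.cont_x t) w.c3 z3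
    have j1 := I _ _ (h.s1.px.cont_x t) w.c0 z0
    have j2 := I _ _ (h.s2.px.px.cont_x t) w.c0 z0
    have j3 := I _ _ (h.s3.px.px.px.cont_x t) w.c0 z0
    have s01 : Integrable (fun x => B0 t x * φ0 x - B1 t x * φ1 x) := i0.sub i1
    have s012 : Integrable (fun x => B0 t x * φ0 x - B1 t x * φ1 x + B2 t x * φ2 x) := s01.add i2
    have t01 : Integrable (fun x => B0 t x * φ0 x + px B1 t x * φ0 x) := i0.add j1
    have t012 : Integrable (fun x => B0 t x * φ0 x + px B1 t x * φ0 x + px (px B2) t x * φ0 x) :=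
      t01.add j2
    rw [integral_sub s012 i3, integral_add s01 i2, integral_sub i0 i1]
    have : ∀ x, pt D t x * φ0 x = B0 t x * φ0 x + px B1 t x * φ0 x + px (px B2) t x * φ0 x
        + px (px (px B3)) t x * φ0 x := fun x => by rw [h.eq]; ring
    rw [integral_congr_ae (Eventually.of_forall this), integral_add t012 j3, integral_add t01 j2,
      integral_add i0 j1]
    linarith
  simp_rw [← step]
  have cpt : Continuous (Function.uncurry fun t x => pt D t x * φ0 x) :=
    h.sD.pt.cont.mul (w.c0.comp continuous_snd)
  rw [intervalIntegral_integral_swap, ← integral_sub]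
  · refine integral_congr_ae (Eventually.of_forall fun x => ?_)
    have : ∫ t in a..b, pt D t x = D b x - D a x :=
      intervalIntegral.integral_eq_sub_of_hasDerivAt (fun t _ => h.sD.hasDerivAt_t t x)
        ((h.sD.pt.cont_t x).intervalIntegrable _ _)
    simp only [intervalIntegral.integral_mul_const, this]
    ring
  · exact integrable_of_compact ((h.sD.cont_x b).mul w.c0) R fun x hx => by simp [z0 x hx]
  · exact integrable_of_compact ((h.sD.cont_x a).mul w.c0) R fun x hx => by simp [z0 x hx]
  · have hK : IsCompact (Set.uIcc a b ×ˢ Set.Icc (-R) R) := isCompact_uIcc.prod isCompact_Icc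
    have h1 := cpt.continuousOn.integrableOn_compact (μ := (volume : Measure (ℝ × ℝ))) hK
    have h2 : IntegrableOn (Function.uncurry fun t x => pt D t x * φ0 x)
        (Set.uIcc a b ×ˢ Set.univ) := by
      refine h1.of_forall_sdiff_eq_zero (measurableSet_uIcc.prod MeasurableSet.univ) ?_
      rintro ⟨t, x⟩ ⟨⟨h1, -⟩, h2⟩
      have : R ≤ |x| := by
        by_contra h3
        push Not at h3
        exact h2 ⟨h1, by linarith [neg_abs_le x], by linarith [le_abs_self x]⟩
      simp [z0 x this]
    have h3 := h2.mono_set (Set.prod_mono_left Set.uIoc_subset_uIcc (t := Set.univ))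
    rwa [IntegrableOn, Measure.volume_eq_prod, ← Measure.prod_restrict,
      Measure.restrict_univ] at h3

/-- A smooth compactly supported cutoff with all the derivatives needed. -/
lemma exists_cutoff : ∃ χ0 χ1 χ2 χ3 : ℝ → ℝ, Wt χ0 χ1 χ2 χ3 ∧
    (∀ x, 2 ≤ |x| → χ0 x = 0 ∧ χ1 x = 0 ∧ χ2 x = 0 ∧ χ3 x = 0) ∧ χ0 0 = 1 := by
  let b : ContDiffBump (0 : ℝ) := ⟨1, 3 / 2, by norm_num, by norm_num⟩
  have hb : ContDiff ℝ (⊤ : ℕ∞) b := b.contDiff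
  have hs : HasCompactSupport b := b.hasCompactSupport
  have ht : ∀ x : ℝ, 2 ≤ |x| → x ∉ tsupport b := by
    intro x hx h
    rw [b.tsupport_eq, Metric.mem_closedBall, Real.dist_eq] at h
    simp only [sub_zero] at h
    change |x| ≤ 3 / 2 at h
    linarith
  have hk : ∀ k : ℕ, Differentiable ℝ (deriv^[k] b) := fun k => by
    rw [← iteratedDeriv_eq_iterate]
    exact hb.differentiable_iteratedDeriv k (by exact_mod_cast WithTop.coe_lt_top k)
  have hz : ∀ (k : ℕ) (x : ℝ), 2 ≤ |x| → deriv^[k] b x = 0 := fun k x hx => by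
    have hsub : tsupport (deriv^[k] b) ⊆ tsupport b := by
      induction k with
      | zero => exact subset_rfl
      | succ k ih =>
        rw [Function.iterate_succ_apply']
        exact (closure_minimal support_deriv_subset isClosed_closure).trans ih
    by_contra h
    exact ht x hx (hsub (subset_closure h))
  have hB : ∀ k : ℕ, ∃ C, ∀ x, |deriv^[k] b x| ≤ C := fun k => by
    have hc : HasCompactSupport (deriv^[k] b) := by
      refine HasCompactSupport.of_support_subset_isCompact (isCompact_Icc (a := -2) (b := (2 : ℝ))) ?_
      intro x hx
      by_contra h
      refine hx (hz k x ?_)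
      by_contra h2
      push Not at h2
      exact h ⟨by linarith [neg_abs_le x], by linarith [le_abs_self x]⟩
    obtain ⟨C, hC⟩ := (hk k).continuous.bounded_above_of_compact_support hc
    exact ⟨C, fun x => by simpa using hC x⟩
  have hd : ∀ (k : ℕ) (x : ℝ), HasDerivAt (deriv^[k] b) (deriv^[k + 1] b x) x := fun k x => by
    rw [Function.iterate_succ_apply']
    exact (hk k x).hasDerivAt
  obtain ⟨C0, h0⟩ := hB 0
  obtain ⟨C1, h1⟩ := hB 1
  obtain ⟨C2, h2⟩ := hB 2
  obtain ⟨C3, h3⟩ := hB 3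
  refine ⟨deriv^[0] b, deriv^[1] b, deriv^[2] b, deriv^[3] b,
    ⟨hd 0, hd 1, hd 2, (hk 3).continuous, max (max C0 C1) (max C2 C3), fun x =>
      ⟨(h0 x).trans (by simp), (h1 x).trans (by simp), (h2 x).trans (by simp),
        (h3 x).trans (by simp)⟩⟩,
    fun x hx => ⟨hz 0 x hx, hz 1 x hx, hz 2 x hx, hz 3 x hx⟩, ?_⟩
  exact b.one_of_mem_closedBall (by simp [b.rIn_pos.le])

end GKdV

namespace GKdV

/-- Uniform integrability bound in space on a time interval. -/
def BddL1 (B : ℝ → ℝ → ℝ) (a b : ℝ) : Prop :=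
  ∃ C, ∀ t ∈ Set.Icc a b, Integrable (B t) ∧ ∫ x, |B t x| ≤ C

lemma BddL1.add {f g : ℝ → ℝ → ℝ} {a b : ℝ} (hf : BddL1 f a b) (hg : BddL1 g a b) :
    BddL1 (fun t x => f t x + g t x) a b := by
  obtain ⟨C, hC⟩ := hf
  obtain ⟨C', hC'⟩ := hg
  refine ⟨C + C', fun t ht => ⟨(hC t ht).1.add (hC' t ht).1, ?_⟩⟩
  refine (integral_mono ((hC t ht).1.add (hC' t ht).1).abs
    ((hC t ht).1.abs.add (hC' t ht).1.abs) fun x => abs_add_le _ _).trans ?_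
  simp only [Pi.add_apply]
  rw [integral_add (hC t ht).1.abs (hC' t ht).1.abs]
  exact add_le_add (hC t ht).2 (hC' t ht).2

lemma BddL1.of_le {f g : ℝ → ℝ → ℝ} {a b : ℝ} (hg : BddL1 g a b) (hf : ∀ t, Continuous (f t))
    (K : ℝ) (h : ∀ t ∈ Set.Icc a b, ∀ x, |f t x| ≤ K * |g t x|) : BddL1 f a b := by
  obtain ⟨C, hC⟩ := hg
  refine ⟨max K 0 * C, fun t ht => ?_⟩
  have i1 : Integrable (fun x => K * |g t x|) := (hC t ht).1.abs.const_mul K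
  have i2 : Integrable (f t) := i1.mono' (hf t).aestronglyMeasurable
    (Eventually.of_forall fun x => by simpa using h t ht x)
  refine ⟨i2, (integral_mono i2.abs i1 (h t ht)).trans ?_⟩
  rw [integral_const_mul]
  have h0 : 0 ≤ ∫ x, |g t x| := integral_nonneg fun x => abs_nonneg _
  calc K * ∫ x, |g t x| ≤ max K 0 * ∫ x, |g t x| := by gcongr; exact le_max_left _ _
    _ ≤ _ := by gcongr; exact (hC t ht).2

lemma BddL1.zero (a b : ℝ) : BddL1 (fun _ _ => 0) a b := ⟨0, fun t _ => by simp⟩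

variable {D B0 B1 B2 B3 : ℝ → ℝ → ℝ} {φ0 φ1 φ2 φ3 : ℝ → ℝ}

lemma CLaw.global (h : CLaw D B0 B1 B2 B3) (w : Wt φ0 φ1 φ2 φ3) {a b : ℝ} (hab : a ≤ b)
    (iDa : Integrable (D a)) (iDb : Integrable (D b)) (b0 : BddL1 B0 a b) (b1 : BddL1 B1 a b)
    (b2 : BddL1 B2 a b) (b3 : BddL1 B3 a b) :
    (∫ x, D b x * φ0 x) - ∫ x, D a x * φ0 x =
      ∫ t in a..b, ∫ x, (B0 t x * φ0 x - B1 t x * φ1 x + B2 t x * φ2 x - B3 t x * φ3 x) := by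
  obtain ⟨χ0, χ1, χ2, χ3, hχ, hz, h1⟩ := exists_cutoff
  obtain ⟨K, hK⟩ := w.bdd
  obtain ⟨L, hL⟩ := hχ.bdd
  have hK0 : 0 ≤ K := (abs_nonneg _).trans (hK 0).1
  have hL0 : 0 ≤ L := (abs_nonneg _).trans (hL 0).1
  let r : ℕ → ℝ := fun n => 1 / ((n : ℝ) + 1)
  have r0 : ∀ n, 0 < r n := fun n => by positivity
  have r1 : ∀ n, r n ≤ 1 := fun n => by
    rw [div_le_one (by positivity)]; linarith [(Nat.cast_nonneg n : (0 : ℝ) ≤ n)]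
  have rt : Tendsto r atTop (nhds 0) := tendsto_one_div_add_atTop_nhds_zero_nat
  let W0 : ℕ → ℝ → ℝ := fun n x => φ0 x * χ0 (r n * x)
  let W1 : ℕ → ℝ → ℝ := fun n x => φ1 x * χ0 (r n * x) + r n * (φ0 x * χ1 (r n * x))
  let W2 : ℕ → ℝ → ℝ := fun n x => φ2 x * χ0 (r n * x) + r n * (2 * (φ1 x * χ1 (r n * x))) +
    r n ^ 2 * (φ0 x * χ2 (r n * x))
  let W3 : ℕ → ℝ → ℝ := fun n x => φ3 x * χ0 (r n * x) + r n * (3 * (φ2 x * χ1 (r n * x))) +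
    r n ^ 2 * (3 * (φ1 x * χ2 (r n * x))) + r n ^ 3 * (φ0 x * χ3 (r n * x))
  have lin : ∀ n x, HasDerivAt (fun x => r n * x) (r n) x := fun n x => by
    simpa using (hasDerivAt_id x).const_mul (r n)
  have e0 : ∀ n x, HasDerivAt (fun x => χ0 (r n * x)) (χ1 (r n * x) * r n) x := fun n x =>
    (hχ.d0 _).comp x (lin n x)
  have e1 : ∀ n x, HasDerivAt (fun x => χ1 (r n * x)) (χ2 (r n * x) * r n) x := fun n x =>
    (hχ.d1 _).comp x (lin n x)
  have e2 : ∀ n x, HasDerivAt (fun x => χ2 (r n * x)) (χ3 (r n * x) * r n) x := fun n x =>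
    (hχ.d2 _).comp x (lin n x)
  have ab : ∀ (A B : ℝ), |A| ≤ K → |B| ≤ L → |A * B| ≤ K * L := fun A B hA hB => by
    rw [abs_mul]; exact mul_le_mul hA hB (abs_nonneg _) hK0
  have rr : ∀ (k n : ℕ) (A : ℝ), |r n ^ k * A| ≤ |A| := fun k n A => by
    rw [abs_mul, abs_pow, abs_of_pos (r0 n)]
    exact mul_le_of_le_one_left (abs_nonneg _) (pow_le_one₀ (r0 n).le (r1 n))
  have bW0 : ∀ n x, |W0 n x| ≤ 8 * (K * L) := fun n x => by
    have := ab _ _ (hK x).1 (hL (r n * x)).1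
    have : 0 ≤ K * L := by positivity
    linarith
  have bW1 : ∀ n x, |W1 n x| ≤ 8 * (K * L) := fun n x => by
    have h1 := ab _ _ (hK x).2.1 (hL (r n * x)).1
    have h2 := ab _ _ (hK x).1 (hL (r n * x)).2.1
    have h3 := rr 1 n (φ0 x * χ1 (r n * x))
    rw [pow_one] at h3
    have : 0 ≤ K * L := by positivity
    refine (abs_add_le _ _).trans ?_
    linarith
  have bW2 : ∀ n x, |W2 n x| ≤ 8 * (K * L) := fun n x => by
    have h1 := ab _ _ (hK x).2.2.1 (hL (r n * x)).1
    have h2 := ab _ _ (hK x).2.1 (hL (r n * x)).2.1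
    have h3 := ab _ _ (hK x).1 (hL (r n * x)).2.2.1
    have h4 := rr 1 n (2 * (φ1 x * χ1 (r n * x)))
    have h5 := rr 2 n (φ0 x * χ2 (r n * x))
    rw [pow_one, abs_mul 2, abs_two] at h4
    have : 0 ≤ K * L := by positivity
    refine (abs_add_three _ _ _).trans ?_
    linarith
  have bW3 : ∀ n x, |W3 n x| ≤ 8 * (K * L) := fun n x => by
    have h1 := ab _ _ (hK x).2.2.2 (hL (r n * x)).1
    have h2 := ab _ _ (hK x).2.2.1 (hL (r n * x)).2.1
    have h3 := ab _ _ (hK x).2.1 (hL (r n * x)).2.2.1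
    have h3' := ab _ _ (hK x).1 (hL (r n * x)).2.2.2
    have h4 := rr 1 n (3 * (φ2 x * χ1 (r n * x)))
    have h5 := rr 2 n (3 * (φ1 x * χ2 (r n * x)))
    have h6 := rr 3 n (φ0 x * χ3 (r n * x))
    have n3 : |(3 : ℝ)| = 3 := by norm_num
    rw [pow_one, abs_mul 3, n3] at h4
    rw [abs_mul 3, n3] at h5
    refine (abs_add_le _ _).trans ?_
    refine (add_le_add_left (abs_add_three _ _ _) _).trans ?_
    linarith
  have wW : ∀ n, Wt (W0 n) (W1 n) (W2 n) (W3 n) := fun n => by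
    refine ⟨fun x => ?_, fun x => ?_, fun x => ?_, ?_, _, fun x =>
      ⟨bW0 n x, bW1 n x, bW2 n x, bW3 n x⟩⟩
    · exact ((w.d0 x).mul (e0 n x)).congr_deriv (by simp only [W1]; ring)
    · exact (((w.d1 x).mul (e0 n x)).add (((w.d0 x).mul (e1 n x)).const_mul (r n))).congr_deriv
        (by simp only [W2]; ring)
    · exact ((((w.d2 x).mul (e0 n x)).add ((((w.d1 x).mul (e1 n x)).const_mul 2).const_mul
        (r n))).add (((w.d0 x).mul (e2 n x)).const_mul (r n ^ 2))).congr_deriv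
        (by simp only [W3]; ring)
    · have := w.c0; have := w.c1; have := w.c2; have := w.c3
      have := hχ.c0; have := hχ.c1; have := hχ.c2; have := hχ.c3
      fun_prop
  have zz : ∀ n x, 2 / r n ≤ |x| → 2 ≤ |r n * x| := fun n x hx => by
    rw [abs_mul, abs_of_pos (r0 n)]
    rwa [div_le_iff₀' (r0 n)] at hx
  have key : ∀ n, (∫ x, D b x * W0 n x) - ∫ x, D a x * W0 n x =
      ∫ t in a..b, ∫ x, (B0 t x * W0 n x - B1 t x * W1 n x + B2 t x * W2 n x - B3 t x * W3 n x) := by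
    intro n
    refine h.compact (wW n) (2 / r n) ?_ ?_ ?_ ?_ a b <;> intro x hx <;>
    obtain ⟨q0, q1, q2, q3⟩ := hz _ (zz n x hx)
    · simp [W0, q0]
    · simp [W1, q0, q1]
    · simp [W2, q0, q1, q2]
    · simp [W3, q0, q1, q2, q3]
  have tr : ∀ x, Tendsto (fun n => r n * x) atTop (nhds 0) := fun x => by
    simpa using rt.mul_const x
  have tχ : ∀ x, Tendsto (fun n => χ0 (r n * x)) atTop (nhds 1) := fun x => by
    have := (hχ.c0.tendsto 0).comp (tr x); rwa [h1] at this
  have tz : ∀ (k : ℕ) (A : ℕ → ℝ), k ≠ 0 → (∃ C, ∀ n, |A n| ≤ C) →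
      Tendsto (fun n => r n ^ k * A n) atTop (nhds 0) := by
    rintro k A hk ⟨C, hC⟩
    have h1 : Tendsto (fun n => r n ^ k) atTop (nhds 0) := by
      simpa [hk] using rt.pow k
    have h2 : Tendsto (fun n => r n ^ k * C) atTop (nhds 0) := by simpa using h1.mul_const C
    refine squeeze_zero_norm (fun n => ?_) h2
    rw [norm_mul, norm_pow, Real.norm_eq_abs, Real.norm_eq_abs, abs_of_pos (r0 n)]
    exact mul_le_mul_of_nonneg_left (hC n) (by have := r0 n; positivity)
  have t0 : ∀ x, Tendsto (fun n => W0 n x) atTop (nhds (φ0 x)) := fun x => by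
    simpa using (tχ x).const_mul (φ0 x)
  have t1 : ∀ x, Tendsto (fun n => W1 n x) atTop (nhds (φ1 x)) := fun x => by
    have := tz 1 (fun n => φ0 x * χ1 (r n * x)) one_ne_zero
      ⟨_, fun n => ab _ _ (hK x).1 (hL (r n * x)).2.1⟩
    simpa using ((tχ x).const_mul (φ1 x)).add this
  have t2 : ∀ x, Tendsto (fun n => W2 n x) atTop (nhds (φ2 x)) := fun x => by
    have q1 := (tz 1 (fun n => φ1 x * χ1 (r n * x)) one_ne_zero
      ⟨_, fun n => ab _ _ (hK x).2.1 (hL (r n * x)).2.1⟩).const_mul 2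
    have q2 := tz 2 (fun n => φ0 x * χ2 (r n * x)) two_ne_zero
      ⟨_, fun n => ab _ _ (hK x).1 (hL (r n * x)).2.2.1⟩
    have := (((tχ x).const_mul (φ2 x)).add q1).add q2
    simp only [mul_one, mul_zero, add_zero] at this
    refine this.congr fun n => ?_
    simp only [W2]; ring
  have t3 : ∀ x, Tendsto (fun n => W3 n x) atTop (nhds (φ3 x)) := fun x => by
    have q1 := (tz 1 (fun n => φ2 x * χ1 (r n * x)) one_ne_zero
      ⟨_, fun n => ab _ _ (hK x).2.2.1 (hL (r n * x)).2.1⟩).const_mul 3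
    have q2 := (tz 2 (fun n => φ1 x * χ2 (r n * x)) two_ne_zero
      ⟨_, fun n => ab _ _ (hK x).2.1 (hL (r n * x)).2.2.1⟩).const_mul 3
    have q3 := tz 3 (fun n => φ0 x * χ3 (r n * x)) three_ne_zero
      ⟨_, fun n => ab _ _ (hK x).1 (hL (r n * x)).2.2.2⟩
    have := ((((tχ x).const_mul (φ3 x)).add q1).add q2).add q3
    simp only [mul_one, mul_zero, add_zero] at this
    refine this.congr fun n => ?_
    simp only [W3]; ring
  have limD : ∀ t, Integrable (D t) →
      Tendsto (fun n => ∫ x, D t x * W0 n x) atTop (nhds (∫ x, D t x * φ0 x)) := by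
    intro t ht
    refine tendsto_integral_of_dominated_convergence (fun x => |D t x| * (8 * (K * L)))
      (fun n => ((h.sD.cont_x t).mul (wW n).c0).aestronglyMeasurable) (ht.abs.mul_const _)
      (fun n => Eventually.of_forall fun x => ?_)
      (Eventually.of_forall fun x => (t0 x).const_mul _)
    rw [norm_mul, Real.norm_eq_abs, Real.norm_eq_abs]
    exact mul_le_mul_of_nonneg_left (bW0 n x) (abs_nonneg _)
  obtain ⟨C0, hC0⟩ := b0
  obtain ⟨C1, hC1⟩ := b1
  obtain ⟨C2, hC2⟩ := b2
  obtain ⟨C3, hC3⟩ := b3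
  have gb : ∀ n t x, ‖B0 t x * W0 n x - B1 t x * W1 n x + B2 t x * W2 n x - B3 t x * W3 n x‖ ≤
      (|B0 t x| + |B1 t x| + |B2 t x| + |B3 t x|) * (8 * (K * L)) := by
    intro n t x
    have m0 := mul_le_mul_of_nonneg_left (bW0 n x) (abs_nonneg (B0 t x))
    have m1 := mul_le_mul_of_nonneg_left (bW1 n x) (abs_nonneg (B1 t x))
    have m2 := mul_le_mul_of_nonneg_left (bW2 n x) (abs_nonneg (B2 t x))
    have m3 := mul_le_mul_of_nonneg_left (bW3 n x) (abs_nonneg (B3 t x))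
    rw [← abs_mul] at m0 m1 m2 m3
    rw [Real.norm_eq_abs, abs_le]
    rw [abs_le] at m0 m1 m2 m3
    constructor <;> nlinarith
  have gi : ∀ t ∈ Set.Icc a b,
      Integrable (fun x => (|B0 t x| + |B1 t x| + |B2 t x| + |B3 t x|) * (8 * (K * L))) :=
    fun t ht => ((((hC0 t ht).1.abs.add (hC1 t ht).1.abs).add (hC2 t ht).1.abs).add
      (hC3 t ht).1.abs).mul_const _
  have limR : Tendsto (fun n => ∫ t in a..b, ∫ x,
      (B0 t x * W0 n x - B1 t x * W1 n x + B2 t x * W2 n x - B3 t x * W3 n x)) atTop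
      (nhds (∫ t in a..b, ∫ x,
        (B0 t x * φ0 x - B1 t x * φ1 x + B2 t x * φ2 x - B3 t x * φ3 x))) := by
    refine intervalIntegral.tendsto_integral_filter_of_dominated_convergence
      (fun _ => (C0 + C1 + C2 + C3) * (8 * (K * L))) ?_ ?_ ?_ ?_
    · refine Eventually.of_forall fun n => ?_
      have c : Continuous (Function.uncurry fun t x =>
          B0 t x * W0 n x - B1 t x * W1 n x + B2 t x * W2 n x - B3 t x * W3 n x) :=
        (((h.s0.cont.mul ((wW n).c0.comp continuous_snd)).sub
          (h.s1.cont.mul ((wW n).c1.comp continuous_snd))).add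
          (h.s2.cont.mul ((wW n).c2.comp continuous_snd))).sub
          (h.s3.cont.mul ((wW n).c3.comp continuous_snd))
      exact c.stronglyMeasurable.integral_prod_right'.aestronglyMeasurable
    · refine Eventually.of_forall fun n => Eventually.of_forall fun t ht => ?_
      rw [Set.uIoc_of_le hab] at ht
      have ht' : t ∈ Set.Icc a b := Set.Ioc_subset_Icc_self ht
      refine (norm_integral_le_of_norm_le (gi t ht') (Eventually.of_forall (gb n t))).trans ?_
      have i1 : Integrable (fun x => |B0 t x| + |B1 t x|) := (hC0 t ht').1.abs.add (hC1 t ht').1.abs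
      have i2 : Integrable (fun x => |B0 t x| + |B1 t x| + |B2 t x|) := i1.add (hC2 t ht').1.abs
      rw [integral_mul_const, integral_add i2 (hC3 t ht').1.abs, integral_add i1 (hC2 t ht').1.abs,
        integral_add (hC0 t ht').1.abs (hC1 t ht').1.abs]
      refine mul_le_mul_of_nonneg_right ?_ (by positivity)
      exact add_le_add (add_le_add (add_le_add (hC0 t ht').2 (hC1 t ht').2) (hC2 t ht').2)
        (hC3 t ht').2
    · exact intervalIntegrable_const
    · refine Eventually.of_forall fun t ht => ?_
      rw [Set.uIoc_of_le hab] at ht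
      have ht' : t ∈ Set.Icc a b := Set.Ioc_subset_Icc_self ht
      refine tendsto_integral_of_dominated_convergence _ (fun n => ?_) (gi t ht')
        (fun n => Eventually.of_forall (gb n t)) (Eventually.of_forall fun x => ?_)
      · exact (((((h.s0.cont_x t).mul (wW n).c0).sub ((h.s1.cont_x t).mul (wW n).c1)).add
          ((h.s2.cont_x t).mul (wW n).c2)).sub
          ((h.s3.cont_x t).mul (wW n).c3)).aestronglyMeasurable
      · exact ((((t0 x).const_mul _).sub ((t1 x).const_mul _)).add ((t2 x).const_mul _)).sub
          ((t3 x).const_mul _)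
  have l2 := (limD b iDb).sub (limD a iDa)
  exact tendsto_nhds_unique (l2.congr key) limR

end GKdV

namespace GKdV

/-- `f` seen in a frame moving along `x = m t + y`. -/
def shift (f : ℝ → ℝ → ℝ) (m y : ℝ) : ℝ → ℝ → ℝ := fun t x => f t (x + (m * t + y))

lemma Sm.shift {f : ℝ → ℝ → ℝ} (hf : Sm f) (m y : ℝ) : Sm (shift f m y) := by
  have := hf.affine 1 0 m 1 y
  simp only [one_mul, add_zero, add_assoc] at this
  exact this

lemma Sm.px_shift {f : ℝ → ℝ → ℝ} (hf : Sm f) (m y : ℝ) :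
    GKdV.px (GKdV.shift f m y) = GKdV.shift (GKdV.px f) m y := by
  ext t x
  have := hf.affine_x 1 0 m 1 y t x
  simp only [one_mul, add_zero, add_assoc] at this
  exact this.deriv

lemma Sm.pt_shift {f : ℝ → ℝ → ℝ} (hf : Sm f) (m y : ℝ) (t x : ℝ) :
    GKdV.pt (GKdV.shift f m y) t x =
      GKdV.shift (GKdV.pt f) m y t x + m * GKdV.shift (GKdV.px f) m y t x := by
  have := hf.affine_t 1 0 m 1 y t x
  simp only [one_mul, add_zero, add_assoc] at this
  exact this.deriv

lemma px_add_mul {f g : ℝ → ℝ → ℝ} (hf : Sm f) (hg : Sm g) (m : ℝ) (t x : ℝ) :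
    px (fun t x => f t x + m * g t x) t x = px f t x + m * px g t x :=
  ((hf.hasDerivAt_x t x).add ((hg.hasDerivAt_x t x).const_mul m)).deriv

variable {D B0 B1 B2 B3 : ℝ → ℝ → ℝ} {φ0 φ1 φ2 φ3 : ℝ → ℝ}

lemma CLaw.moving (h : CLaw D B0 B1 B2 B3) (m y : ℝ) :
    CLaw (shift D m y) (shift B0 m y) (fun t x => shift B1 m y t x + m * shift D m y t x)
      (shift B2 m y) (shift B3 m y) := by
  refine ⟨h.sD.shift m y, h.s0.shift m y, (h.s1.shift m y).add ((h.sD.shift m y).const_mul m),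
    h.s2.shift m y, h.s3.shift m y, fun t x => ?_⟩
  rw [h.sD.pt_shift, px_add_mul (h.s1.shift m y) (h.sD.shift m y), h.s1.px_shift, h.sD.px_shift,
    h.s2.px_shift, h.s2.px.px_shift, h.s3.px_shift, h.s3.px.px_shift, h.s3.px.px.px_shift]
  simp only [GKdV.shift]
  rw [h.eq]
  ring

lemma BddL1.shift {f : ℝ → ℝ → ℝ} {a b : ℝ} (hf : BddL1 f a b) (m y : ℝ) :
    BddL1 (shift f m y) a b := by
  obtain ⟨C, hC⟩ := hf
  refine ⟨C, fun t ht => ⟨(hC t ht).1.comp_add_right _, ?_⟩⟩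
  simp only [GKdV.shift]
  rw [integral_add_right_eq_self (fun x => |f t x|)]
  exact (hC t ht).2

/-- The flux integrand of a conservation law with a weight moving along `x = m t + y`. -/
noncomputable def flux (D B0 B1 B2 B3 : ℝ → ℝ → ℝ) (φ0 φ1 φ2 φ3 : ℝ → ℝ) (m y t x : ℝ) : ℝ :=
  B0 t x * φ0 (x - (m * t + y)) - (B1 t x + m * D t x) * φ1 (x - (m * t + y)) +
    B2 t x * φ2 (x - (m * t + y)) - B3 t x * φ3 (x - (m * t + y))

lemma CLaw.le (h : CLaw D B0 B1 B2 B3) (w : Wt φ0 φ1 φ2 φ3) {a b : ℝ} (hab : a ≤ b) (m y : ℝ)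
    (bD : BddL1 D a b) (b0 : BddL1 B0 a b) (b1 : BddL1 B1 a b)
    (b2 : BddL1 B2 a b) (b3 : BddL1 B3 a b) (g : ℝ → ℝ) (hg : IntervalIntegrable g volume a b)
    (hle : ∀ t ∈ Set.Icc a b, ∫ x, flux D B0 B1 B2 B3 φ0 φ1 φ2 φ3 m y t x ≤ g t) :
    (∫ x, D b x * φ0 (x - (m * b + y))) ≤ (∫ x, D a x * φ0 (x - (m * a + y))) +
      ∫ t in a..b, g t := by
  have hm := h.moving m y
  have bD' := bD.shift m y
  have b1' : BddL1 (fun t x => GKdV.shift B1 m y t x + m * GKdV.shift D m y t x) a b :=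
    (b1.shift m y).add (bD'.of_le (fun t => ((h.sD.shift m y).const_mul m).cont_x t) |m|
      fun t _ x => by rw [abs_mul])
  have b0' := b0.shift m y
  have b2' := b2.shift m y
  have b3' := b3.shift m y
  obtain ⟨CD, hCD⟩ := bD'
  have G := hm.global w hab (hCD a ⟨le_rfl, hab⟩).1 (hCD b ⟨hab, le_rfl⟩).1 b0' b1' b2' b3'
  have tr : ∀ t, ∫ x, GKdV.shift D m y t x * φ0 x = ∫ x, D t x * φ0 (x - (m * t + y)) := fun t => by
    rw [← integral_add_right_eq_self (fun x => D t x * φ0 (x - (m * t + y))) (m * t + y)]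
    simp [GKdV.shift]
  rw [tr, tr] at G
  have tf : ∀ t, (∫ x, (GKdV.shift B0 m y t x * φ0 x -
      (GKdV.shift B1 m y t x + m * GKdV.shift D m y t x) * φ1 x +
      GKdV.shift B2 m y t x * φ2 x - GKdV.shift B3 m y t x * φ3 x)) =
      ∫ x, flux D B0 B1 B2 B3 φ0 φ1 φ2 φ3 m y t x := fun t => by
    rw [← integral_add_right_eq_self (fun x => flux D B0 B1 B2 B3 φ0 φ1 φ2 φ3 m y t x) (m * t + y)]
    simp [GKdV.shift, flux]
  simp_rw [tf] at G
  have flux_int : IntervalIntegrable (fun t => ∫ x, flux D B0 B1 B2 B3 φ0 φ1 φ2 φ3 m y t x)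
      volume a b := by
    simp_rw [← tf]
    obtain ⟨K, hK⟩ := w.bdd
    have hK0 : 0 ≤ K := (abs_nonneg _).trans (hK 0).1
    obtain ⟨C0, hC0⟩ := b0'
    obtain ⟨C1, hC1⟩ := b1'
    obtain ⟨C2, hC2⟩ := b2'
    obtain ⟨C3, hC3⟩ := b3'
    have c : Continuous (Function.uncurry fun t x => GKdV.shift B0 m y t x * φ0 x -
        (GKdV.shift B1 m y t x + m * GKdV.shift D m y t x) * φ1 x +
        GKdV.shift B2 m y t x * φ2 x - GKdV.shift B3 m y t x * φ3 x) :=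
      (((hm.s0.cont.mul (w.c0.comp continuous_snd)).sub
          (hm.s1.cont.mul (w.c1.comp continuous_snd))).add
          (hm.s2.cont.mul (w.c2.comp continuous_snd))).sub
          (hm.s3.cont.mul (w.c3.comp continuous_snd))
    rw [intervalIntegrable_iff_integrableOn_Icc_of_le hab]
    refine Measure.integrableOn_of_bounded (M := (C0 + C1 + C2 + C3) * K) (by simp)
      c.stronglyMeasurable.integral_prod_right'.aestronglyMeasurable ?_
    refine (ae_restrict_iff' measurableSet_Icc).2 (Eventually.of_forall fun t ht => ?_)
    have i1 := (hC0 t ht).1.abs.add (hC1 t ht).1.abs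
    have i2 := i1.add (hC2 t ht).1.abs
    refine (norm_integral_le_of_norm_le ((i2.add (hC3 t ht).1.abs).mul_const K)
      (Eventually.of_forall fun x => ?_)).trans ?_
    · have m0 := mul_le_mul_of_nonneg_left (hK x).1 (abs_nonneg (GKdV.shift B0 m y t x))
      have m1 := mul_le_mul_of_nonneg_left (hK x).2.1
        (abs_nonneg (GKdV.shift B1 m y t x + m * GKdV.shift D m y t x))
      have m2 := mul_le_mul_of_nonneg_left (hK x).2.2.1 (abs_nonneg (GKdV.shift B2 m y t x))
      have m3 := mul_le_mul_of_nonneg_left (hK x).2.2.2 (abs_nonneg (GKdV.shift B3 m y t x))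
      rw [← abs_mul] at m0 m1 m2 m3
      rw [Real.norm_eq_abs, abs_le]
      rw [abs_le] at m0 m1 m2 m3
      simp only [Pi.add_apply]
      constructor <;> nlinarith
    · rw [integral_mul_const, integral_add' i2 (hC3 t ht).1.abs, integral_add' i1 (hC2 t ht).1.abs,
        integral_add' (hC0 t ht).1.abs (hC1 t ht).1.abs]
      refine mul_le_mul_of_nonneg_right ?_ hK0
      exact add_le_add (add_le_add (add_le_add (hC0 t ht).2 (hC1 t ht).2) (hC2 t ht).2) (hC3 t ht).2
  have := intervalIntegral.integral_mono_on hab flux_int hg hle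
  linarith

/-- The constant weight gives exact conservation. -/
lemma CLaw.conserved {f : ℝ → ℝ → ℝ} (h : CLaw f (fun _ _ => 0) B1 B2 B3) {a b : ℝ} (hab : a ≤ b)
    (ia : Integrable (f a)) (ib : Integrable (f b)) (b1 : BddL1 B1 a b) (b2 : BddL1 B2 a b)
    (b3 : BddL1 B3 a b) : ∫ x, f b x = ∫ x, f a x := by
  have w : Wt (fun _ => 1) (fun _ => 0) (fun _ => 0) (fun _ => 0) :=
    ⟨fun x => hasDerivAt_const x _, fun x => hasDerivAt_const x _, fun x => hasDerivAt_const x _,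
      continuous_const, 1, fun x => by simp⟩
  have := h.global w hab ia ib (BddL1.zero a b) b1 b2 b3
  simp at this
  linarith

end GKdV

namespace GKdV

section Sol
variable {u : ℝ → ℝ → ℝ}

lemma sol_sm (hu : IsGKdVSolution u) : Sm u := hu.1

lemma iteratedDeriv_px (t : ℝ) :
    ∀ k : ℕ, ∀ x, iteratedDeriv k (u t) x = px^[k] u t x := by
  intro k
  induction k with
  | zero => intro x; simp
  | succ k ih =>
    intro x
    rw [iteratedDeriv_succ, Function.iterate_succ_apply', px]
    congr 1
    funext y; exact ih y

lemma sol_int0 (hu : IsGKdVSolution u) (t : ℝ) : Integrable (fun x => u t x ^ 2) := by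
  simpa [iteratedDeriv_px] using hu.2.2 t 0
lemma sol_int1 (hu : IsGKdVSolution u) (t : ℝ) : Integrable (fun x => px u t x ^ 2) := by
  have := hu.2.2 t 1
  simp only [iteratedDeriv_px] at this
  exact this
lemma sol_int2 (hu : IsGKdVSolution u) (t : ℝ) : Integrable (fun x => px (px u) t x ^ 2) := by
  have := hu.2.2 t 2
  simp only [iteratedDeriv_px] at this
  exact this
lemma sol_int3 (hu : IsGKdVSolution u) (t : ℝ) :
    Integrable (fun x => px (px (px u)) t x ^ 2) := by
  have := hu.2.2 t 3
  simp only [iteratedDeriv_px] at this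
  exact this

/-- The potential `∂ₓ²u + u⁴`. -/
noncomputable def pot (u : ℝ → ℝ → ℝ) : ℝ → ℝ → ℝ := fun t x => px (px u) t x + u t x ^ 4

lemma pot_sm (hu : Sm u) : Sm (pot u) := hu.px.px.add (hu.pow 4)

lemma sol_pt (hu : IsGKdVSolution u) : pt u = fun t x => - px (pot u) t x := by
  ext t x
  have h := hu.2.1 t x
  have e : (fun y => iteratedDeriv 2 (u t) y + u t y ^ 4) = pot u t := by
    funext y; rw [iteratedDeriv_px]; rfl
  rw [e] at h
  simp only [pt, px] at h ⊢
  linarith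

lemma px_pot (hu : Sm u) (t x : ℝ) :
    px (pot u) t x = px (px (px u)) t x + 4 * u t x ^ 3 * px u t x := by
  refine ((hu.px.px.hasDerivAt_x t x).add ((hu.hasDerivAt_x t x).pow 4)).deriv.trans ?_
  norm_num

lemma reflect_aux {f : ℝ → ℝ → ℝ} (hf : Sm f) : Sm (fun t x => f (-t) (-x)) := by
  simpa using hf.affine (-1) 0 0 (-1) 0

lemma reflect_px {f : ℝ → ℝ → ℝ} (hf : Sm f) (t x : ℝ) :
    px (fun t x => f (-t) (-x)) t x = - px f (-t) (-x) := by
  have := (hf.affine_x (-1) 0 0 (-1) 0 t x).deriv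
  simp at this
  exact this

lemma reflect_sol (hu : IsGKdVSolution u) : IsGKdVSolution (fun t x => u (-t) (-x)) := by
  refine ⟨reflect_aux hu.1, fun t x => ?_, fun t k => ?_⟩
  · have h1 : deriv (fun s => u (-s) (-x)) t = - pt u (-t) (-x) := by
      have := (Sm.affine_t hu.1 (-1) 0 0 (-1) 0 t x).deriv
      simpa using this
    have h2 : (fun y => iteratedDeriv 2 (fun x => u (-t) (-x)) y + u (-t) (-y) ^ 4)
        = fun y => pot u (-t) (-y) := by
      funext y
      rw [iteratedDeriv_comp_neg]
      simp [pot, iteratedDeriv_px]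
    rw [h1, h2, sol_pt hu]
    have := reflect_px (pot_sm hu.1) t x
    simp only [px] at this ⊢
    rw [this]; ring
  · have := (hu.2.2 (-t) k).comp_neg
    refine this.congr (Eventually.of_forall fun x => ?_)
    simp only [iteratedDeriv_comp_neg]
    rw [smul_eq_mul, mul_pow, ← pow_mul, mul_comm k 2, pow_mul]
    simp

lemma CLaw.add {D B0 B1 B2 B3 D' B0' B1' B2' B3' : ℝ → ℝ → ℝ} (h : CLaw D B0 B1 B2 B3)
    (h' : CLaw D' B0' B1' B2' B3') (l : ℝ) :
    CLaw (fun t x => D t x + l * D' t x) (fun t x => B0 t x + l * B0' t x)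
      (fun t x => B1 t x + l * B1' t x) (fun t x => B2 t x + l * B2' t x)
      (fun t x => B3 t x + l * B3' t x) := by
  refine ⟨h.sD.add (h'.sD.const_mul l), h.s0.add (h'.s0.const_mul l), h.s1.add (h'.s1.const_mul l),
    h.s2.add (h'.s2.const_mul l), h.s3.add (h'.s3.const_mul l), fun t x => ?_⟩
  have e2 : px (fun t x => B2 t x + l * B2' t x) = fun t x => px B2 t x + l * px B2' t x := by
    ext t x; exact px_add_mul h.s2 h'.s2 l t x
  have e3 : px (fun t x => B3 t x + l * B3' t x) = fun t x => px B3 t x + l * px B3' t x := by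
    ext t x; exact px_add_mul h.s3 h'.s3 l t x
  have e3' : px (fun t x => px B3 t x + l * px B3' t x) =
      fun t x => px (px B3) t x + l * px (px B3') t x := by
    ext t x; exact px_add_mul h.s3.px h'.s3.px l t x
  have eD : pt (fun t x => D t x + l * D' t x) t x = pt D t x + l * pt D' t x :=
    ((h.sD.hasDerivAt_t t x).add ((h'.sD.hasDerivAt_t t x).const_mul l)).deriv
  rw [e2, e3, e3', px_add_mul h.s1 h'.s1, px_add_mul h.s2.px h'.s2.px,
    px_add_mul h.s3.px.px h'.s3.px.px, eD, h.eq, h'.eq]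
  ring

lemma px_zero : px (fun _ _ => (0 : ℝ)) = fun _ _ => 0 := by ext t x; simp [px]

lemma px_sq {f : ℝ → ℝ → ℝ} (hf : Sm f) :
    px (fun t x => f t x ^ 2) = fun t x => 2 * (f t x * px f t x) := by
  ext t x
  refine ((hf.hasDerivAt_x t x).pow 2).deriv.trans ?_
  norm_num; ring

lemma px_mul {f g : ℝ → ℝ → ℝ} (hf : Sm f) (hg : Sm g) :
    px (fun t x => f t x * g t x) = fun t x => px f t x * g t x + f t x * px g t x := by
  ext t x
  exact ((hf.hasDerivAt_x t x).mul (hg.hasDerivAt_x t x)).deriv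

lemma px_const_mul {f : ℝ → ℝ → ℝ} (hf : Sm f) (a : ℝ) :
    px (fun t x => a * f t x) = fun t x => a * px f t x := by
  ext t x
  exact ((hf.hasDerivAt_x t x).const_mul a).deriv

lemma px_add {f g : ℝ → ℝ → ℝ} (hf : Sm f) (hg : Sm g) :
    px (fun t x => f t x + g t x) = fun t x => px f t x + px g t x := by
  ext t x
  exact ((hf.hasDerivAt_x t x).add (hg.hasDerivAt_x t x)).deriv

lemma mass_law (hu : IsGKdVSolution u) :
    CLaw (fun t x => u t x ^ 2) (fun _ _ => 0)
      (fun t x => 3 * px u t x ^ 2 - 8 / 5 * u t x ^ 5)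
      (fun t x => -3 * (u t x * px u t x)) (fun t x => 1 / 2 * u t x ^ 2) := by
  have s := sol_sm hu
  refine ⟨s.pow 2, Sm.const 0, ((s.px.pow 2).const_mul 3).sub ((s.pow 5).const_mul _),
    (s.mul s.px).const_mul _, (s.pow 2).const_mul _, fun t x => ?_⟩
  have e2 : px (fun t x => u t x * px u t x) =
      fun t x => px u t x * px u t x + u t x * px (px u) t x := px_mul s s.px
  have e2' : px (fun t x => px u t x * px u t x + u t x * px (px u) t x) =
      fun t x => 3 * (px u t x * px (px u) t x) + u t x * px (px (px u)) t x := by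
    ext t x
    rw [px_add (s.px.mul s.px) (s.mul s.px.px), px_mul s.px s.px, px_mul s s.px.px]; ring
  rw [px_const_mul (s.mul s.px), px_const_mul (s.mul s.px).px, px_const_mul (s.pow 2),
    px_const_mul (s.pow 2).px, px_const_mul (s.pow 2).px.px, px_sq s,
    px_const_mul (s.mul s.px), px_const_mul (s.mul s.px).px, e2, e2']
  have e1 : px (fun t x => 3 * px u t x ^ 2 - 8 / 5 * u t x ^ 5) t x =
      6 * (px u t x * px (px u) t x) - 8 * u t x ^ 4 * px u t x := by
    refine ((((s.px.hasDerivAt_x t x).pow 2).const_mul 3).sub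
      (((s.hasDerivAt_x t x).pow 5).const_mul (8 / 5))).deriv.trans ?_
    norm_num; ring
  have e0 : pt (fun t x => u t x ^ 2) t x = 2 * (u t x * pt u t x) := by
    refine ((s.hasDerivAt_t t x).pow 2).deriv.trans ?_
    norm_num; ring
  rw [e1, e0, sol_pt hu]
  simp only [px_pot s]
  ring

/-- Energy density. -/
noncomputable def en (u : ℝ → ℝ → ℝ) : ℝ → ℝ → ℝ :=
  fun t x => 1 / 2 * px u t x ^ 2 - 1 / 5 * u t x ^ 5

lemma energy_law (hu : IsGKdVSolution u) :
    CLaw (en u) (fun _ _ => 0)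
      (fun t x => 1 / 2 * pot u t x ^ 2 + px (px u) t x * pot u t x)
      (fun t x => (-1) * (px u t x * pot u t x)) (fun _ _ => 0) := by
  have s := sol_sm hu
  have sp := pot_sm s
  refine ⟨((s.px.pow 2).const_mul _).sub ((s.pow 5).const_mul _), Sm.const 0,
    ((sp.pow 2).const_mul _).add (s.px.px.mul sp), (s.px.mul sp).const_mul _, Sm.const 0,
    fun t x => ?_⟩
  have e2 : px (fun t x => px u t x * pot u t x) =
      fun t x => px (px u) t x * pot u t x + px u t x * px (pot u) t x := px_mul s.px sp
  have e2' : px (fun t x => px (px u) t x * pot u t x + px u t x * px (pot u) t x) =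
      fun t x => px (px (px u)) t x * pot u t x + 2 * (px (px u) t x * px (pot u) t x) +
        px u t x * px (px (pot u)) t x := by
    ext t x
    rw [px_add (s.px.px.mul sp) (s.px.mul sp.px), px_mul s.px.px sp, px_mul s.px sp.px]; ring
  rw [px_const_mul (s.px.mul sp), px_const_mul (s.px.mul sp).px, e2, e2', px_zero, px_zero, px_zero,
    px_add ((sp.pow 2).const_mul _) (s.px.px.mul sp), px_const_mul (sp.pow 2), px_sq sp,
    px_mul s.px.px sp]
  have e0 : pt (en u) t x = px u t x * pt (px u) t x - u t x ^ 4 * pt u t x := by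
    refine ((((s.px.hasDerivAt_t t x).pow 2).const_mul (1 / 2)).sub
      (((s.hasDerivAt_t t x).pow 5).const_mul (1 / 5))).deriv.trans ?_
    norm_num; ring
  have e3 : px (fun t x => - px (pot u) t x) t x = - px (px (pot u)) t x :=
    (sp.px.hasDerivAt_x t x).neg.deriv
  rw [e0, s.pt_px, sol_pt hu, e3]
  have : pot u t x = px (px u) t x + u t x ^ 4 := rfl
  simp only [this]; ring

lemma integral_law (hu : IsGKdVSolution u) :
    CLaw u (fun _ _ => 0) (fun t x => (-1) * u t x ^ 4) (fun _ _ => 0)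
      (fun t x => (-1) * u t x) := by
  have s := sol_sm hu
  refine ⟨s, Sm.const 0, (s.pow 4).const_mul _, Sm.const 0, s.const_mul _, fun t x => ?_⟩
  have e1 : px (fun t x => (-1) * u t x ^ 4) t x = - (4 * u t x ^ 3 * px u t x) := by
    refine (((s.hasDerivAt_x t x).pow 4).const_mul (-1)).deriv.trans ?_
    norm_num
  rw [px_const_mul s, px_const_mul s.px, px_const_mul s.px.px, px_zero, px_zero, e1, sol_pt hu]
  simp only [px_pot s]
  ring

end Sol
end GKdV

namespace GKdV

lemma sq_le_four_mul {z X Y : ℝ} (hX : 0 ≤ X) (hz : 0 ≤ z)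
    (h : ∀ a > 0, z ≤ a * X + Y / a) : z ^ 2 ≤ 4 * X * Y := by
  have hd : discrim X (-z) Y ≤ 0 := by
    refine discrim_le_zero fun a => ?_
    rcases lt_trichotomy a 0 with ha | ha | ha
    · have := h (-a) (by linarith)
      have h2 : z * (-a) ≤ (-a) * X * (-a) + Y := by
        have := mul_le_mul_of_nonneg_right this (by linarith : 0 ≤ -a)
        rwa [add_mul, div_mul_cancel₀ _ (by linarith)] at this
      nlinarith
    · subst ha
      simp only [mul_zero, zero_add]
      by_contra hY
      push Not at hY
      rcases eq_or_lt_of_le hX with hX | hX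
      · have := h 1 one_pos
        rw [← hX] at this; simp at this; linarith
      · have hs : 0 < √(-Y / (2 * X)) := Real.sqrt_pos.2 (by apply div_pos <;> linarith)
        have h3 := h _ hs
        have h4 : √(-Y / (2 * X)) ^ 2 = -Y / (2 * X) := Real.sq_sqrt (by
          apply le_of_lt; apply div_pos <;> linarith)
        set s := √(-Y / (2 * X))
        have h5 : z * s ≤ s ^ 2 * X + Y := by
          have := mul_le_mul_of_nonneg_right h3 hs.le
          rw [add_mul, div_mul_cancel₀ _ hs.ne'] at this
          linarith
        rw [h4] at h5
        have h6 : -Y / (2 * X) * X = -Y / 2 := by field_simp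
        rw [h6] at h5
        have := mul_nonneg hz hs.le
        linarith
    · have := h a ha
      have h2 : z * a ≤ a * X * a + Y := by
        have := mul_le_mul_of_nonneg_right this ha.le
        rwa [add_mul, div_mul_cancel₀ _ ha.ne'] at this
      nlinarith
  unfold discrim at hd
  nlinarith

lemma integrable_mul_of_sq {f g : ℝ → ℝ} (hf : Continuous f) (hg : Continuous g)
    (h1 : Integrable fun x => f x ^ 2) (h2 : Integrable fun x => g x ^ 2) :
    Integrable fun x => f x * g x := by
  refine (h1.add h2).mono' (hf.mul hg).aestronglyMeasurable (Eventually.of_forall fun x => ?_)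
  simp only [Pi.add_apply, Real.norm_eq_abs, abs_mul]
  nlinarith [sq_nonneg (|f x| - |g x|), sq_abs (f x), sq_abs (g x)]

/-- The mass of the derivative to the right of a point controls the value there. -/
lemma abs_le_integral_Ioi {G G' : ℝ → ℝ} (hG : ∀ x, HasDerivAt G (G' x) x) (iG : Integrable G)
    (iG' : Integrable G') (x : ℝ) : |G x| ≤ ∫ y in Set.Ioi x, |G' y| := by
  have ht := tendsto_zero_of_hasDerivAt_of_integrableOn_Ioi (a := x) (fun y _ => hG y)
    iG'.integrableOn iG.integrableOn
  have h := integral_Ioi_of_hasDerivAt_of_tendsto' (a := x) (fun y _ => hG y) iG'.integrableOn ht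
  have : G x = - ∫ y in Set.Ioi x, G' y := by rw [h]; ring
  rw [this, abs_neg]
  exact abs_integral_le_integral_abs

lemma sq_le_integral_Ioi {f f' : ℝ → ℝ} (hf : ∀ x, HasDerivAt f (f' x) x) (c : Continuous f')
    (h1 : Integrable fun x => f x ^ 2) (h2 : Integrable fun x => f' x ^ 2) (x : ℝ) :
    f x ^ 2 ≤ ∫ y in Set.Ioi x, 2 * |f y * f' y| := by
  have cf : Continuous f := continuous_iff_continuousAt.2 fun x => (hf x).continuousAt
  have := abs_le_integral_Ioi (G := fun x => f x ^ 2) (G' := fun x => 2 * (f x * f' x))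
    (fun x => ((hf x).pow 2).congr_deriv (by norm_num; ring)) h1
    ((integrable_mul_of_sq cf c h1 h2).const_mul 2) x
  rw [abs_of_nonneg (sq_nonneg _)] at this
  simpa [abs_mul] using this

lemma sq_le_H1_Ioi {f f' : ℝ → ℝ} (hf : ∀ x, HasDerivAt f (f' x) x) (c : Continuous f')
    (h1 : Integrable fun x => f x ^ 2) (h2 : Integrable fun x => f' x ^ 2) (x : ℝ) :
    f x ^ 2 ≤ ∫ y in Set.Ioi x, (f y ^ 2 + f' y ^ 2) := by
  have cf : Continuous f := continuous_iff_continuousAt.2 fun x => (hf x).continuousAt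
  refine (sq_le_integral_Ioi hf c h1 h2 x).trans ?_
  refine integral_mono ((integrable_mul_of_sq cf c h1 h2).abs.const_mul 2).integrableOn
    (h1.add h2).integrableOn fun y => ?_
  simp only [abs_mul]
  nlinarith [sq_nonneg (|f y| - |f' y|), sq_abs (f y), sq_abs (f' y)]

lemma sq_le_H1 {f f' : ℝ → ℝ} (hf : ∀ x, HasDerivAt f (f' x) x) (c : Continuous f')
    (h1 : Integrable fun x => f x ^ 2) (h2 : Integrable fun x => f' x ^ 2) (x : ℝ) :
    f x ^ 2 ≤ ∫ y, (f y ^ 2 + f' y ^ 2) :=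
  (sq_le_H1_Ioi hf c h1 h2 x).trans (setIntegral_le_integral (h1.add h2)
    (Eventually.of_forall fun y => by positivity))

lemma four_le {f f' : ℝ → ℝ} (hf : ∀ x, HasDerivAt f (f' x) x) (c : Continuous f')
    (h1 : Integrable fun x => f x ^ 2) (h2 : Integrable fun x => f' x ^ 2) (x : ℝ) :
    f x ^ 4 ≤ 4 * (∫ y, f y ^ 2) * ∫ y, f' y ^ 2 := by
  have cf : Continuous f := continuous_iff_continuousAt.2 fun x => (hf x).continuousAt
  have := sq_le_four_mul (z := f x ^ 2) (X := ∫ y, f y ^ 2) (Y := ∫ y, f' y ^ 2)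
    (integral_nonneg fun y => sq_nonneg _) (sq_nonneg _) ?_
  · calc f x ^ 4 = (f x ^ 2) ^ 2 := by ring
      _ ≤ _ := this
  intro a ha
  have i := integrable_mul_of_sq cf c h1 h2
  refine (sq_le_integral_Ioi hf c h1 h2 x).trans ?_
  refine (setIntegral_le_integral (i.abs.const_mul 2)
    (Eventually.of_forall fun y => by positivity)).trans ?_
  rw [← integral_const_mul, ← integral_div, ← integral_add (h1.const_mul a) (h2.div_const a)]
  refine integral_mono (i.abs.const_mul 2) ((h1.const_mul a).add (h2.div_const a)) fun y => ?_
  simp only [abs_mul]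
  have h3 : f' y ^ 2 / a * a = f' y ^ 2 := div_mul_cancel₀ _ ha.ne'
  have h4 : 0 ≤ (a * |f y| - |f' y|) ^ 2 := sq_nonneg _
  have h5 : 2 * (|f y| * |f' y|) * a ≤ (a * f y ^ 2 + f' y ^ 2 / a) * a := by
    rw [add_mul, h3, ← sq_abs (f y), ← sq_abs (f' y)]; linarith
  exact le_of_mul_le_mul_right h5 ha

end GKdV

namespace GKdV

/-- The derivative of the sigmoid, used as a bell-shaped kernel. -/
noncomputable def bell (x : ℝ) : ℝ := sigmoid x * (1 - sigmoid x)
/-- First derivative of `bell`. -/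
noncomputable def bell1 (x : ℝ) : ℝ := bell x * (1 - 2 * sigmoid x)
/-- Second derivative of `bell`. -/
noncomputable def bell2 (x : ℝ) : ℝ := bell x * (1 - 6 * bell x)
/-- Third derivative of `bell`. -/
noncomputable def bell3 (x : ℝ) : ℝ := bell1 x * (1 - 12 * bell x)

lemma bell_pos (x : ℝ) : 0 < bell x :=
  mul_pos (sigmoid_pos x) (by linarith [sigmoid_lt_one x])
lemma bell_le (x : ℝ) : bell x ≤ 1 / 4 := by
  unfold bell; nlinarith [sq_nonneg (1 - 2 * sigmoid x)]
lemma bell_neg (x : ℝ) : bell (-x) = bell x := by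
  unfold bell; rw [sigmoid_neg]; ring
lemma bell_zero : bell 0 = 1 / 4 := by unfold bell; rw [sigmoid_zero]; norm_num
lemma hasDerivAt_sig (x : ℝ) : HasDerivAt sigmoid (bell x) x := hasDerivAt_sigmoid x
lemma hasDerivAt_bell (x : ℝ) : HasDerivAt bell (bell1 x) x :=
  ((hasDerivAt_sig x).mul ((hasDerivAt_sig x).const_sub 1)).congr_deriv (by
    simp only [bell1, bell]; ring)
lemma hasDerivAt_bell1 (x : ℝ) : HasDerivAt bell1 (bell2 x) x :=
  ((hasDerivAt_bell x).mul (((hasDerivAt_sig x).const_mul 2).const_sub 1)).congr_deriv (by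
    simp only [bell1, bell2, bell]; ring)
lemma hasDerivAt_bell2 (x : ℝ) : HasDerivAt bell2 (bell3 x) x :=
  ((hasDerivAt_bell x).mul (((hasDerivAt_bell x).const_mul 6).const_sub 1)).congr_deriv (by
    simp only [bell1, bell3, bell]; ring)
lemma continuous_bell : Continuous bell :=
  continuous_iff_continuousAt.2 fun x => (hasDerivAt_bell x).continuousAt
lemma continuous_bell1 : Continuous bell1 :=
  continuous_iff_continuousAt.2 fun x => (hasDerivAt_bell1 x).continuousAt
lemma continuous_bell2 : Continuous bell2 :=
  continuous_iff_continuousAt.2 fun x => (hasDerivAt_bell2 x).continuousAt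
lemma continuous_bell3 : Continuous bell3 :=
  continuous_bell1.mul (continuous_const.sub (continuous_const.mul continuous_bell))
lemma abs_bell1 (x : ℝ) : |bell1 x| ≤ bell x := by
  unfold bell1
  rw [abs_mul, abs_of_pos (bell_pos x)]
  refine mul_le_of_le_one_right (bell_pos x).le ?_
  rw [abs_le]; constructor <;> linarith [sigmoid_pos x, sigmoid_lt_one x]
lemma abs_bell2 (x : ℝ) : |bell2 x| ≤ bell x := by
  unfold bell2
  rw [abs_mul, abs_of_pos (bell_pos x)]
  refine mul_le_of_le_one_right (bell_pos x).le ?_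
  rw [abs_le]; constructor <;> linarith [bell_pos x, bell_le x]
lemma abs_bell3 (x : ℝ) : |bell3 x| ≤ 2 * bell x := by
  unfold bell3
  rw [abs_mul, mul_comm]
  refine mul_le_mul ?_ (abs_bell1 x) (abs_nonneg _) (by norm_num)
  rw [abs_le]; constructor <;> linarith [bell_pos x, bell_le x]

lemma wt_bell : Wt bell bell1 bell2 bell3 := by
  refine ⟨hasDerivAt_bell, hasDerivAt_bell1, hasDerivAt_bell2, continuous_bell3, 1, fun x => ?_⟩
  have := bell_le x
  have h0 := bell_pos x
  have := abs_bell1 x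
  have := abs_bell2 x
  have := abs_bell3 x
  rw [abs_of_pos h0]
  refine ⟨?_, ?_, ?_, ?_⟩ <;> linarith

lemma bell_le_exp (x : ℝ) : bell x ≤ exp (-|x|) := by
  wlog hx : 0 ≤ x generalizing x
  · have := this (-x) (by linarith)
    rwa [bell_neg, abs_neg] at this
  rw [abs_of_nonneg hx]
  unfold bell
  have h : sigmoid x * exp (-x) = sigmoid (-x) := sigmoid_mul_rexp_neg x
  have h2 : 1 - sigmoid x = sigmoid (-x) := (sigmoid_neg x).symm
  rw [h2, ← h]
  have := sigmoid_pos x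
  have := sigmoid_lt_one x
  have := exp_pos (-x)
  calc sigmoid x * (sigmoid x * exp (-x)) ≤ 1 * (1 * exp (-x)) := by gcongr
    _ = _ := by ring

/-- Convolution of an integrable function with a bounded kernel. -/
noncomputable def conv (ρ k : ℝ → ℝ) (x : ℝ) : ℝ := ∫ y, ρ y * k (x - y)

lemma conv_integrable {ρ k : ℝ → ℝ} (hρ : Integrable ρ) (hk : Continuous k) {C : ℝ}
    (hC : ∀ x, |k x| ≤ C) (x : ℝ) : Integrable fun y => ρ y * k (x - y) := by
  refine hρ.mul_bdd (c := C) ?_ (Eventually.of_forall fun y => by simpa using hC (x - y))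
  exact (hk.comp (continuous_const.sub continuous_id)).aestronglyMeasurable

lemma conv_bdd {ρ k : ℝ → ℝ} (hρ : Integrable ρ) (_ : Continuous k) {C : ℝ}
    (hC : ∀ x, |k x| ≤ C) (x : ℝ) : |conv ρ k x| ≤ C * ∫ y, |ρ y| := by
  rw [← integral_const_mul, ← Real.norm_eq_abs]
  refine norm_integral_le_of_norm_le (hρ.abs.const_mul C) (Eventually.of_forall fun y => ?_)
  rw [norm_mul, Real.norm_eq_abs, Real.norm_eq_abs, mul_comm]
  exact mul_le_mul_of_nonneg_right (hC _) (abs_nonneg _)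

lemma conv_hasDerivAt {ρ k k' : ℝ → ℝ} (hρ : Integrable ρ) (hk : ∀ x, HasDerivAt k (k' x) x)
    (hk' : Continuous k') {C : ℝ} (hC : ∀ x, |k x| ≤ C) {C' : ℝ} (hC' : ∀ x, |k' x| ≤ C') (x : ℝ) :
    HasDerivAt (conv ρ k) (conv ρ k' x) x := by
  have ck : Continuous k := continuous_iff_continuousAt.2 fun x => (hk x).continuousAt
  refine (hasDerivAt_integral_of_dominated_loc_of_deriv_le (bound := fun y => |ρ y| * C')
    (F := fun x y => ρ y * k (x - y)) (F' := fun x y => ρ y * k' (x - y))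
    (Metric.ball_mem_nhds x one_pos) (Eventually.of_forall fun z => ?_)
    (conv_integrable hρ ck hC x) ?_ (Eventually.of_forall fun y z _ => ?_) (hρ.abs.mul_const _)
    (Eventually.of_forall fun y z _ => ?_)).2
  · exact (conv_integrable hρ ck hC z).aestronglyMeasurable
  · exact (conv_integrable hρ hk' hC' x).aestronglyMeasurable
  · rw [norm_mul, Real.norm_eq_abs, Real.norm_eq_abs]
    exact mul_le_mul_of_nonneg_left (hC' _) (abs_nonneg _)
  · have : HasDerivAt (fun z => z - y) 1 z := (hasDerivAt_id z).sub_const y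
    have h2 := (hk (z - y)).comp z this
    rw [mul_one] at h2
    exact h2.const_mul _

lemma conv_continuous {ρ k : ℝ → ℝ} (hρ : Integrable ρ) (hk : Continuous k) {C : ℝ}
    (hC : ∀ x, |k x| ≤ C) : Continuous (conv ρ k) := by
  refine continuous_of_dominated (bound := fun y => |ρ y| * C)
    (fun x => (conv_integrable hρ hk hC x).aestronglyMeasurable)
    (fun x => Eventually.of_forall fun y => ?_) (hρ.abs.mul_const _)
    (Eventually.of_forall fun y => by fun_prop)
  rw [norm_mul, Real.norm_eq_abs, Real.norm_eq_abs]
  exact mul_le_mul_of_nonneg_left (hC _) (abs_nonneg _)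

lemma BddL1.integrable_prod {f : ℝ → ℝ → ℝ} (hf : Continuous (Function.uncurry f)) {a b : ℝ}
    (hab : a ≤ b) (h : BddL1 f a b) :
    Integrable (Function.uncurry f) ((volume.restrict (Set.uIoc a b)).prod volume) := by
  obtain ⟨C, hC⟩ := h
  rw [Set.uIoc_of_le hab, integrable_prod_iff hf.aestronglyMeasurable]
  refine ⟨(ae_restrict_iff' measurableSet_Ioc).2 (Eventually.of_forall fun t ht =>
    (hC t (Set.Ioc_subset_Icc_self ht)).1), ?_⟩
  refine Measure.integrableOn_of_bounded (M := C) (by simp)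
    hf.norm.stronglyMeasurable.integral_prod_right'.aestronglyMeasurable
    ((ae_restrict_iff' measurableSet_Ioc).2 (Eventually.of_forall fun t ht => ?_))
  rw [Real.norm_eq_abs, abs_of_nonneg (integral_nonneg fun x => norm_nonneg _)]
  exact (hC t (Set.Ioc_subset_Icc_self ht)).2

end GKdV

namespace GKdV

variable {u : ℝ → ℝ → ℝ}

lemma integral_le_of_abs_le {f g : ℝ → ℝ} (hg : Integrable g) (h : ∀ x, |f x| ≤ g x) :
    ∫ x, f x ≤ ∫ x, g x :=
  (le_abs_self _).trans (by
    rw [← Real.norm_eq_abs]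
    exact norm_integral_le_of_norm_le hg (Eventually.of_forall h))

/-- The `H¹` density. -/
noncomputable def hden (u : ℝ → ℝ → ℝ) : ℝ → ℝ → ℝ := fun t x => u t x ^ 2 + px u t x ^ 2

/-- The `H¹` norm of the solution is bounded by `B` on `[a, b]`. -/
def HB (u : ℝ → ℝ → ℝ) (a b B : ℝ) : Prop := ∀ t ∈ Set.Icc a b, ∫ x, hden u t x ≤ B

lemma hden_nonneg (t x : ℝ) : 0 ≤ hden u t x := by unfold hden; positivity

lemma hden_sm (s : Sm u) : Sm (hden u) := (s.pow 2).add (s.px.pow 2)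

lemma hden_int (hu : IsGKdVSolution u) (t : ℝ) : Integrable (hden u t) :=
  (sol_int0 hu t).add (sol_int1 hu t)

lemma HB.mono {a b a' b' B : ℝ} (h : HB u a b B) (ha : a ≤ a') (hb : b' ≤ b) : HB u a' b' B :=
  fun t ht => h t ⟨ha.trans ht.1, ht.2.trans hb⟩

lemma HB.bdd {a b B : ℝ} (h : HB u a b B) (hu : IsGKdVSolution u) : BddL1 (hden u) a b :=
  ⟨B, fun t ht => ⟨hden_int hu t, by
    simp only [abs_of_nonneg (hden_nonneg t _)]; exact h t ht⟩⟩

lemma sq_le_hden (hu : IsGKdVSolution u) (t x : ℝ) : u t x ^ 2 ≤ ∫ y, hden u t y :=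
  sq_le_H1 ((sol_sm hu).hasDerivAt_x t) ((sol_sm hu).px.cont_x t) (sol_int0 hu t) (sol_int1 hu t) x

lemma HB.ptw {a b B : ℝ} (h : HB u a b B) (hu : IsGKdVSolution u) {t : ℝ}
    (ht : t ∈ Set.Icc a b) (x : ℝ) : |u t x| ≤ 1 + B := by
  have h1 := (sq_le_hden hu t x).trans (h t ht)
  refine abs_le_of_sq_le_sq ?_ (by nlinarith [sq_nonneg (u t x)])
  nlinarith [sq_nonneg (u t x)]

lemma HB.nonneg {a b B : ℝ} (h : HB u a b B) (hab : a ≤ b) : 0 ≤ B :=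
  (integral_nonneg (hden_nonneg a)).trans (h a ⟨le_rfl, hab⟩)

lemma abs_pow5_le {A v : ℝ} (h : |v| ≤ A) : |v ^ 5| ≤ A ^ 3 * v ^ 2 := by
  rw [abs_pow, ← sq_abs v]
  calc |v| ^ 5 = |v| ^ 3 * |v| ^ 2 := by ring
    _ ≤ A ^ 3 * |v| ^ 2 := by gcongr

lemma HB.law_bdd {a b B : ℝ} (h : HB u a b B) (hu : IsGKdVSolution u) :
    BddL1 (fun t x => u t x ^ 2) a b ∧ BddL1 (fun t x => 3 * px u t x ^ 2 - 8 / 5 * u t x ^ 5) a b ∧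
    BddL1 (fun t x => (-3) * (u t x * px u t x)) a b ∧ BddL1 (fun t x => 1 / 2 * u t x ^ 2) a b := by
  have s := sol_sm hu
  have hb := h.bdd hu
  have L := mass_law hu
  refine ⟨hb.of_le L.sD.cont_x 1 fun t ht x => ?_,
    hb.of_le L.s1.cont_x (3 + 2 * (1 + B) ^ 3) fun t ht x => ?_,
    hb.of_le L.s2.cont_x 2 fun t ht x => ?_, hb.of_le L.s3.cont_x 1 fun t ht x => ?_⟩ <;>
    rw [abs_of_nonneg (hden_nonneg t x)] <;> unfold hden
  · rw [abs_of_nonneg (sq_nonneg _)]; nlinarith [sq_nonneg (px u t x)]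
  · have hA := h.ptw hu ht x
    have h5 := abs_pow5_le hA
    have hA0 : 0 ≤ 1 + B := (abs_nonneg _).trans hA
    have : 0 ≤ (1 + B) ^ 3 := by positivity
    rw [abs_le] at h5 ⊢
    constructor <;> nlinarith [sq_nonneg (px u t x), sq_nonneg (u t x),
      mul_nonneg this (sq_nonneg (px u t x)), mul_nonneg this (sq_nonneg (u t x))]
  · rw [abs_le]; constructor <;>
    nlinarith [sq_nonneg (px u t x + u t x), sq_nonneg (px u t x - u t x)]
  · rw [abs_of_nonneg (by positivity)]; nlinarith [sq_nonneg (px u t x), sq_nonneg (u t x)]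

lemma HB.mass {a b B : ℝ} (h : HB u a b B) (hu : IsGKdVSolution u) (hab : a ≤ b) :
    ∫ x, u b x ^ 2 = ∫ x, u a x ^ 2 := by
  obtain ⟨_, b1, b2, b3⟩ := h.law_bdd hu
  exact (mass_law hu).conserved hab (sol_int0 hu a) (sol_int0 hu b) b1 b2 b3

lemma HB.window {a b B : ℝ} (h : HB u a b B) (hu : IsGKdVSolution u) (hab : a ≤ b) :
    ∃ ρ : ℝ → ℝ, Integrable ρ ∧ (∀ y, 0 ≤ ρ y) ∧
      ∀ t ∈ Set.Icc a b, ∀ z, ∫ x, u t x ^ 2 * bell (x - z) ≤ conv ρ bell z := by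
  have s := sol_sm hu
  have hB := h.nonneg hab
  set K : ℝ := 6 + 2 * (1 + B) ^ 3 with hK
  have hK0 : 0 ≤ K := by positivity
  have ip := (h.bdd hu).integrable_prod (hden_sm s).cont hab
  have iρ2 : Integrable (fun y => ∫ t in a..b, hden u t y) := by
    simp only [intervalIntegral.integral_of_le hab]
    rw [Set.uIoc_of_le hab] at ip
    exact ip.integral_prod_right
  refine ⟨fun y => u a y ^ 2 + K * ∫ t in a..b, hden u t y, (sol_int0 hu a).add (iρ2.const_mul K),
    fun y => ?_, fun t ht z => ?_⟩
  · have : 0 ≤ ∫ t in a..b, hden u t y :=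
      intervalIntegral.integral_nonneg hab fun t _ => hden_nonneg t y
    positivity
  have cb : Continuous fun x => bell (x - z) := continuous_bell.comp (by fun_prop)
  have hbb : ∀ x, |bell x| ≤ 1 / 4 := fun x => by
    rw [abs_of_pos (bell_pos x)]; exact bell_le x
  -- the weighted density
  have bw : BddL1 (fun t x => hden u t x * bell (x - z)) a b :=
    (h.bdd hu).of_le (fun t => ((hden_sm s).cont_x t).mul cb) 1 fun t _ x => by
      rw [abs_mul, mul_comm, one_mul]
      exact mul_le_of_le_one_left (abs_nonneg _) ((hbb _).trans (by norm_num))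
  have cw : Continuous (Function.uncurry fun t x => hden u t x * bell (x - z)) :=
    (hden_sm s).cont.mul (cb.comp continuous_snd)
  have ipw := bw.integrable_prod cw hab
  have ig : IntervalIntegrable (fun t => ∫ x, hden u t x * bell (x - z)) volume a b := by
    rw [intervalIntegrable_iff]; exact ipw.integral_prod_left
  obtain ⟨bD, b1, b2, b3⟩ := (h.mono le_rfl ht.2).law_bdd hu
  have key := (mass_law hu).le wt_bell ht.1 0 z bD (BddL1.zero a t) b1 b2 b3
    (fun t => K * ∫ x, hden u t x * bell (x - z))
    ((ig.const_mul K).mono_set (by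
      rw [Set.uIcc_of_le ht.1, Set.uIcc_of_le hab]; exact Set.Icc_subset_Icc le_rfl ht.2))
    (fun r hr => by
      have hr' : r ∈ Set.Icc a b := ⟨hr.1, hr.2.trans ht.2⟩
      obtain ⟨C, hC⟩ := bw
      rw [← integral_const_mul]
      refine integral_le_of_abs_le ((hC r hr').1.const_mul K) fun x => ?_
      have hA := h.ptw hu hr' x
      have h5 := abs_pow5_le hA
      have hb := bell_pos (x - z)
      have e : (0 : ℝ) * r + z = z := by ring
      simp only [flux, e]
      have hA0 : 0 ≤ 1 + B := (abs_nonneg _).trans hA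
      have a1 : |3 * px u r x ^ 2 - 8 / 5 * u r x ^ 5 + 0 * u r x ^ 2| ≤
          (3 + 2 * (1 + B) ^ 3) * hden u r x := by
        have : 0 ≤ (1 + B) ^ 3 := by positivity
        unfold hden
        rw [abs_le] at h5 ⊢
        constructor <;> nlinarith [sq_nonneg (px u r x), sq_nonneg (u r x),
          mul_nonneg this (sq_nonneg (px u r x)), mul_nonneg this (sq_nonneg (u r x))]
      have a2 : |-3 * (u r x * px u r x)| ≤ 3 / 2 * hden u r x := by
        unfold hden
        rw [abs_le]; constructor <;>
        nlinarith [sq_nonneg (px u r x + u r x), sq_nonneg (px u r x - u r x)]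
      have a3 : |1 / 2 * u r x ^ 2| ≤ 1 / 2 * hden u r x := by
        rw [abs_of_nonneg (by positivity)]; unfold hden; nlinarith [sq_nonneg (px u r x)]
      have hd := hden_nonneg (u := u) r x
      have c1 := mul_le_mul a1 (abs_bell1 (x - z)) (abs_nonneg _) (by positivity)
      have c2 := mul_le_mul a2 (abs_bell2 (x - z)) (abs_nonneg _) (by positivity)
      have c3 := mul_le_mul a3 (abs_bell3 (x - z)) (abs_nonneg _) (by positivity)
      rw [← abs_mul, abs_le] at c1 c2 c3
      have : 0 ≤ hden u r x * bell (x - z) := by positivity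
      rw [hK, abs_le]
      constructor <;> nlinarith)
  have e : ∀ r : ℝ, (0 : ℝ) * r + z = z := fun r => by ring
  simp only [e, intervalIntegral.integral_const_mul] at key
  have m1 : ∫ r in a..t, ∫ x, hden u r x * bell (x - z) ≤
      ∫ r in a..b, ∫ x, hden u r x * bell (x - z) :=
    intervalIntegral.integral_mono_interval le_rfl ht.1 ht.2 (Eventually.of_forall fun r =>
      integral_nonneg fun x => mul_nonneg (hden_nonneg r x) (bell_pos _).le) ig
  have sw : ∫ r in a..b, ∫ x, hden u r x * bell (x - z) =
      ∫ x, (∫ r in a..b, hden u r x) * bell (x - z) := by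
    rw [intervalIntegral_integral_swap ipw]
    simp only [intervalIntegral.integral_mul_const]
  refine key.trans ?_
  rw [sw] at m1
  have i1 : Integrable fun x => u a x ^ 2 * bell (x - z) :=
    (sol_int0 hu a).mul_bdd (c := 1 / 4) cb.aestronglyMeasurable
      (Eventually.of_forall fun x => hbb _)
  have i2 : Integrable fun x => (∫ r in a..b, hden u r x) * bell (x - z) :=
    iρ2.mul_bdd (c := 1 / 4) cb.aestronglyMeasurable (Eventually.of_forall fun x => hbb _)
  have ec : conv (fun y => u a y ^ 2 + K * ∫ t in a..b, hden u t y) bell z =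
      (∫ x, u a x ^ 2 * bell (x - z)) + K * ∫ x, (∫ r in a..b, hden u r x) * bell (x - z) := by
    unfold conv
    rw [← integral_const_mul, ← integral_add i1 (i2.const_mul K)]
    refine integral_congr_ae (Eventually.of_forall fun x => ?_)
    have : bell (z - x) = bell (x - z) := by rw [← bell_neg]; ring_nf
    simp only [this]; ring
  rw [ec]
  gcongr

lemma HB.four_le_conv {a b B : ℝ} (h : HB u a b B) (hu : IsGKdVSolution u) (hab : a ≤ b) :
    ∃ ρ : ℝ → ℝ, Integrable ρ ∧ (∀ y, 0 ≤ ρ y) ∧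
      ∀ t ∈ Set.Icc a b, ∀ z, u t z ^ 4 ≤ 32 * B * conv ρ bell z := by
  obtain ⟨ρ, iρ, hρ, hw⟩ := h.window hu hab
  refine ⟨ρ, iρ, hρ, fun t ht z => ?_⟩
  have s := sol_sm hu
  have hB := h.nonneg hab
  have cb : Continuous fun x => bell (x - z) := continuous_bell.comp (by fun_prop)
  have cb1 : Continuous fun x => bell1 (x - z) := continuous_bell1.comp (by fun_prop)
  have hbb : ∀ x, |bell x| ≤ 1 / 4 := fun x => by
    rw [abs_of_pos (bell_pos x)]; exact bell_le x
  have i0 : Integrable fun x => u t x ^ 2 * bell (x - z) :=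
    (sol_int0 hu t).mul_bdd (c := 1 / 4) cb.aestronglyMeasurable
      (Eventually.of_forall fun x => hbb _)
  have ih : Integrable fun x => hden u t x * bell (x - z) :=
    (hden_int hu t).mul_bdd (c := 1 / 4) cb.aestronglyMeasurable
      (Eventually.of_forall fun x => hbb _)
  have iG' : Integrable fun x =>
      2 * (u t x * px u t x) * bell (x - z) + u t x ^ 2 * bell1 (x - z) := by
    refine (((integrable_mul_of_sq (s.cont_x t) (s.px.cont_x t) (sol_int0 hu t)
      (sol_int1 hu t)).const_mul 2).mul_bdd (c := 1 / 4) cb.aestronglyMeasurable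
      (Eventually.of_forall fun x => hbb _)).add ((sol_int0 hu t).mul_bdd (c := 1 / 4)
      cb1.aestronglyMeasurable
      (Eventually.of_forall fun x => (abs_bell1 _).trans (bell_le _)))
  have hG : ∀ x, HasDerivAt (fun x => u t x ^ 2 * bell (x - z))
      (2 * (u t x * px u t x) * bell (x - z) + u t x ^ 2 * bell1 (x - z)) x := fun x => by
    have d1 : HasDerivAt (fun x => u t x ^ 2) (2 * (u t x * px u t x)) x :=
      ((s.hasDerivAt_x t x).pow 2).congr_deriv (by norm_num; ring)
    have d2 : HasDerivAt (fun x => bell (x - z)) (bell1 (x - z)) x := by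
      have := (hasDerivAt_bell (x - z)).comp x ((hasDerivAt_id x).sub_const z)
      rw [mul_one] at this
      exact this
    exact d1.mul d2
  have h1 := abs_le_integral_Ioi hG i0 iG' z
  have h2 := h1.trans (setIntegral_le_integral iG'.abs (Eventually.of_forall fun y => abs_nonneg _))
  simp only [sub_self, bell_zero] at h2
  rw [abs_of_nonneg (by positivity)] at h2
  have h3 := sq_le_four_mul (z := u t z ^ 2 * (1 / 4)) (X := ∫ x, u t x ^ 2 * bell (x - z))
    (Y := B / 2) (integral_nonneg fun x => mul_nonneg (sq_nonneg _) (bell_pos _).le)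
    (by positivity) fun α hα => by
      refine h2.trans ?_
      have : B / 2 / α = 2 / α * (1 / 4 * B) := by ring
      rw [this]
      have h4 : ∫ x, |2 * (u t x * px u t x) * bell (x - z) + u t x ^ 2 * bell1 (x - z)| ≤
          ∫ x, (α * (u t x ^ 2 * bell (x - z)) + 2 / α * (1 / 4 * hden u t x)) := by
        refine integral_mono iG'.abs ((i0.const_mul α).add
          (((hden_int hu t).const_mul _).const_mul _)) fun x => ?_
        have hb := bell_pos (x - z)
        have hb' := bell_le (x - z)
        have q : |2 * (u t x * px u t x)| + u t x ^ 2 ≤ α * u t x ^ 2 + 2 / α * hden u t x := by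
          have e1 : 2 / α * hden u t x = 2 * hden u t x * α⁻¹ := by ring
          have hi : α * α⁻¹ = 1 := by field_simp
          have hi0 : 0 < α⁻¹ := by positivity
          have : |2 * (u t x * px u t x)| = 2 * (|u t x| * |px u t x|) := by
            rw [abs_mul, abs_mul]; norm_num
          rw [this, e1]; unfold hden
          rw [← sq_abs (u t x), ← sq_abs (px u t x)]
          set p := |u t x|
          set q := |px u t x|
          have h5 : 0 ≤ α⁻¹ * (α * p - (q + p / 2)) ^ 2 := by positivity
          have h6 : α⁻¹ * (α * p - (q + p / 2)) ^ 2 =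
              (α * α⁻¹) * α * p ^ 2 - 2 * (α * α⁻¹) * p * (q + p / 2) + (q + p / 2) ^ 2 * α⁻¹ := by
            ring
          rw [h6, hi] at h5
          have h7 : (q + p / 2) ^ 2 * α⁻¹ ≤ 2 * (p ^ 2 + q ^ 2) * α⁻¹ := by
            gcongr; nlinarith [sq_nonneg (q - p / 2), sq_nonneg p]
          nlinarith
        have q0 : |2 * (u t x * px u t x) * bell (x - z) + u t x ^ 2 * bell1 (x - z)| ≤
            (|2 * (u t x * px u t x)| + u t x ^ 2) * bell (x - z) := by
          refine (abs_add_le _ _).trans ?_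
          rw [abs_mul _ (bell _), abs_mul _ (bell1 _), abs_of_pos hb, abs_of_nonneg (sq_nonneg (u t x)),
            add_mul]
          gcongr
          exact abs_bell1 _
        refine q0.trans ((mul_le_mul_of_nonneg_right q hb.le).trans ?_)
        have hd := hden_nonneg (u := u) t x
        have : 2 / α * hden u t x * bell (x - z) ≤ 2 / α * hden u t x * (1 / 4) := by gcongr
        linarith
      refine h4.trans ?_
      rw [integral_add (i0.const_mul α) (((hden_int hu t).const_mul _).const_mul _),
        integral_const_mul, integral_const_mul, integral_const_mul]
      gcongr
      exact h t ht
  have h5 := hw t ht z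
  have : 32 * B * ∫ x, u t x ^ 2 * bell (x - z) ≤ 32 * B * conv ρ bell z := by gcongr
  nlinarith

end GKdV

namespace GKdV

variable {u : ℝ → ℝ → ℝ}

lemma CLaw.exp_mul {D B0 B1 B2 B3 : ℝ → ℝ → ℝ} (h : CLaw D B0 B1 B2 B3) (κ : ℝ) :
    CLaw (fun t x => exp (-κ * t) * D t x) (fun t x => exp (-κ * t) * (B0 t x - κ * D t x))
      (fun t x => exp (-κ * t) * B1 t x) (fun t x => exp (-κ * t) * B2 t x)
      (fun t x => exp (-κ * t) * B3 t x) := by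
  have se : Sm (fun t _ => exp (-κ * t)) := Sm.of_t (by fun_prop)
  have pe : ∀ f : ℝ → ℝ → ℝ, Sm f → px (fun t x => exp (-κ * t) * f t x) =
      fun t x => exp (-κ * t) * px f t x := fun f hf => by
    ext t x
    exact ((hf.hasDerivAt_x t x).const_mul _).deriv
  refine ⟨se.mul h.sD, se.mul (h.s0.sub (h.sD.const_mul κ)), se.mul h.s1, se.mul h.s2,
    se.mul h.s3, fun t x => ?_⟩
  rw [pe _ h.s1, pe _ h.s2, pe _ h.s2.px, pe _ h.s3, pe _ h.s3.px, pe _ h.s3.px.px]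
  have d : HasDerivAt (fun t => exp (-κ * t)) (exp (-κ * t) * (-κ)) t := by
    have : HasDerivAt (fun t : ℝ => -κ * t) (-κ) t := by
      simpa using (hasDerivAt_id t).const_mul (-κ)
    exact this.exp
  have : pt (fun t x => exp (-κ * t) * D t x) t x =
      exp (-κ * t) * (-κ) * D t x + exp (-κ * t) * pt D t x :=
    (d.mul (h.sD.hasDerivAt_t t x)).deriv
  rw [this, h.eq]; ring

lemma BddL1.exp_mul {f : ℝ → ℝ → ℝ} {a b : ℝ} (hf : BddL1 f a b) (κ : ℝ) :
    BddL1 (fun t x => exp (-κ * t) * f t x) a b := by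
  obtain ⟨C, hC⟩ := hf
  refine ⟨exp (|κ| * max |a| |b|) * C, fun t ht => ⟨(hC t ht).1.const_mul _, ?_⟩⟩
  simp only [abs_mul, abs_exp]
  rw [integral_const_mul]
  have : 0 ≤ ∫ x, |f t x| := integral_nonneg fun x => abs_nonneg _
  have h2 : -κ * t ≤ |κ| * max |a| |b| := by
    refine (le_abs_self _).trans ?_
    rw [abs_mul, abs_neg]
    gcongr
    exact abs_le_max_abs_abs ht.1 ht.2
  have h3 := (hC t ht).2
  gcongr

/-- Fatou's lemma for real integrals of continuous nonnegative functions. -/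
lemma integral_le_of_tendsto {f : ℕ → ℝ → ℝ} {g : ℝ → ℝ} {C : ℝ} (hC : 0 ≤ C)
    (hf0 : ∀ n x, 0 ≤ f n x) (hf : ∀ n, Integrable (f n)) (hfC : ∀ᶠ n in atTop, ∫ x, f n x ≤ C)
    (hlim : ∀ x, Tendsto (fun n => f n x) atTop (nhds (g x))) :
    Integrable g ∧ ∫ x, g x ≤ C := by
  have hg0 : ∀ x, 0 ≤ g x := fun x => ge_of_tendsto' (hlim x) fun n => hf0 n x
  have hm : AEStronglyMeasurable g volume :=
    aestronglyMeasurable_of_tendsto_ae atTop (fun n => (hf n).aestronglyMeasurable)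
      (Eventually.of_forall hlim)
  have key : ∫⁻ x, ENNReal.ofReal (g x) ≤ ENNReal.ofReal C := by
    have h1 : ∀ x, ENNReal.ofReal (g x) = liminf (fun n => ENNReal.ofReal (f n x)) atTop :=
      fun x => ((ENNReal.tendsto_ofReal (hlim x)).liminf_eq).symm
    simp only [h1]
    refine (lintegral_liminf_le' fun n => (hf n).aestronglyMeasurable.aemeasurable.ennreal_ofReal
      ).trans ?_
    refine liminf_le_of_le (by isBoundedDefault) fun b hb => ?_
    obtain ⟨n, hn1, hn2⟩ := (hb.and hfC).exists
    refine hn1.trans ?_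
    rw [← ofReal_integral_eq_lintegral_ofReal (hf n) (Eventually.of_forall (hf0 n))]
    exact ENNReal.ofReal_le_ofReal hn2
  have ig : Integrable g := ⟨hm, by
    rw [hasFiniteIntegral_iff_ofReal (Eventually.of_forall hg0)]
    exact key.trans_lt ENNReal.ofReal_lt_top⟩
  refine ⟨ig, ?_⟩
  rw [← ofReal_integral_eq_lintegral_ofReal ig (Eventually.of_forall hg0)] at key
  exact (ENNReal.ofReal_le_ofReal_iff hC).1 key

/-- The difference of two solutions. -/
lemma diff_law {v : ℝ → ℝ → ℝ} (hu : IsGKdVSolution u) (hv : IsGKdVSolution v) :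
    CLaw (fun t x => (v t x - u t x) ^ 2)
      (fun t x => 2 * ((v t x ^ 3 + v t x ^ 2 * u t x + v t x * u t x ^ 2 + u t x ^ 3) *
        ((v t x - u t x) * (px v t x - px u t x))))
      (fun t x => 3 * (px v t x - px u t x) ^ 2 -
        2 * ((v t x ^ 3 + v t x ^ 2 * u t x + v t x * u t x ^ 2 + u t x ^ 3) *
          (v t x - u t x) ^ 2)) (fun _ _ => 0) (fun t x => (-1) * (v t x - u t x) ^ 2) := by
  have su := sol_sm hu
  have sv := sol_sm hv
  set w : ℝ → ℝ → ℝ := fun t x => v t x - u t x with hw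
  set w1 : ℝ → ℝ → ℝ := fun t x => px v t x - px u t x with hw1
  set q : ℝ → ℝ → ℝ := fun t x =>
    v t x ^ 3 + v t x ^ 2 * u t x + v t x * u t x ^ 2 + u t x ^ 3 with hq
  have sw : Sm w := sv.sub su
  have sw1 : Sm w1 := sv.px.sub su.px
  have sq : Sm q := (((sv.pow 3).add ((sv.pow 2).mul su)).add (sv.mul (su.pow 2))).add (su.pow 3)
  have pw : px w = w1 := by
    ext t x; exact ((sv.hasDerivAt_x t x).sub (su.hasDerivAt_x t x)).deriv
  have pw1 : ∀ t x, px w1 t x = px (px v) t x - px (px u) t x := fun t x =>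
    ((sv.px.hasDerivAt_x t x).sub (su.px.hasDerivAt_x t x)).deriv
  have pw2 : ∀ t x, px (px w1) t x = px (px (px v)) t x - px (px (px u)) t x := fun t x => by
    have : px w1 = fun t x => px (px v) t x - px (px u) t x := by ext t x; exact pw1 t x
    rw [this]
    exact ((sv.px.px.hasDerivAt_x t x).sub (su.px.px.hasDerivAt_x t x)).deriv
  have pq : ∀ t x, px q t x = 3 * v t x ^ 2 * px v t x + (2 * v t x * px v t x * u t x +
      v t x ^ 2 * px u t x) + (px v t x * u t x ^ 2 + v t x * (2 * u t x * px u t x)) +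
      3 * u t x ^ 2 * px u t x := fun t x => by
    have dv := sv.hasDerivAt_x t x
    have du := su.hasDerivAt_x t x
    refine ((((dv.pow 3).add ((dv.pow 2).mul du)).add (dv.mul (du.pow 2))).add
      (du.pow 3)).deriv.trans ?_
    simp
  refine ⟨sw.pow 2, (sq.mul (sw.mul sw1)).const_mul 2, ((sw1.pow 2).const_mul 3).sub
    ((sq.mul (sw.pow 2)).const_mul 2), Sm.const 0, (sw.pow 2).const_mul _, fun t x => ?_⟩
  have e0 : pt (fun t x => w t x ^ 2) t x = 2 * (w t x * (pt v t x - pt u t x)) := by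
    refine (((sv.hasDerivAt_t t x).sub (su.hasDerivAt_t t x)).pow 2).deriv.trans ?_
    simp [hw]; ring
  have e1 : px (fun t x => 3 * w1 t x ^ 2 - 2 * (q t x * w t x ^ 2)) t x =
      6 * (w1 t x * px w1 t x) - 2 * (px q t x * w t x ^ 2 + q t x * (2 * (w t x * w1 t x))) := by
    have dw := sw.hasDerivAt_x t x
    rw [pw] at dw
    refine ((((sw1.hasDerivAt_x t x).pow 2).const_mul 3).sub
      (((sq.hasDerivAt_x t x).mul (dw.pow 2)).const_mul 2)).deriv.trans ?_
    simp; ring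
  have e3 : px (px (px (fun t x => (-1) * w t x ^ 2))) t x =
      -(2 * (3 * (w1 t x * px w1 t x) + w t x * px (px w1) t x)) := by
    rw [px_const_mul (sw.pow 2), px_sq sw, pw, px_const_mul ((sw.mul sw1).const_mul 2),
      px_const_mul (sw.mul sw1), px_const_mul ((sw.mul sw1).px.const_mul 2),
      px_const_mul (sw.mul sw1).px, px_mul sw sw1, pw, px_add (sw1.mul sw1) (sw.mul sw1.px),
      px_mul sw1 sw1, px_mul sw sw1.px, pw]
    ring
  rw [e0, e1, e3, px_zero, px_zero, sol_pt hu, sol_pt hv]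
  simp only [px_pot su, px_pot sv, pq, pw2, pw1]
  simp only [hw, hw1, hq]
  ring

lemma time_shift_sol (hu : IsGKdVSolution u) (h : ℝ) : IsGKdVSolution (fun t x => u (t + h) x) := by
  refine ⟨?_, fun t x => ?_, fun t k => hu.2.2 (t + h) k⟩
  · have := (sol_sm hu).affine 1 h 0 1 0
    simpa [Sm] using this
  · have h1 := hu.2.1 (t + h) x
    have : deriv (fun s => u (s + h) x) t = deriv (fun s => u s x) (t + h) :=
      deriv_comp_add_const (fun s => u s x) h t
    rw [this]; exact h1

end GKdV

namespace GKdV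

variable {u : ℝ → ℝ → ℝ}

lemma cross_le {p X k w w1 : ℝ} (hp : 0 ≤ p) (hX : 0 ≤ X) (h : k ^ 2 ≤ 3 * p * X) :
    2 * (k * (w * w1)) ≤ 3 * p * w1 ^ 2 + X * w ^ 2 := by
  refine abs_le_of_sq_le_sq' ?_ (by positivity) |>.2
  have h1 : k ^ 2 * (w * w1) ^ 2 ≤ 3 * p * X * (w * w1) ^ 2 := by gcongr
  nlinarith [sq_nonneg (3 * p * w1 ^ 2 - X * w ^ 2)]

lemma quart_bound {A v w : ℝ} (hv : |v| ≤ A) (hw : |w| ≤ A) :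
    |v ^ 3 + v ^ 2 * w + v * w ^ 2 + w ^ 3| ≤ 4 * A ^ 3 ∧
    (v ^ 3 + v ^ 2 * w + v * w ^ 2 + w ^ 3) ^ 2 ≤ 8 * A ^ 2 * (v ^ 4 + w ^ 4) := by
  have hA : 0 ≤ A := (abs_nonneg _).trans hv
  have h1 : |v ^ 3 + v ^ 2 * w + v * w ^ 2 + w ^ 3| ≤
      |v| ^ 3 + |v| ^ 2 * |w| + |v| * |w| ^ 2 + |w| ^ 3 := by
    refine (abs_add_le _ _).trans ?_
    refine add_le_add ((abs_add_le _ _).trans (add_le_add ((abs_add_le _ _).trans ?_) ?_)) ?_ <;>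
      simp [abs_mul, abs_pow]
  refine ⟨h1.trans ?_, ?_⟩
  · calc _ ≤ A ^ 3 + A ^ 2 * A + A * A ^ 2 + A ^ 3 := by gcongr
      _ = _ := by ring
  · have e : (v ^ 3 + v ^ 2 * w + v * w ^ 2 + w ^ 3) ^ 2 = (v + w) ^ 2 * (v ^ 2 + w ^ 2) ^ 2 := by
      ring
    rw [e]
    have s1 : v ^ 2 ≤ A ^ 2 := sq_le_sq' (by linarith [(abs_le.1 hv).1]) (abs_le.1 hv).2
    have s2 : w ^ 2 ≤ A ^ 2 := sq_le_sq' (by linarith [(abs_le.1 hw).1]) (abs_le.1 hw).2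
    have s3 : (v + w) ^ 2 ≤ 4 * A ^ 2 := by nlinarith [sq_nonneg (v - w)]
    have s4 : (v ^ 2 + w ^ 2) ^ 2 ≤ 2 * (v ^ 4 + w ^ 4) := by nlinarith [sq_nonneg (v ^ 2 - w ^ 2)]
    calc _ ≤ (4 * A ^ 2) * (2 * (v ^ 4 + w ^ 4)) := by gcongr
      _ = _ := by ring

lemma diff_flux_le {A K S P p p' q d d1 : ℝ} (A0 : 0 ≤ A) (K0 : 0 ≤ K) (P0 : 0 ≤ P) (PS : P ≤ S)
    (p0 : 0 ≤ p) (pS : p ≤ S) (p2 : p' ≤ S) (q1 : |q| ≤ 4 * A ^ 3) (q3 : q ^ 2 ≤ K * p) :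
    (2 * (q * (d * d1)) - (K * (1 + S) ^ 2 + 8 * A ^ 3 * S + S) * d ^ 2) * (1 + P) -
      (3 * d1 ^ 2 - 2 * (q * d ^ 2)) * p + d ^ 2 * p' ≤ 0 := by
  have S0 : 0 ≤ S := P0.trans PS
  set κ : ℝ := K * (1 + S) ^ 2 + 8 * A ^ 3 * S + S with hκ
  have κ0 : 0 ≤ κ := by positivity
  have c1 := cross_le (w := d) (w1 := d1) (k := q * (1 + P)) (X := K * (1 + S) ^ 2) p0
    (by positivity) (by
      have : (1 + P) ^ 2 ≤ (1 + S) ^ 2 := by gcongr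
      calc (q * (1 + P)) ^ 2 = q ^ 2 * (1 + P) ^ 2 := by ring
        _ ≤ K * p * (1 + S) ^ 2 := by gcongr
        _ ≤ _ := by nlinarith [mul_nonneg (mul_nonneg K0 p0) (sq_nonneg (1 + S))])
  have c2 : q * p ≤ 4 * A ^ 3 * S := by
    calc q * p ≤ |q| * p := by gcongr; exact le_abs_self q
      _ ≤ _ := by gcongr
  have c3 : 0 ≤ κ * d ^ 2 * P := by positivity
  have c4 : d ^ 2 * p' ≤ d ^ 2 * S := by gcongr
  have c5 : d ^ 2 * (q * p) ≤ d ^ 2 * (4 * A ^ 3 * S) := by gcongr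
  have e : κ * d ^ 2 = K * (1 + S) ^ 2 * d ^ 2 + 2 * (d ^ 2 * (4 * A ^ 3 * S)) + d ^ 2 * S := by
    rw [hκ]; ring
  have e2 : (2 * (q * (d * d1)) - κ * d ^ 2) * (1 + P) -
      (3 * d1 ^ 2 - 2 * (q * d ^ 2)) * p + d ^ 2 * p' =
      2 * (q * (1 + P) * (d * d1)) - κ * d ^ 2 - κ * d ^ 2 * P - 3 * p * d1 ^ 2 +
        2 * (d ^ 2 * (q * p)) + d ^ 2 * p' := by ring
  rw [e2]; linarith

set_option maxHeartbeats 1000000 in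
lemma HB.diff {a b B : ℝ} (hB : HB u a b B) (hu : IsGKdVSolution u) (hab : a ≤ b) :
    ∃ C, 0 ≤ C ∧ ∀ h t, 0 ≤ h → a ≤ t → t + h ≤ b →
      ∫ x, (u (t + h) x - u t x) ^ 2 ≤ C * ∫ x, (u (a + h) x - u a x) ^ 2 := by
  obtain ⟨ρ, iρ, ρ0, hρ⟩ := hB.four_le_conv hu hab
  have B0 := hB.nonneg hab
  set A : ℝ := 1 + B with hA
  set S : ℝ := ∫ y, |ρ y| with hS
  have S0 : 0 ≤ S := integral_nonneg fun y => abs_nonneg _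
  have hsb : ∀ x, |sigmoid x| ≤ 1 := fun x => by
    rw [abs_of_pos (sigmoid_pos x)]; exact (sigmoid_lt_one x).le
  have hbb : ∀ x, |bell x| ≤ 1 / 4 := fun x => by
    rw [abs_of_pos (bell_pos x)]; exact bell_le x
  have hb1 : ∀ x, |bell1 x| ≤ 1 / 4 := fun x => (abs_bell1 x).trans (bell_le x)
  have hb2 : ∀ x, |bell2 x| ≤ 1 / 4 := fun x => (abs_bell2 x).trans (bell_le x)
  have w : Wt (fun x => 1 + conv ρ sigmoid x) (conv ρ bell) (conv ρ bell1) (conv ρ bell2) := by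
    refine ⟨fun x => (conv_hasDerivAt iρ hasDerivAt_sig continuous_bell hsb hbb x).const_add 1,
      fun x => conv_hasDerivAt iρ hasDerivAt_bell continuous_bell1 hbb hb1 x,
      fun x => conv_hasDerivAt iρ hasDerivAt_bell1 continuous_bell2 hb1 hb2 x,
      conv_continuous iρ continuous_bell2 hb2, 1 + S, fun x => ?_⟩
    have c0 := conv_bdd iρ continuous_sigmoid hsb x
    have c1 := conv_bdd iρ continuous_bell hbb x
    have c2 := conv_bdd iρ continuous_bell1 hb1 x
    have c3 := conv_bdd iρ continuous_bell2 hb2 x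
    refine ⟨(abs_add_le _ _).trans (by rw [abs_one]; linarith), ?_, ?_, ?_⟩ <;> linarith
  have P0 : ∀ x, 0 ≤ conv ρ sigmoid x := fun x =>
    integral_nonneg fun y => mul_nonneg (ρ0 y) (sigmoid_pos _).le
  have PS : ∀ x, conv ρ sigmoid x ≤ S := fun x => by
    have := (le_abs_self _).trans (conv_bdd iρ continuous_sigmoid hsb x); linarith
  have p0 : ∀ x, 0 ≤ conv ρ bell x := fun x =>
    integral_nonneg fun y => mul_nonneg (ρ0 y) (bell_pos _).le
  have pS : ∀ x, conv ρ bell x ≤ S := fun x => by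
    have := (le_abs_self _).trans (conv_bdd iρ continuous_bell hbb x); linarith
  have p2 : ∀ x, conv ρ bell2 x ≤ S := fun x => by
    have := (le_abs_self _).trans (conv_bdd iρ continuous_bell2 hb2 x); linarith
  set K : ℝ := 8 * A ^ 2 * (64 * B) with hK
  have K0 : 0 ≤ K := by positivity
  set κ : ℝ := K * (1 + S) ^ 2 + 8 * A ^ 3 * S + S with hκ
  have κ0 : 0 ≤ κ := by positivity
  refine ⟨exp (κ * (b - a)) * (1 + S), by positivity, fun h t h0 hat htb => ?_⟩
  set v : ℝ → ℝ → ℝ := fun t x => u (t + h) x with hv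
  have sv : IsGKdVSolution v := time_shift_sol hu h
  have hBv : HB v a t B := fun s hs => hB (s + h) ⟨by linarith [hs.1], by linarith [hs.2]⟩
  have hBu : HB u a t B := hB.mono le_rfl (by linarith)
  have L := diff_law hu sv
  have bH : BddL1 (fun t x => hden u t x + hden v t x) a t := (hBu.bdd hu).add (hBv.bdd sv)
  have sq2 : ∀ p q : ℝ, (p - q) ^ 2 ≤ 2 * (p ^ 2 + q ^ 2) := fun p q => by
    nlinarith [sq_nonneg (p + q)]
  have nn : ∀ s x, 0 ≤ hden u s x + hden v s x := fun s x =>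
    add_nonneg (hden_nonneg s x) (hden_nonneg s x)
  have w2 : ∀ s x, (v s x - u s x) ^ 2 ≤ 2 * (hden u s x + hden v s x) := fun s x => by
    have := sq2 (v s x) (u s x)
    unfold hden; nlinarith [sq_nonneg (px u s x), sq_nonneg (px v s x)]
  have w12 : ∀ s x, (px v s x - px u s x) ^ 2 ≤ 2 * (hden u s x + hden v s x) := fun s x => by
    have := sq2 (px v s x) (px u s x)
    unfold hden; nlinarith [sq_nonneg (u s x), sq_nonneg (v s x)]
  have bD : BddL1 (fun t x => (v t x - u t x) ^ 2) a t := bH.of_le L.sD.cont_x 2 fun s _ x => by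
    rw [abs_of_nonneg (sq_nonneg _), abs_of_nonneg (nn s x)]; exact w2 s x
  have b3 : BddL1 (fun t x => (-1) * (v t x - u t x) ^ 2) a t :=
    bH.of_le L.s3.cont_x 2 fun s _ x => by
      rw [abs_mul, abs_neg, abs_one, one_mul, abs_of_nonneg (sq_nonneg _), abs_of_nonneg (nn s x)]
      exact w2 s x
  have qb : ∀ s ∈ Set.Icc a t, ∀ x, _ := fun s hs x =>
    quart_bound (hBv.ptw sv hs x) (hBu.ptw hu hs x)
  have A0 : 0 ≤ A := by positivity
  have b0 := bH.of_le L.s0.cont_x (16 * A ^ 3) fun s hs x => by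
    obtain ⟨q1, -⟩ := qb s hs x
    rw [abs_of_nonneg (nn s x), abs_mul, abs_mul, abs_two]
    have : |(v s x - u s x) * (px v s x - px u s x)| ≤ 2 * (hden u s x + hden v s x) := by
      have h1 := w2 s x
      have h2 := w12 s x
      rw [abs_le]; constructor <;> nlinarith [sq_nonneg (v s x - u s x + (px v s x - px u s x)),
        sq_nonneg (v s x - u s x - (px v s x - px u s x))]
    calc _ ≤ 2 * ((4 * A ^ 3) * (2 * (hden u s x + hden v s x))) := by gcongr
      _ = _ := by ring
  have b1 := bH.of_le L.s1.cont_x (6 + 16 * A ^ 3) fun s hs x => by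
    obtain ⟨q1, -⟩ := qb s hs x
    rw [abs_of_nonneg (nn s x)]
    refine (abs_sub _ _).trans ?_
    rw [abs_mul, abs_mul, abs_mul, abs_of_nonneg (sq_nonneg (px v s x - px u s x)),
      abs_of_nonneg (sq_nonneg (v s x - u s x))]
    have e : |(3 : ℝ)| = 3 := abs_of_pos (by norm_num)
    rw [e, abs_two]
    calc _ ≤ 3 * (2 * (hden u s x + hden v s x)) +
          2 * ((4 * A ^ 3) * (2 * (hden u s x + hden v s x))) := by
          gcongr
          · exact w12 s x
          · exact w2 s x
      _ = _ := by ring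
  have b0' : BddL1 _ a t := b0.add (bD.of_le (fun s => (L.sD.const_mul (-κ)).cont_x s) |κ|
    fun s _ x => by rw [abs_mul, abs_neg])
  have key := (L.exp_mul κ).le w hat 0 0 (bD.exp_mul κ) (by
      have := b0'.exp_mul κ
      simpa only [neg_mul, ← sub_eq_add_neg] using this) (b1.exp_mul κ)
    (by simpa using BddL1.zero a t) (b3.exp_mul κ) (fun _ => 0) (by simp) (fun s hs => by
      refine integral_nonpos fun x => ?_
      simp only [flux, zero_mul, add_zero, mul_zero, sub_zero, Pi.zero_apply]
      obtain ⟨q1, q2⟩ := qb s hs x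
      have hs' : s ∈ Set.Icc a b := ⟨hs.1, by linarith [hs.2]⟩
      have f1 := hρ s hs' x
      have f2 : v s x ^ 4 ≤ _ := hρ (s + h) ⟨by linarith [hs.1], by linarith [hs.2]⟩ x
      have P0 := P0 x
      have PS := PS x
      have p0 := p0 x
      have pS := pS x
      have p2 := p2 x
      generalize conv ρ sigmoid x = P at *
      generalize conv ρ bell x = p at *
      generalize conv ρ bell2 x = p' at *
      generalize v s x ^ 3 + v s x ^ 2 * u s x + v s x * u s x ^ 2 + u s x ^ 3 = q at *
      have q3 : q ^ 2 ≤ K * p := by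
        refine q2.trans ?_
        calc _ ≤ 8 * A ^ 2 * (32 * B * p + 32 * B * p) := by gcongr
          _ = _ := by rw [hK]; ring
      have e0 := exp_pos (-κ * s)
      generalize v s x - u s x = d at *
      generalize px v s x - px u s x = d1 at *
      have := diff_flux_le (d := d) (d1 := d1) A0 K0 P0 PS p0 pS p2 q1 q3
      rw [← hκ] at this
      have e1 := mul_nonneg e0.le (neg_nonneg.2 this)
      linarith)
  simp only [zero_mul, sub_zero, add_zero, intervalIntegral.integral_zero] at key
  obtain ⟨C, hC⟩ := bD
  have ia := (hC a ⟨le_rfl, hat⟩).1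
  have it := (hC t ⟨hat, le_rfl⟩).1
  have lo : exp (-κ * t) * ∫ x, (v t x - u t x) ^ 2 ≤
      ∫ x, exp (-κ * t) * (v t x - u t x) ^ 2 * (1 + conv ρ sigmoid x) := by
    rw [← integral_const_mul]
    refine integral_mono (it.const_mul _) ((it.const_mul _).mul_bdd (c := 1 + S)
      w.c0.aestronglyMeasurable (Eventually.of_forall fun x => ?_)) fun x => ?_
    · rw [Real.norm_eq_abs, abs_of_nonneg (by linarith [P0 x])]; linarith [PS x]
    · exact le_mul_of_one_le_right (by positivity) (by linarith [P0 x])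
  have hi : ∫ x, exp (-κ * a) * (v a x - u a x) ^ 2 * (1 + conv ρ sigmoid x) ≤
      exp (-κ * a) * (1 + S) * ∫ x, (v a x - u a x) ^ 2 := by
    rw [← integral_const_mul]
    refine integral_mono ((ia.const_mul _).mul_bdd (c := 1 + S)
      w.c0.aestronglyMeasurable (Eventually.of_forall fun x => ?_)) (ia.const_mul _) fun x => ?_
    · rw [Real.norm_eq_abs, abs_of_nonneg (by linarith [P0 x])]; linarith [PS x]
    · have := PS x
      have h2 : exp (-κ * a) * (v a x - u a x) ^ 2 * (1 + conv ρ sigmoid x) ≤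
        exp (-κ * a) * (v a x - u a x) ^ 2 * (1 + S) := by gcongr
      linarith
  have fin := lo.trans (key.trans hi)
  have i0 : 0 ≤ ∫ x, (v a x - u a x) ^ 2 := integral_nonneg fun x => sq_nonneg _
  calc ∫ x, (v t x - u t x) ^ 2 = exp (κ * t) * (exp (-κ * t) * ∫ x, (v t x - u t x) ^ 2) := by
        rw [← mul_assoc, ← exp_add]; simp
    _ ≤ exp (κ * t) * (exp (-κ * a) * (1 + S) * ∫ x, (v a x - u a x) ^ 2) := by gcongr
    _ = exp (κ * (t - a)) * (1 + S) * ∫ x, (v a x - u a x) ^ 2 := by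
        rw [← mul_assoc, ← mul_assoc, ← exp_add]; ring_nf
    _ ≤ exp (κ * (b - a)) * (1 + S) * ∫ x, (v a x - u a x) ^ 2 := by
        gcongr; linarith

end GKdV

namespace GKdV

variable {u : ℝ → ℝ → ℝ}

lemma integrable_of_sq_dom {f g h : ℝ → ℝ} (hf : Continuous f) (ig : Integrable g) (ih : Integrable h)
    (hle : ∀ x, |f x| ≤ g x + h x) : Integrable f :=
  (ig.add ih).mono' hf.aestronglyMeasurable (Eventually.of_forall hle)

/-- Pairing of a solution with its value at a fixed time. -/
lemma pairing_law (hu : IsGKdVSolution u) (a : ℝ) :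
    CLaw (fun t x => u a x * u t x)
      (fun t x => px (px (px u)) a x * u t x + px u a x * u t x ^ 4)
      (fun t x => -3 * (px (px u) a x * u t x) - u a x * u t x ^ 4)
      (fun t x => 3 * (px u a x * u t x)) (fun t x => (-1) * (u a x * u t x)) := by
  have s := sol_sm hu
  have fr : ∀ f : ℝ → ℝ → ℝ, Sm f → Sm (fun _ x => f a x) := fun f hf => by
    simpa using hf.affine 0 a 0 1 0
  have pfr : ∀ f : ℝ → ℝ → ℝ, px (fun _ x => f a x) = fun _ x => px f a x := fun f => rfl
  set f0 : ℝ → ℝ → ℝ := fun _ x => u a x with hf0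
  set f1 : ℝ → ℝ → ℝ := fun _ x => px u a x with hf1
  set f2 : ℝ → ℝ → ℝ := fun _ x => px (px u) a x with hf2
  set f3 : ℝ → ℝ → ℝ := fun _ x => px (px (px u)) a x with hf3
  have s0 : Sm f0 := fr u s
  have s1 : Sm f1 := fr _ s.px
  have s2 : Sm f2 := fr _ s.px.px
  have s3 : Sm f3 := fr _ s.px.px.px
  have p0 : px f0 = f1 := rfl
  have p1 : px f1 = f2 := rfl
  have p2 : px f2 = f3 := rfl
  refine ⟨s0.mul s, (s3.mul s).add (s1.mul (s.pow 4)), ((s2.mul s).const_mul _).sub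
    (s0.mul (s.pow 4)), (s1.mul s).const_mul _, (s0.mul s).const_mul _, fun t x => ?_⟩
  change pt (fun t x => f0 t x * u t x) t x = (f3 t x * u t x + f1 t x * u t x ^ 4) +
    px (fun t x => -3 * (f2 t x * u t x) - f0 t x * u t x ^ 4) t x +
    px (px (fun t x => 3 * (f1 t x * u t x))) t x + px (px (px (fun t x => (-1) * (f0 t x * u t x)))) t x
  have e0 : pt (fun t x => f0 t x * u t x) t x = f0 t x * pt u t x :=
    ((s.hasDerivAt_t t x).const_mul _).deriv
  have e1 : px (fun t x => -3 * (f2 t x * u t x) - f0 t x * u t x ^ 4) t x =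
      -3 * (f3 t x * u t x + f2 t x * px u t x) -
        (f1 t x * u t x ^ 4 + f0 t x * (4 * u t x ^ 3 * px u t x)) := by
    have du := s.hasDerivAt_x t x
    refine ((((s2.hasDerivAt_x t x).mul du).const_mul (-3)).sub
      ((s0.hasDerivAt_x t x).mul (du.pow 4))).deriv.trans ?_
    rw [p2, p0]; simp
  have e2 : px (px (fun t x => 3 * (f1 t x * u t x))) t x =
      3 * (f3 t x * u t x + 2 * (f2 t x * px u t x) + f1 t x * px (px u) t x) := by
    rw [px_const_mul (s1.mul s), px_const_mul (s1.mul s).px, px_mul s1 s, p1,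
      px_add (s2.mul s) (s1.mul s.px), px_mul s2 s, px_mul s1 s.px, p2, p1]; ring
  have e3 : px (px (px (fun t x => (-1) * (f0 t x * u t x)))) t x =
      -(f3 t x * u t x + 3 * (f2 t x * px u t x) + 3 * (f1 t x * px (px u) t x) +
        f0 t x * px (px (px u)) t x) := by
    have h1 : px (px (fun t x => f0 t x * u t x)) = fun t x => f2 t x * u t x +
        2 * (f1 t x * px u t x) + f0 t x * px (px u) t x := by
      rw [px_mul s0 s, p0]
      ext t x
      rw [px_add (s1.mul s) (s0.mul s.px), px_mul s1 s, px_mul s0 s.px, p1, p0]; ring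
    rw [px_const_mul (s0.mul s), px_const_mul (s0.mul s).px, px_const_mul (s0.mul s).px.px, h1,
      px_add ((s2.mul s).add ((s1.mul s.px).const_mul 2)) (s0.mul s.px.px),
      px_add (s2.mul s) ((s1.mul s.px).const_mul 2), px_const_mul (s1.mul s.px), px_mul s2 s,
      px_mul s1 s.px, px_mul s0 s.px.px, p2, p1, p0]; ring
  rw [e0, e1, e2, e3, sol_pt hu]
  simp only [px_pot s]
  ring

lemma mul_abs_le (p q : ℝ) : |p * q| ≤ 1 / 2 * p ^ 2 + 1 / 2 * q ^ 2 := by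
  rw [abs_le]; constructor <;> nlinarith [sq_nonneg (p + q), sq_nonneg (p - q)]

lemma HB.lipschitz {a b B : ℝ} (hB : HB u a b B) (hu : IsGKdVSolution u) (hab : a ≤ b) :
    ∃ C, 0 ≤ C ∧ ∀ h, 0 ≤ h → a + h ≤ b → ∫ x, (u (a + h) x - u a x) ^ 2 ≤ C * h ^ 2 := by
  have s := sol_sm hu
  have B0 := hB.nonneg hab
  set A : ℝ := 1 + B with hA
  have A0 : 0 ≤ A := by positivity
  have i0 := sol_int0 hu
  have i1 := sol_int1 hu
  have i3 := sol_int3 hu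
  have L := pairing_law hu a
  set g : ℝ → ℝ := fun x => |px (px (px u)) a x| + 4 * A ^ 3 * |px u a x| with hg
  have cg : Continuous g := (s.px.px.px.cont_x a).abs.add ((s.px.cont_x a).abs.const_mul _)
  have ig : Integrable fun x => g x ^ 2 := by
    refine integrable_of_sq_dom (cg.pow 2) ((i3 a).const_mul 2)
      ((i1 a).const_mul (2 * (4 * A ^ 3) ^ 2)) fun x => ?_
    rw [abs_of_nonneg (sq_nonneg _), ← sq_abs (px (px (px u)) a x), ← sq_abs (px u a x)]
    simp only [hg]
    nlinarith [sq_nonneg (|px (px (px u)) a x| - 4 * A ^ 3 * |px u a x|)]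
  set G : ℝ := ∫ x, g x ^ 2 with hG
  have G0 : 0 ≤ G := integral_nonneg fun x => sq_nonneg _
  -- bounds on the fluxes
  have bu : BddL1 (fun t x => u t x ^ 2) a b := (hB.law_bdd hu).1
  have bfix : ∀ f : ℝ → ℝ, Integrable (fun x => f x ^ 2) →
      BddL1 (fun t x => f x ^ 2 + u t x ^ 2) a b := fun f hf =>
    BddL1.add ⟨∫ x, |f x ^ 2|, fun t _ => ⟨hf, le_rfl⟩⟩ bu
  have bprod : ∀ f : ℝ → ℝ, Continuous f → Integrable (fun x => f x ^ 2) →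
      BddL1 (fun t x => f x * u t x) a b := fun f cf hf =>
    (bfix f hf).of_le (fun t => cf.mul (s.cont_x t)) 1 fun t _ x => by
      rw [abs_of_nonneg (by positivity : 0 ≤ f x ^ 2 + u t x ^ 2)]
      have := mul_abs_le (f x) (u t x)
      nlinarith [sq_nonneg (f x), sq_nonneg (u t x)]
  have bprod4 : ∀ f : ℝ → ℝ, Continuous f → Integrable (fun x => f x ^ 2) →
      BddL1 (fun t x => f x * u t x ^ 4) a b := fun f cf hf =>
    (bprod f cf hf).of_le (fun t => cf.mul ((s.pow 4).cont_x t)) (A ^ 3) fun t ht x => by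
      have h1 := hB.ptw hu ht x
      rw [abs_mul, abs_mul, abs_pow]
      calc |f x| * |u t x| ^ 4 = |u t x| ^ 3 * (|f x| * |u t x|) := by ring
        _ ≤ A ^ 3 * (|f x| * |u t x|) := by gcongr
  have bm : ∀ (f : ℝ → ℝ → ℝ) (k : ℝ), BddL1 f a b → (∀ t, Continuous (f t)) →
      BddL1 (fun t x => k * f t x) a b := fun f k hf cf =>
    hf.of_le (fun t => (cf t).const_mul k) |k| fun t _ x => (abs_mul _ _).le
  have b0 := (bprod _ (s.px.px.px.cont_x a) (i3 a)).add (bprod4 _ (s.px.cont_x a) (i1 a))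
  have b1 : BddL1 (fun t x => -3 * (px (px u) a x * u t x) - u a x * u t x ^ 4) a b := by
    have := (bm _ (-3) (bprod _ (s.px.px.cont_x a) (sol_int2 hu a)) fun t =>
      (s.px.px.cont_x a).mul (s.cont_x t)).add (bm _ (-1) (bprod4 _ (s.cont_x a) (i0 a)) fun t =>
      (s.cont_x a).mul ((s.pow 4).cont_x t))
    simpa only [neg_one_mul, ← sub_eq_add_neg] using this
  have b2 := bm _ 3 (bprod _ (s.px.cont_x a) (i1 a)) fun t => (s.px.cont_x a).mul (s.cont_x t)
  have b3 := bm _ (-1) (bprod _ (s.cont_x a) (i0 a)) fun t => (s.cont_x a).mul (s.cont_x t)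
  obtain ⟨Cb, hCb⟩ := b0
  have bsub : ∀ {f : ℝ → ℝ → ℝ} {t : ℝ}, t ≤ b → BddL1 f a b → BddL1 f a t :=
    fun ht ⟨C, hC⟩ => ⟨C, fun r hr => hC r ⟨hr.1, hr.2.trans ht⟩⟩
  set F : ℝ → ℝ := fun t => ∫ x, (px (px (px u)) a x * u t x + px u a x * u t x ^ 4) with hF
  -- the flux vanishes at the initial time
  have Fa : F a = 0 := by
    have a_mem : a ∈ Set.Icc a b := ⟨le_rfl, hab⟩
    refine integral_eq_zero_of_hasDerivAt_of_integrable
      (f := fun x => u a x * px (px u) a x - 1 / 2 * px u a x ^ 2 + 1 / 5 * u a x ^ 5)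
      (fun x => ?_) (hCb a a_mem).1 ?_
    · have d0 := s.hasDerivAt_x a x
      have d1 := s.px.hasDerivAt_x a x
      have d2 := s.px.px.hasDerivAt_x a x
      refine (((d0.mul d2).sub ((d1.pow 2).const_mul (1 / 2))).add
        ((d0.pow 5).const_mul (1 / 5))).congr_deriv ?_
      norm_num; ring
    · refine ((integrable_mul_of_sq (s.cont_x a) (s.px.px.cont_x a) (i0 a) (sol_int2 hu a)).sub
        ((i1 a).const_mul _)).add (Integrable.const_mul ?_ _)
      refine ((i0 a).const_mul (A ^ 3)).mono' ((s.pow 5).cont_x a).aestronglyMeasurable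
        (Eventually.of_forall fun x => abs_pow5_le (hB.ptw hu a_mem x))
  set N : ℝ → ℝ := fun t => ∫ x, (u t x - u a x) ^ 2 with hN
  have iw : ∀ t, Integrable fun x => (u t x - u a x) ^ 2 := fun t =>
    integrable_of_sq_dom (((s.cont_x t).sub (s.cont_x a)).pow 2) ((i0 t).const_mul 2)
      ((i0 a).const_mul 2) fun x => by
        rw [abs_of_nonneg (sq_nonneg _)]; nlinarith [sq_nonneg (u t x + u a x)]
  have Fle : ∀ t ∈ Set.Icc a b, ∀ α > 0, 2 * |F t| ≤ α * G + N t / α := fun t ht α hα => by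
    have e : F t = ∫ x, ((px (px (px u)) a x * u t x + px u a x * u t x ^ 4) -
        (px (px (px u)) a x * u a x + px u a x * u a x ^ 4)) := by
      rw [integral_sub (hCb t ht).1 (hCb a ⟨le_rfl, hab⟩).1]
      change F t = F t - F a
      rw [Fa, sub_zero]
    have h1 : |F t| ≤ ∫ x, (α / 2 * g x ^ 2 + 1 / (2 * α) * (u t x - u a x) ^ 2) := by
      rw [e, ← Real.norm_eq_abs]
      refine norm_integral_le_of_norm_le ((ig.const_mul _).add ((iw t).const_mul _))
        (Eventually.of_forall fun x => ?_)
      have p1 := (quart_bound (hB.ptw hu ht x) (hB.ptw hu ⟨le_rfl, hab⟩ x)).1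
      have e2 : (px (px (px u)) a x * u t x + px u a x * u t x ^ 4) -
        (px (px (px u)) a x * u a x + px u a x * u a x ^ 4) =
        px (px (px u)) a x * (u t x - u a x) + px u a x * ((u t x ^ 3 + u t x ^ 2 * u a x +
          u t x * u a x ^ 2 + u a x ^ 3) * (u t x - u a x)) := by ring
      rw [e2, Real.norm_eq_abs]
      have h2 : |px (px (px u)) a x * (u t x - u a x) + px u a x * ((u t x ^ 3 + u t x ^ 2 * u a x +
          u t x * u a x ^ 2 + u a x ^ 3) * (u t x - u a x))| ≤ g x * |u t x - u a x| := by
        refine (abs_add_le _ _).trans ?_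
        rw [abs_mul, abs_mul, abs_mul]
        have : |px u a x| * (|u t x ^ 3 + u t x ^ 2 * u a x +
          u t x * u a x ^ 2 + u a x ^ 3| * |u t x - u a x|) ≤
          |px u a x| * (4 * A ^ 3 * |u t x - u a x|) := by gcongr
        simp only [hg]
        nlinarith
      refine h2.trans ?_
      rw [← sq_abs (u t x - u a x)]
      have h3 : α / 2 * g x ^ 2 + 1 / (2 * α) * |u t x - u a x| ^ 2 - g x * |u t x - u a x| =
        1 / (2 * α) * (α * g x - |u t x - u a x|) ^ 2 := by field_simp; ring
      have h4 : 0 ≤ 1 / (2 * α) * (α * g x - |u t x - u a x|) ^ 2 := by positivity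
      linarith
    rw [integral_add (ig.const_mul _) ((iw t).const_mul _), integral_const_mul,
      integral_const_mul] at h1
    have : α * G + N t / α = 2 * (α / 2 * G + 1 / (2 * α) * N t) := by field_simp
    rw [this]; linarith
  have Neq : ∀ t ∈ Set.Icc a b, N t = -2 * ∫ r in a..t, F r := fun t ht => by
    have ip : ∀ t ∈ Set.Icc a b, Integrable fun x => u a x * u t x := fun t _ =>
      integrable_mul_of_sq (s.cont_x a) (s.cont_x t) (i0 a) (i0 t)
    have w : Wt (fun _ => 1) (fun _ => 0) (fun _ => 0) (fun _ => 0) :=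
      ⟨fun x => hasDerivAt_const x _, fun x => hasDerivAt_const x _, fun x => hasDerivAt_const x _,
        continuous_const, 1, fun x => by simp⟩
    have key := L.global w ht.1 (ip a ⟨le_rfl, hab⟩) (ip t ht) (bsub ht.2 ⟨Cb, hCb⟩) (bsub ht.2 b1)
      (bsub ht.2 b2) (bsub ht.2 b3)
    simp only [mul_one, mul_zero, sub_zero, add_zero] at key
    have hm := (hB.mono le_rfl ht.2).mass hu ht.1
    have e1 : N t = (∫ x, u t x ^ 2) + (∫ x, u a x ^ 2) - 2 * ∫ x, u a x * u t x := by
      have ia : Integrable fun x => u t x ^ 2 + u a x ^ 2 := (i0 t).add (i0 a)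
      rw [← integral_const_mul, ← integral_add (i0 t) (i0 a),
        ← integral_sub ia ((ip t ht).const_mul 2)]
      refine integral_congr_ae (Eventually.of_forall fun x => ?_)
      simp only; ring
    have e2 : ∫ x, u a x * u a x = ∫ x, u a x ^ 2 :=
      integral_congr_ae (Eventually.of_forall fun x => by simp only; ring)
    rw [e1, hm]
    linarith
  refine ⟨4 * G, by positivity, fun h h0 hb => ?_⟩
  rcases h0.eq_or_lt with rfl | hpos
  · simp
  set T := Set.Icc a (a + h)
  have hT : T ⊆ Set.Icc a b := Set.Icc_subset_Icc le_rfl hb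
  have bddN : BddAbove (N '' T) := by
    refine ⟨4 * B, ?_⟩
    rintro _ ⟨t, ht, rfl⟩
    have m : ∀ t ∈ Set.Icc a b, ∫ x, u t x ^ 2 ≤ B := fun t ht =>
      (integral_mono (i0 t) (hden_int hu t) fun x => by
        unfold hden; nlinarith [sq_nonneg (px u t x)]).trans (hB t ht)
    have : N t ≤ ∫ x, (2 * u t x ^ 2 + 2 * u a x ^ 2) :=
      integral_mono (iw t) (((i0 t).const_mul 2).add ((i0 a).const_mul 2)) fun x => by
        simp only; nlinarith [sq_nonneg (u t x + u a x)]
    rw [integral_add ((i0 t).const_mul 2) ((i0 a).const_mul 2), integral_const_mul,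
      integral_const_mul] at this
    have h1 := m t (hT ht)
    have h2 := m a ⟨le_rfl, hab⟩
    linarith
  have leS : ∀ t ∈ T, N t ≤ sSup (N '' T) := fun t ht => le_csSup bddN ⟨t, ht, rfl⟩
  have Sle : sSup (N '' T) ≤ 2 * h ^ 2 * G + sSup (N '' T) / 2 := by
    refine csSup_le ⟨_, a, ⟨le_rfl, by linarith⟩, rfl⟩ ?_
    rintro _ ⟨t, ht, rfl⟩
    have S0 : 0 ≤ sSup (N '' T) :=
      (integral_nonneg fun x => sq_nonneg _).trans (leS a ⟨le_rfl, by linarith⟩)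
    rw [Neq t (hT ht)]
    have h1 : ‖∫ r in a..t, F r‖ ≤ (h * G + sSup (N '' T) / (4 * h)) * |t - a| := by
      refine intervalIntegral.norm_integral_le_of_norm_le_const fun r hr => ?_
      rw [Set.uIoc_of_le ht.1] at hr
      have hr' : r ∈ T := ⟨hr.1.le, hr.2.trans ht.2⟩
      have := Fle r (hT hr') (2 * h) (by linarith)
      have h2 : N r / (2 * h) ≤ sSup (N '' T) / (2 * h) := by
        gcongr; exact leS r hr'
      have h3 : sSup (N '' T) / (2 * h) = 2 * (sSup (N '' T) / (4 * h)) := by field_simp; norm_num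
      rw [Real.norm_eq_abs]
      linarith
    have h2 : |t - a| ≤ h := by
      rw [abs_of_nonneg (by linarith [ht.1])]; linarith [ht.2]
    have h3 : (h * G + sSup (N '' T) / (4 * h)) * |t - a| ≤
        (h * G + sSup (N '' T) / (4 * h)) * h := by
      gcongr
    have h4 : (h * G + sSup (N '' T) / (4 * h)) * h = h ^ 2 * G + sSup (N '' T) / 4 := by
      field_simp
    rw [Real.norm_eq_abs] at h1
    have h5 := neg_abs_le (∫ r in a..t, F r)
    linarith
  have := leS (a + h) ⟨by linarith, le_rfl⟩
  change N (a + h) ≤ _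
  linarith

end GKdV

namespace GKdV
variable {u : ℝ → ℝ → ℝ}

lemma tendsto_of_one_div {a b : ℝ} (hab : a < b) : ∃ t : ℕ → ℝ, (∀ n, t n ∈ Set.Ico a b) ∧
    Tendsto t atTop (nhds b) := by
  refine ⟨fun n => b - (b - a) * (1 / ((n : ℝ) + 1)), fun n => ?_, ?_⟩
  · have h0 : (0:ℝ) < 1 / ((n : ℝ) + 1) := by positivity
    have h1 : 1 / ((n : ℝ) + 1) ≤ 1 := by
      rw [div_le_one (by positivity)]; linarith [(Nat.cast_nonneg n : (0:ℝ) ≤ n)]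
    constructor <;> nlinarith
  · simpa using (tendsto_one_div_add_atTop_nhds_zero_nat (𝕜 := ℝ)).const_mul (b - a) |>.const_sub b

lemma HB.pt_sq {a b B : ℝ} (hB : HB u a b B) (hu : IsGKdVSolution u) (hab : a < b) :
    BddL1 (fun t x => pt u t x ^ 2) a b := by
  have s := sol_sm hu
  obtain ⟨C1, C10, h1⟩ := hB.diff hu hab.le
  obtain ⟨C2, C20, h2⟩ := hB.lipschitz hu hab.le
  have base : ∀ t ∈ Set.Ico a b,
      Integrable (fun x => pt u t x ^ 2) ∧ ∫ x, pt u t x ^ 2 ≤ C1 * C2 := fun t ht => by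
    obtain ⟨τ, hτ, hl⟩ := tendsto_of_one_div (a := t - b) (b := 0) (by linarith [ht.2])
    have iw : ∀ r, Integrable fun x => (u r x - u t x) ^ 2 := fun r =>
      integrable_of_sq_dom (((s.cont_x r).sub (s.cont_x t)).pow 2) ((sol_int0 hu r).const_mul 2)
        ((sol_int0 hu t).const_mul 2) fun x => by
          rw [abs_of_nonneg (sq_nonneg _)]; nlinarith [sq_nonneg (u r x + u t x)]
    refine integral_le_of_tendsto (f := fun n x => ((- τ n)⁻¹) ^ 2 * (u (t + - τ n) x - u t x) ^ 2)
      (by positivity) (fun n x => by positivity) (fun n => (iw _).const_mul _)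
      (Eventually.of_forall fun n => ?_) (fun x => ?_)
    · obtain ⟨h3, h4⟩ := hτ n
      rw [integral_const_mul]
      have h5 := h1 (-τ n) t (by linarith) ht.1 (by linarith)
      have h6 := h2 (-τ n) (by linarith) (by linarith [ht.1])
      have h7 : 0 < - τ n := by linarith
      calc (-τ n)⁻¹ ^ 2 * ∫ x, (u (t + - τ n) x - u t x) ^ 2
          ≤ (-τ n)⁻¹ ^ 2 * (C1 * (C2 * (-τ n) ^ 2)) := by
            gcongr; exact h5.trans (by gcongr)
        _ = C1 * C2 := by
          have : (-τ n)⁻¹ ^ 2 * (-τ n) ^ 2 = 1 := by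
            rw [← mul_pow, inv_mul_cancel₀ h7.ne', one_pow]
          linear_combination C1 * C2 * this
    · have hd := (s.hasDerivAt_t t x).tendsto_slope_zero
      have hl' : Tendsto (fun n => - τ n) atTop (nhdsWithin 0 {0}ᶜ) := by
        refine tendsto_nhdsWithin_iff.2 ⟨by simpa using hl.neg, Eventually.of_forall fun n => ?_⟩
        have := (hτ n).2
        simp; linarith
      have := (hd.comp hl').pow 2
      refine this.congr fun n => ?_
      simp only [Function.comp, smul_eq_mul]; ring
  refine ⟨C1 * C2, fun t ht => ?_⟩
  have key : Integrable (fun x => pt u t x ^ 2) ∧ ∫ x, pt u t x ^ 2 ≤ C1 * C2 := by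
    rcases ht.2.eq_or_lt with rfl | h
    · obtain ⟨τ, hτ, hl⟩ := tendsto_of_one_div hab
      refine integral_le_of_tendsto (f := fun n x => pt u (τ n) x ^ 2) (by positivity)
        (fun n x => sq_nonneg _) (fun n => (base _ (hτ n)).1)
        (Eventually.of_forall fun n => (base _ (hτ n)).2)
        fun x => (((s.pt.cont_t x).tendsto t).comp hl).pow 2
    · exact base t ⟨ht.1, h⟩
  refine ⟨key.1, ?_⟩
  simpa [abs_of_nonneg, sq_nonneg] using key.2

lemma HB.px3_sq {a b B : ℝ} (hB : HB u a b B) (hu : IsGKdVSolution u) (hab : a < b) :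
    BddL1 (fun t x => px (px (px u)) t x ^ 2) a b := by
  have s := sol_sm hu
  have h := ((hB.pt_sq hu hab).add (hB.bdd hu))
  refine h.of_le (fun t => (s.px.px.px.pow 2).cont_x t) (2 + 32 * (1 + B) ^ 6) fun t ht x => ?_
  have e : px (px (px u)) t x = - pt u t x - 4 * u t x ^ 3 * px u t x := by
    rw [sol_pt hu]; simp only [px_pot s]; ring
  have h1 := hB.ptw hu ht x
  have h2 : (u t x ^ 3) ^ 2 ≤ (1 + B) ^ 6 := by
    calc (u t x ^ 3) ^ 2 = |u t x| ^ 6 := by rw [← abs_pow, abs_of_nonneg (by positivity)]; ring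
      _ ≤ _ := by gcongr
  have h3 : 0 ≤ pt u t x ^ 2 + hden u t x := add_nonneg (sq_nonneg _) (hden_nonneg (u := u) t x)
  rw [abs_of_nonneg (sq_nonneg _), abs_of_nonneg h3, e]
  have h4 : px u t x ^ 2 ≤ hden u t x := by unfold hden; nlinarith [sq_nonneg (u t x)]
  have h5 : (u t x ^ 3) ^ 2 * px u t x ^ 2 ≤ (1 + B) ^ 6 * hden u t x :=
    mul_le_mul h2 h4 (sq_nonneg _) (by positivity)
  have h6 : 0 ≤ (1 + B) ^ 6 * pt u t x ^ 2 := by positivity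
  have h7 := hden_nonneg (u := u) t x
  nlinarith [sq_nonneg (pt u t x - 4 * u t x ^ 3 * px u t x)]

lemma HB.px2_sq {a b B : ℝ} (hB : HB u a b B) (hu : IsGKdVSolution u) (hab : a < b) :
    BddL1 (fun t x => px (px u) t x ^ 2) a b := by
  have s := sol_sm hu
  obtain ⟨C, hC⟩ := hB.px3_sq hu hab
  refine ⟨B + C, fun t ht => ⟨sol_int2 hu t, ?_⟩⟩
  have i13 := integrable_mul_of_sq (s.px.cont_x t) (s.px.px.px.cont_x t) (sol_int1 hu t)
    (sol_int3 hu t)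
  have i22 := sol_int2 hu t
  have e := integral_eq_zero_of_hasDerivAt_of_integrable
      (f := fun x => px u t x * px (px u) t x)
      (f' := fun x => px (px u) t x ^ 2 + px u t x * px (px (px u)) t x)
      (fun x => ((s.px.hasDerivAt_x t x).mul (s.px.px.hasDerivAt_x t x)).congr_deriv (by ring))
      (i22.add i13) (integrable_mul_of_sq (s.px.cont_x t) (s.px.px.cont_x t) (sol_int1 hu t) i22)
  rw [integral_add i22 i13] at e
  have h1 : -∫ x, px u t x * px (px (px u)) t x ≤ ∫ x, (hden u t x + px (px (px u)) t x ^ 2) := by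
    rw [← integral_neg]
    refine integral_mono i13.neg ((hden_int hu t).add (sol_int3 hu t)) fun x => ?_
    simp only [hden]
    nlinarith [sq_nonneg (px u t x + px (px (px u)) t x), sq_nonneg (u t x),
      sq_nonneg (px u t x), sq_nonneg (px (px (px u)) t x)]
  rw [integral_add (hden_int hu t) (sol_int3 hu t)] at h1
  have h2 := (hC t ht).2
  simp only [abs_sq] at h2 ⊢
  have := hB t ht
  linarith

lemma HB.pot_sq {a b B : ℝ} (hB : HB u a b B) (hu : IsGKdVSolution u) (hab : a < b) :
    BddL1 (fun t x => pot u t x ^ 2) a b := by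
  have s := sol_sm hu
  refine ((hB.px2_sq hu hab).add (hB.bdd hu)).of_le (fun t => ((pot_sm s).pow 2).cont_x t)
    (2 + 2 * (1 + B) ^ 6) fun t ht x => ?_
  have h1 := hB.ptw hu ht x
  have h2 : (u t x ^ 3) ^ 2 ≤ (1 + B) ^ 6 := by
    calc (u t x ^ 3) ^ 2 = |u t x| ^ 6 := by rw [← abs_pow, abs_of_nonneg (by positivity)]; ring
      _ ≤ _ := by gcongr
  have h3 : 0 ≤ px (px u) t x ^ 2 + hden u t x := add_nonneg (sq_nonneg _) (hden_nonneg (u := u) t x)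
  rw [abs_of_nonneg (sq_nonneg _), abs_of_nonneg h3]
  have h4 : u t x ^ 2 ≤ hden u t x := by unfold hden; nlinarith [sq_nonneg (px u t x)]
  have h5 : (u t x ^ 3) ^ 2 * u t x ^ 2 ≤ (1 + B) ^ 6 * hden u t x :=
    mul_le_mul h2 h4 (sq_nonneg _) (by positivity)
  have h6 : 0 ≤ (1 + B) ^ 6 * px (px u) t x ^ 2 := by positivity
  have h7 := hden_nonneg (u := u) t x
  simp only [pot]
  nlinarith [sq_nonneg (px (px u) t x - u t x ^ 4)]

lemma en_abs_le {A : ℝ} {t x : ℝ} (h : |u t x| ≤ A) : |en u t x| ≤ (1 + A ^ 3) * |hden u t x| := by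
  have A0 : 0 ≤ A := (abs_nonneg _).trans h
  have := abs_le.1 (abs_pow5_le h)
  have h1 : 0 ≤ A ^ 3 := by positivity
  have h2 := mul_nonneg h1 (sq_nonneg (px u t x))
  have h3 := mul_nonneg h1 (sq_nonneg (u t x))
  rw [abs_of_nonneg (hden_nonneg (u := u) t x)]
  unfold en hden
  rw [abs_le]
  constructor <;> nlinarith [sq_nonneg (px u t x), sq_nonneg (u t x)]

/-- All fluxes of the energy law are bounded in `L¹` where the `H¹` norm is. -/
lemma HB.energy_bdd {a b B : ℝ} (hB : HB u a b B) (hu : IsGKdVSolution u) (hab : a < b) :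
    BddL1 (en u) a b ∧ BddL1 (fun t x => 1 / 2 * pot u t x ^ 2 + px (px u) t x * pot u t x) a b ∧
    BddL1 (fun t x => (-1) * (px u t x * pot u t x)) a b := by
  have L := energy_law hu
  have p := hB.pot_sq hu hab
  have q := hB.px2_sq hu hab
  have r := hB.bdd hu
  refine ⟨r.of_le L.sD.cont_x (1 + (1 + B) ^ 3) fun t ht x => en_abs_le (hB.ptw hu ht x),
    (p.add q).of_le L.s1.cont_x 2 fun t ht x => ?_, (p.add r).of_le L.s2.cont_x 1 fun t ht x => ?_⟩
  · rw [abs_of_nonneg (by positivity : 0 ≤ pot u t x ^ 2 + px (px u) t x ^ 2), abs_le]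
    constructor <;> nlinarith [sq_nonneg (pot u t x + px (px u) t x),
      sq_nonneg (pot u t x - px (px u) t x)]
  · have := hden_nonneg (u := u) t x
    rw [abs_of_nonneg (by positivity : 0 ≤ pot u t x ^ 2 + hden u t x), abs_le]
    unfold hden
    constructor <;> nlinarith [sq_nonneg (pot u t x + px u t x),
      sq_nonneg (pot u t x - px u t x), sq_nonneg (u t x)]

lemma HB.energy {a b B : ℝ} (hB : HB u a b B) (hu : IsGKdVSolution u) (hab : a ≤ b) :
    ∫ x, en u b x = ∫ x, en u a x := by
  rcases hab.eq_or_lt with rfl | hlt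
  · rfl
  obtain ⟨⟨C, h0⟩, h1, h2⟩ := hB.energy_bdd hu hlt
  exact (energy_law hu).conserved hab (h0 a ⟨le_rfl, hab⟩).1 (h0 b ⟨hab, le_rfl⟩).1 h1 h2
    (BddL1.zero a b)

end GKdV

namespace GKdV
variable {u : ℝ → ℝ → ℝ}

lemma en_int (hu : IsGKdVSolution u) (t : ℝ) : Integrable (en u t) := by
  have s := sol_sm hu
  obtain ⟨B, hB⟩ : ∃ B, HB u t t B := ⟨∫ x, hden u t x, fun r hr => by
    rw [Set.Icc_self, Set.mem_singleton_iff] at hr; rw [hr]⟩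
  refine ((hden_int hu t).abs.const_mul (1 + (1 + B) ^ 3)).mono'
    ((energy_law hu).sD.cont_x t).aestronglyMeasurable (Eventually.of_forall fun x => ?_)
  exact en_abs_le (hB.ptw hu ⟨le_rfl, le_rfl⟩ x)

/-- The bound of the `H¹` norm given by mass and energy. -/
noncomputable def hbound (m e : ℝ) : ℝ := m + 5 / 3 * (2 * e + 2 / 5 * ((4 * m ^ 2 + 1) ^ 3 * m))

lemma hden_le_hbound (hu : IsGKdVSolution u) (t : ℝ) :
    ∫ x, hden u t x ≤ hbound (∫ x, u t x ^ 2) (∫ x, en u t x) := by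
  have s := sol_sm hu
  set m := ∫ x, u t x ^ 2 with hm
  set P := ∫ x, px u t x ^ 2 with hP
  have i0 := sol_int0 hu t
  have i1 := sol_int1 hu t
  have m0 : 0 ≤ m := integral_nonneg fun x => sq_nonneg _
  have P0 : 0 ≤ P := integral_nonneg fun x => sq_nonneg _
  have eH : ∫ x, hden u t x = m + P := integral_add i0 i1
  set D := 4 * m ^ 2 + 1 with hD
  have D1 : 1 ≤ D := by rw [hD]; nlinarith [sq_nonneg m]
  have key : P / 2 - 1 / 5 * ((4 * m * P / D + D ^ 3) * m) ≤ ∫ x, en u t x := by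
    have : ∫ x, (1 / 2 * px u t x ^ 2 - 1 / 5 * ((4 * m * P / D + D ^ 3) * u t x ^ 2))
        = P / 2 - 1 / 5 * ((4 * m * P / D + D ^ 3) * m) := by
      rw [integral_sub (i1.const_mul _) ((i0.const_mul _).const_mul _), integral_const_mul,
        integral_const_mul, integral_const_mul]
      ring
    rw [← this]
    refine integral_mono ((i1.const_mul _).sub ((i0.const_mul _).const_mul _)) (en_int hu t)
      fun x => ?_
    have h4 : u t x ^ 4 ≤ 4 * m * P := four_le (s.hasDerivAt_x t) (s.px.cont_x t) i0 i1 x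
    have h3 : u t x ^ 3 ≤ 4 * m * P / D + D ^ 3 := by
      rcases le_total (u t x) D with h | h
      · have : u t x ^ 3 ≤ D ^ 3 := by
          have : Odd 3 := by decide
          exact this.strictMono_pow.monotone h
        have : 0 ≤ 4 * m * P / D := by positivity
        linarith
      · have h0 : 0 < u t x := by linarith
        have : u t x ^ 3 ≤ u t x ^ 4 / D := by
          rw [le_div_iff₀ (by linarith)]
          calc u t x ^ 3 * D ≤ u t x ^ 3 * u t x := by gcongr
            _ = _ := by ring
        have h5 : u t x ^ 4 / D ≤ 4 * m * P / D := by gcongr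
        have : 0 ≤ D ^ 3 := by positivity
        linarith
    have := mul_le_mul_of_nonneg_right h3 (sq_nonneg (u t x))
    simp only [en]
    nlinarith
  have h2 : 4 * m * P / D * m ≤ P := by
    rw [div_mul_eq_mul_div, div_le_iff₀ (by linarith), hD]
    nlinarith
  rw [eH, hbound]
  nlinarith

lemma hbound_mono {m e n f : ℝ} (h0 : 0 ≤ m) (h1 : m ≤ n) (h2 : e ≤ f) : hbound m e ≤ hbound n f := by
  unfold hbound; gcongr

lemma mass_le_hden (hu : IsGKdVSolution u) (t : ℝ) : ∫ x, u t x ^ 2 ≤ ∫ x, hden u t x :=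
  integral_mono (sol_int0 hu t) (hden_int hu t) fun x => by
    simp only [hden]; nlinarith [sq_nonneg (px u t x)]

lemma en_le_hden (hu : IsGKdVSolution u) (t : ℝ) {B : ℝ} (hB : ∫ x, hden u t x ≤ B) :
    ∫ x, en u t x ≤ (1 + (1 + B) ^ 3) * B := by
  have hb : HB u t t B := fun r hr => by
    rw [Set.Icc_self, Set.mem_singleton_iff] at hr; rwa [hr]
  have h0 := hb.nonneg le_rfl
  have h1 : ∫ x, en u t x ≤ ∫ x, (1 + (1 + B) ^ 3) * hden u t x :=
    integral_le_of_abs_le ((hden_int hu t).const_mul _) fun x => by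
      have := en_abs_le (hb.ptw hu ⟨le_rfl, le_rfl⟩ x)
      rwa [abs_of_nonneg (hden_nonneg (u := u) t x)] at this
  rw [integral_const_mul] at h1
  exact h1.trans (by gcongr)

lemma hden_closed (hu : IsGKdVSolution u) (B : ℝ) : IsClosed {t | ∫ x, hden u t x ≤ B} := by
  refine IsSeqClosed.isClosed fun τ t hτ hl => ?_
  have B0 : 0 ≤ B := (integral_nonneg fun x => hden_nonneg (u := u) (τ 0) x).trans (hτ 0)
  exact (integral_le_of_tendsto (f := fun n x => hden u (τ n) x) B0 (fun n x => hden_nonneg _ x)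
    (fun n => hden_int hu _) (Eventually.of_forall hτ)
    fun x => (((hden_sm (sol_sm hu)).cont_t x).tendsto t).comp hl).2

/-- The times near which the `H¹` norm is bounded. -/
def good (u : ℝ → ℝ → ℝ) : Set ℝ := {t | ∃ B, ∀ᶠ s in nhds t, ∫ x, hden u s x ≤ B}

lemma good_open : IsOpen (good u) := by
  rw [isOpen_iff_mem_nhds]
  rintro t ⟨B, hB⟩
  filter_upwards [hB.eventually_nhds] with s hs using ⟨B, hs⟩

lemma exists_HB_of_good {a b : ℝ} (h : Set.Icc a b ⊆ good u) : ∃ B, HB u a b B := by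
  refine isCompact_Icc.induction_on (p := fun s => ∃ B, ∀ t ∈ s, ∫ x, hden u t x ≤ B)
    ⟨0, by simp⟩ (fun s t hst ⟨B, hB⟩ => ⟨B, fun r hr => hB r (hst hr)⟩) ?_ ?_
  · rintro s t ⟨B, hB⟩ ⟨B', hB'⟩
    exact ⟨max B B', fun r hr => hr.elim (fun h => (hB r h).trans (le_max_left _ _))
      fun h => (hB' r h).trans (le_max_right _ _)⟩
  · intro t ht
    obtain ⟨B, hB⟩ := h ht
    exact ⟨_, mem_nhdsWithin_of_mem_nhds hB, B, fun r hr => hr⟩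

lemma conserved_of_good (hu : IsGKdVSolution u) {a b : ℝ} (hab : a < b)
    (h : Set.Ioo a b ⊆ good u) :
    ∫ x, u b x ^ 2 = ∫ x, u a x ^ 2 ∧ ∫ x, en u b x = ∫ x, en u a x := by
  set m := (a + b) / 2 with hm
  have mm : m ∈ Set.Ioo a b := ⟨by rw [hm]; linarith, by rw [hm]; linarith⟩
  set B := hbound (∫ x, u m x ^ 2) (∫ x, en u m x)
  have hB : ∀ t ∈ Set.Ioo a b, ∫ x, hden u t x ≤ B := fun t ht => by
    rcases le_total t m with hl | hl
    · obtain ⟨B', hB'⟩ := exists_HB_of_good (u := u) (a := t) (b := m) fun r hr =>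
        h ⟨ht.1.trans_le hr.1, hr.2.trans_lt mm.2⟩
      have := hden_le_hbound hu t
      rwa [← hB'.mass hu hl, ← hB'.energy hu hl] at this
    · obtain ⟨B', hB'⟩ := exists_HB_of_good (u := u) (a := m) (b := t) fun r hr =>
        h ⟨mm.1.trans_le hr.1, hr.2.trans_lt ht.2⟩
      have := hden_le_hbound hu t
      rwa [hB'.mass hu hl, hB'.energy hu hl] at this
  have hB' : HB u a b B := by
    have : closure (Set.Ioo a b) ⊆ {t | ∫ x, hden u t x ≤ B} :=
      closure_minimal hB (hden_closed hu B)
    rw [closure_Ioo hab.ne] at this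
    exact this
  exact ⟨hB'.mass hu hab.le, hB'.energy hu hab.le⟩

lemma good_eq_univ (hu : IsGKdVSolution u) : good u = Set.univ := by
  by_contra hne
  set F : Set ℝ := (good u)ᶜ with hF
  have Fne : F.Nonempty := Set.nonempty_compl.2 hne
  have Fc : IsClosed F := good_open.isClosed_compl
  have : Nonempty F := Fne.to_subtype
  have : CompleteSpace F := Fc.completeSpace_coe
  obtain ⟨n, ⟨p, hp⟩, hpi⟩ := nonempty_interior_of_iUnion_of_closed
    (f := fun n : ℕ => {t : F | ∫ x, hden u t x ≤ n})
    (fun n => (hden_closed hu n).preimage continuous_subtype_val) (by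
      refine Set.eq_univ_of_forall fun t => Set.mem_iUnion.2 ?_
      exact exists_nat_ge (∫ x, hden u t x))
  rw [mem_interior_iff_mem_nhds, nhds_subtype_eq_comap, mem_comap] at hpi
  obtain ⟨O, hO, hsub⟩ := hpi
  obtain ⟨ε, ε0, hε⟩ := Metric.mem_nhds_iff.1 hO
  have hq : ∀ q ∈ F, q ∈ Metric.ball p ε → ∫ x, hden u q x ≤ n := fun q hq hb =>
    @hsub ⟨q, hq⟩ (hε hb)
  have key : ∀ q s, q ∈ F → q ∈ Metric.ball p ε → ∫ x, u s x ^ 2 = ∫ x, u q x ^ 2 →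
      ∫ x, en u s x = ∫ x, en u q x →
      ∫ x, hden u s x ≤ hbound n ((1 + (1 + n) ^ 3) * n) := fun q s hqF hqb h1 h2 => by
    have := hden_le_hbound hu s
    rw [h1, h2] at this
    exact this.trans (hbound_mono (integral_nonneg fun x => sq_nonneg _)
      ((mass_le_hden hu q).trans (hq q hqF hqb)) (en_le_hden hu q (hq q hqF hqb)))
  refine hp ⟨hbound n ((1 + (1 + n) ^ 3) * n), ?_⟩
  filter_upwards [Metric.ball_mem_nhds p ε0] with s hs
  by_cases hsF : s ∈ F
  · exact key s s hsF hs rfl rfl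
  rw [Real.ball_eq_Ioo] at hs key
  rcases le_total p s with hps | hps
  · obtain ⟨q, ⟨hqF, hqI⟩, hqm⟩ := ((isCompact_Icc (a := p) (b := s)).inter_left Fc).exists_isGreatest
      ⟨p, hp, le_rfl, hps⟩
    have hlt : q < s := lt_of_le_of_ne hqI.2 fun h => hsF (h ▸ hqF)
    obtain ⟨h1, h2⟩ := conserved_of_good hu hlt fun r hr => by
      by_contra hr'
      exact absurd (hqm ⟨hr', hqI.1.trans hr.1.le, hr.2.le⟩) (not_le.2 hr.1)
    exact key q s hqF ⟨by linarith [hqI.1], by linarith [hs.2]⟩ h1 h2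
  · obtain ⟨q, ⟨hqF, hqI⟩, hqm⟩ := ((isCompact_Icc (a := s) (b := p)).inter_left Fc).exists_isLeast
      ⟨p, hp, hps, le_rfl⟩
    have hlt : s < q := lt_of_le_of_ne hqI.1 fun h => hsF (h ▸ hqF)
    obtain ⟨h1, h2⟩ := conserved_of_good hu hlt fun r hr => by
      by_contra hr'
      exact absurd (hqm ⟨hr', hr.1.le, hr.2.le.trans hqI.2⟩) (not_le.2 hr.2)
    exact key q s hqF ⟨by linarith [hs.1], by linarith [hqI.2]⟩ h1.symm h2.symm

/-- Mass and energy are conserved, for all times. -/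
lemma conserved (hu : IsGKdVSolution u) (a b : ℝ) :
    ∫ x, u b x ^ 2 = ∫ x, u a x ^ 2 ∧ ∫ x, en u b x = ∫ x, en u a x := by
  have h : ∀ a b, Set.Ioo a b ⊆ good u := fun a b => by rw [good_eq_univ hu]; exact Set.subset_univ _
  rcases lt_trichotomy a b with hl | rfl | hl
  · exact conserved_of_good hu hl (h a b)
  · exact ⟨rfl, rfl⟩
  · have := conserved_of_good hu hl (h b a)
    exact ⟨this.1.symm, this.2.symm⟩

lemma exists_HB (hu : IsGKdVSolution u) : ∃ B, 0 ≤ B ∧ ∀ a b, HB u a b B := by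
  refine ⟨hbound (∫ x, u 0 x ^ 2) (∫ x, en u 0 x), ?_, fun a b t _ => ?_⟩
  · exact (integral_nonneg fun x => hden_nonneg (u := u) 0 x).trans (hden_le_hbound hu 0)
  · have := hden_le_hbound hu t
    rwa [(conserved hu 0 t).1, (conserved hu 0 t).2] at this

end GKdV

namespace GKdV

/-- The sixth root of the speed, which is the mass of the soliton up to a constant. -/
noncomputable def rt (c : ℝ) : ℝ := c ^ ((1:ℝ)/6)

lemma rt_pos {c : ℝ} (hc : 0 < c) : 0 < rt c := rpow_pos_of_pos hc _
lemma rt_pow {c : ℝ} (hc : 0 < c) : rt c ^ 6 = c := by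
  rw [rt, ← rpow_natCast, ← rpow_mul hc.le]; norm_num
lemma sqrt_eq_rt {c : ℝ} (hc : 0 < c) : √c = rt c ^ 3 := by
  rw [rt, ← rpow_natCast, ← rpow_mul hc.le, sqrt_eq_rpow]; norm_num
lemma cbrt_eq_rt {c : ℝ} (hc : 0 < c) : c ^ ((1:ℝ)/3) = rt c ^ 2 := by
  rw [rt, ← rpow_natCast, ← rpow_mul hc.le]; norm_num
lemma Q_pos (x : ℝ) : 0 < Q x := by
  have := cosh_pos (3 * x / 2)
  unfold Q; positivity

lemma Q_cube (x : ℝ) : Q x ^ 3 = 5 / (2 * cosh (3 * x / 2) ^ 2) := by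
  have := cosh_pos (3 * x / 2)
  have h : 0 ≤ 5 / (2 * cosh (3 * x / 2) ^ 2) := by positivity
  rw [Q, ← rpow_natCast, ← rpow_mul h]; norm_num

lemma Q_neg (x : ℝ) : Q (-x) = Q x := by
  unfold Q; rw [show 3 * -x / 2 = -(3 * x / 2) by ring, cosh_neg]

/-- The derivative of the ground state. -/
noncomputable def Q1 (x : ℝ) : ℝ := - tanh (3 * x / 2) * Q x

lemma hasDerivAt_Q (x : ℝ) : HasDerivAt Q (Q1 x) x := by
  have hc := cosh_pos (3 * x / 2)
  have h1 : HasDerivAt (fun x : ℝ => 3 * x / 2) (3 / 2) x := by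
    simpa using ((hasDerivAt_id x).const_mul 3).div_const 2
  have h2 := (((h1.cosh).pow 2).const_mul 2)
  have hp : 0 < 2 * cosh (3 * x / 2) ^ 2 := by positivity
  have h3 := ((hasDerivAt_const x (5:ℝ)).div h2 hp.ne').rpow_const (p := 1 / 3)
    (Or.inl (div_pos (by norm_num) hp).ne')
  refine h3.congr_deriv ?_
  have e : (5 / (2 * cosh (3 * x / 2) ^ 2)) ^ ((1:ℝ) / 3 - 1) =
      Q x * (2 * cosh (3 * x / 2) ^ 2 / 5) := by
    rw [rpow_sub_one (by positivity), Q]; field_simp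
  simp only [Q1, tanh_eq_sinh_div_cosh] at *
  erw [e]
  generalize Q x = q
  simp
  field_simp

lemma hasDerivAt_tanh (x : ℝ) :
    HasDerivAt (fun x => tanh (3 * x / 2)) (3 / 5 * Q x ^ 3) x := by
  have hc := cosh_pos (3 * x / 2)
  have h1 : HasDerivAt (fun x : ℝ => 3 * x / 2) (3 / 2) x := by
    simpa using ((hasDerivAt_id x).const_mul 3).div_const 2
  have h2 := (h1.sinh).div h1.cosh hc.ne'
  have e : (fun x => tanh (3 * x / 2)) = fun x => sinh (3 * x / 2) / cosh (3 * x / 2) := by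
    funext x; rw [tanh_eq_sinh_div_cosh]
  rw [e]
  refine h2.congr_deriv ?_
  rw [Q_cube]
  have := cosh_sq (3 * x / 2)
  field_simp
  nlinarith

lemma tanh_sq_Q (x : ℝ) : tanh (3 * x / 2) ^ 2 = 1 - 2 / 5 * Q x ^ 3 := by
  rw [Q_cube, tanh_eq_sinh_div_cosh]
  have hc := cosh_pos (3 * x / 2)
  have := cosh_sq (3 * x / 2)
  field_simp
  nlinarith

lemma Q1_sq (x : ℝ) : Q1 x ^ 2 = Q x ^ 2 - 2 / 5 * Q x ^ 5 := by
  have := tanh_sq_Q x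
  rw [Q1]
  linear_combination Q x ^ 2 * this

lemma Q_le_exp (x : ℝ) : Q x ≤ 3 * exp (-|x|) := by
  have h : Q x ^ 3 ≤ (3 * exp (-|x|)) ^ 3 := by
    rw [Q_cube, mul_pow, ← exp_nat_mul, ← cosh_abs]
    have h1 : |3 * x / 2| = 3 / 2 * |x| := by
      rw [show 3 * x / 2 = 3 / 2 * x by ring, abs_mul]; norm_num
    have h2 : exp (3 / 2 * |x|) / 2 ≤ cosh |3 * x / 2| := by
      rw [cosh_eq, h1]; linarith [exp_pos (-(3 / 2 * |x|))]
    have h3 : exp (3 / 2 * |x|) ^ 2 * exp ((3:ℕ) * -|x|) = 1 := by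
      rw [← exp_nat_mul, ← exp_add]; push_cast; ring_nf; exact exp_zero
    have hc := cosh_pos |3 * x / 2|
    rw [div_le_iff₀ (by positivity)]
    have h4 : (exp (3 / 2 * |x|) / 2) ^ 2 ≤ cosh |3 * x / 2| ^ 2 := by gcongr
    have h5 := mul_le_mul_of_nonneg_right h4 (exp_pos ((3:ℕ) * -|x|)).le
    nlinarith
  exact le_of_pow_le_pow_left₀ (by norm_num) (by positivity) h

lemma continuous_Q : Continuous Q :=
  continuous_iff_continuousAt.2 fun x => (hasDerivAt_Q x).continuousAt
lemma continuous_Q1 : Continuous Q1 := by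
  have : Continuous fun x : ℝ => tanh (3 * x / 2) :=
    continuous_iff_continuousAt.2 fun x => (hasDerivAt_tanh x).continuousAt
  exact this.neg.mul continuous_Q

lemma abs_Q1_le (x : ℝ) : |Q1 x| ≤ Q x := by
  have h := Q_pos x
  refine abs_le_of_sq_le_sq ?_ h.le
  rw [Q1_sq]
  have : 0 < Q x ^ 5 := by positivity
  linarith

lemma integrable_exp_abs {ν : ℝ} (h : 0 < ν) : Integrable fun x : ℝ => exp (-(ν * |x|)) := by
  have h1 : IntegrableOn (fun x : ℝ => exp (-(ν * |x|))) (Set.Ioi 0) :=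
    (exp_neg_integrableOn_Ioi 0 h).congr_fun (fun x hx => by
      simp only [abs_of_pos (Set.mem_Ioi.1 hx)]; ring_nf) measurableSet_Ioi
  have h2 : IntegrableOn (fun x : ℝ => exp (-(ν * |x|))) (Set.Iic 0) := by
    have h3 : IntegrableOn (fun x : ℝ => exp (-(ν * |x|))) (Set.Ici 0) :=
      (integrableOn_Ici_iff_integrableOn_Ioi (by simp)).2 h1
    have h4 : IntegrableOn (fun x : ℝ => (fun x => exp (-(ν * |x|))) (-x)) (Set.Iic 0) :=
      IntegrableOn.comp_neg_Iic (c := (0:ℝ)) (by simpa using h3)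
    simpa using h4
  have := h2.union h1
  rwa [Set.Iic_union_Ioi, integrableOn_univ] at this

lemma integrable_Q_pow (k : ℕ) : Integrable fun x => Q x ^ (k + 1) := by
  refine ((integrable_exp_abs one_pos).const_mul (3 ^ (k + 1))).mono'
    (continuous_Q.pow _).aestronglyMeasurable (Eventually.of_forall fun x => ?_)
  rw [norm_of_nonneg (pow_nonneg (Q_pos x).le _)]
  have h := pow_le_pow_left₀ (Q_pos x).le (Q_le_exp x) (k + 1)
  rw [mul_pow] at h
  refine h.trans ?_
  have h1 : exp (-|x|) ≤ 1 := exp_le_one_iff.2 (by linarith [abs_nonneg x])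
  have := pow_le_pow_of_le_one (exp_pos (-|x|)).le h1 (by omega : 1 ≤ k + 1)
  rw [one_mul]; rw [pow_one] at this
  gcongr

/-- Mass of the ground state. -/
noncomputable def qmass : ℝ := ∫ x, Q x ^ 2
/-- Integral of the ground state. -/
noncomputable def qint : ℝ := ∫ x, Q x

lemma integrable_Q : Integrable Q := by simpa using integrable_Q_pow 0

lemma integral_pos_of_pos {f : ℝ → ℝ} (hi : Integrable f) (h : ∀ x, 0 < f x) :
    0 < ∫ x, f x := by
  rw [integral_pos_iff_support_of_nonneg (fun x => (h x).le) hi]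
  have : Function.support f = Set.univ := Set.eq_univ_of_forall fun x => (h x).ne'
  simp [this]

lemma qmass_pos : 0 < qmass := integral_pos_of_pos (integrable_Q_pow 1)
  fun x => pow_pos (Q_pos x) 2
lemma qint_pos : 0 < qint := integral_pos_of_pos integrable_Q Q_pos

lemma integral_Q_five : ∫ x, Q x ^ 5 = 10 / 7 * qmass := by
  have e := integral_eq_zero_of_hasDerivAt_of_integrable
      (f := fun x => - (Q x ^ 2 * tanh (3 * x / 2)))
      (f' := fun x => 2 * Q x ^ 2 - 7 / 5 * Q x ^ 5) (fun x => ?_)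
      (((integrable_Q_pow 1).const_mul 2).sub ((integrable_Q_pow 4).const_mul _)) ?_
  · rw [integral_sub ((integrable_Q_pow 1).const_mul 2) ((integrable_Q_pow 4).const_mul _),
      integral_const_mul, integral_const_mul] at e
    change 2 * qmass - _ = _ at e
    norm_num at e
    linarith
  · refine ((((hasDerivAt_Q x).pow 2).mul (hasDerivAt_tanh x)).neg).congr_deriv ?_
    have := tanh_sq_Q x
    simp only [Q1]
    norm_num
    linear_combination 2 * Q x ^ 2 * this
  · refine (integrable_Q_pow 1).mono' (by
      have : Continuous fun x : ℝ => tanh (3 * x / 2) :=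
        continuous_iff_continuousAt.2 fun x => (hasDerivAt_tanh x).continuousAt
      exact ((continuous_Q.pow 2).mul this).neg.aestronglyMeasurable)
      (Eventually.of_forall fun x => ?_)
    have h := abs_Q1_le x
    rw [Q1, abs_mul, abs_neg, abs_of_pos (Q_pos x)] at h
    rw [norm_neg, Real.norm_eq_abs, abs_mul, abs_of_nonneg (sq_nonneg _)]
    have := Q_pos x
    norm_num
    nlinarith

variable {c : ℝ}

lemma Qc_eq (hc : 0 < c) (x : ℝ) : Qc c x = rt c ^ 2 * Q (rt c ^ 3 * x) := by
  rw [Qc, cbrt_eq_rt hc, sqrt_eq_rt hc]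

/-- The derivative of the soliton profile. -/
noncomputable def Qc1 (c x : ℝ) : ℝ := rt c ^ 5 * Q1 (rt c ^ 3 * x)

lemma hasDerivAt_Qc (hc : 0 < c) (x : ℝ) : HasDerivAt (Qc c) (Qc1 c x) x := by
  have h := ((hasDerivAt_Q (rt c ^ 3 * x)).comp x ((hasDerivAt_id x).const_mul (rt c ^ 3))).const_mul
    (rt c ^ 2)
  have e : Qc c = fun x => rt c ^ 2 * Q (rt c ^ 3 * x) := funext (Qc_eq hc)
  rw [e]
  refine h.congr_deriv ?_
  simp only [Qc1]; ring

lemma Qc_pos (hc : 0 < c) (x : ℝ) : 0 < Qc c x := by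
  have := rt_pos hc
  have := Q_pos (rt c ^ 3 * x)
  rw [Qc_eq hc]; positivity

lemma Qc_neg (x : ℝ) : Qc c (-x) = Qc c x := by
  rw [Qc, Qc, mul_neg, Q_neg]

lemma continuous_Qc (hc : 0 < c) : Continuous (Qc c) :=
  continuous_iff_continuousAt.2 fun x => (hasDerivAt_Qc hc x).continuousAt
lemma continuous_Qc1 : Continuous (Qc1 c) :=
  continuous_const.mul (continuous_Q1.comp (continuous_const.mul continuous_id))

lemma Qc1_sq (hc : 0 < c) (x : ℝ) : Qc1 c x ^ 2 = c * Qc c x ^ 2 - 2 / 5 * Qc c x ^ 5 := by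
  have := Q1_sq (rt c ^ 3 * x)
  rw [Qc1, Qc_eq hc]
  nth_rewrite 3 [← rt_pow hc]
  linear_combination rt c ^ 10 * this

lemma Qc_le_exp (hc : 0 < c) (x : ℝ) : Qc c x ≤ 3 * rt c ^ 2 * exp (-(√c * |x|)) := by
  have h := Q_le_exp (rt c ^ 3 * x)
  have h0 := rt_pos hc
  rw [abs_mul, abs_of_pos (by positivity : 0 < rt c ^ 3)] at h
  rw [Qc_eq hc, sqrt_eq_rt hc]
  nlinarith [mul_le_mul_of_nonneg_left h (sq_nonneg (rt c))]

lemma abs_Qc1_le (hc : 0 < c) (x : ℝ) : |Qc1 c x| ≤ rt c ^ 3 * Qc c x := by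
  have h := abs_Q1_le (rt c ^ 3 * x)
  have h0 := rt_pos hc
  rw [Qc1, Qc_eq hc, abs_mul, abs_of_pos (by positivity : 0 < rt c ^ 5)]
  nlinarith [mul_le_mul_of_nonneg_left h (by positivity : 0 ≤ rt c ^ 5)]

lemma integral_Q_scale (hc : 0 < c) (k : ℕ) :
    ∫ x, Qc c x ^ k = (rt c ^ 2) ^ k * ((rt c ^ 3)⁻¹ * ∫ x, Q x ^ k) := by
  have h0 := rt_pos hc
  simp_rw [Qc_eq hc, mul_pow _ (Q _)]
  rw [integral_const_mul, Measure.integral_comp_mul_left (fun x => Q x ^ k), smul_eq_mul,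
    abs_of_pos (by positivity)]

lemma integrable_Qc_pow (hc : 0 < c) (k : ℕ) : Integrable fun x => Qc c x ^ (k + 1) := by
  simp_rw [Qc_eq hc, mul_pow _ (Q _)]
  exact (((integrable_Q_pow k).comp_mul_left' (pow_pos (rt_pos hc) 3).ne')).const_mul _

lemma integral_Qc (hc : 0 < c) : ∫ x, Qc c x = qint / rt c := by
  have h := integral_Q_scale hc 1
  have := rt_pos hc
  simp only [pow_one] at h
  rw [h]; change _ * (_ * qint) = _
  field_simp

lemma integral_Qc_sq (hc : 0 < c) : ∫ x, Qc c x ^ 2 = qmass * rt c := by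
  have h := integral_Q_scale hc 2
  have := rt_pos hc
  rw [h]; change _ * (_ * qmass) = _
  field_simp

lemma integral_Qc_five (hc : 0 < c) : ∫ x, Qc c x ^ 5 = 10 / 7 * qmass * rt c ^ 7 := by
  have h := integral_Q_scale hc 5
  have := rt_pos hc
  rw [h, integral_Q_five]
  field_simp

lemma integrable_Qc1_sq (hc : 0 < c) : Integrable fun x => Qc1 c x ^ 2 := by
  simp_rw [Qc1_sq hc]
  exact ((integrable_Qc_pow hc 1).const_mul _).sub ((integrable_Qc_pow hc 4).const_mul _)

lemma integral_Qc1_sq (hc : 0 < c) : ∫ x, Qc1 c x ^ 2 = 3 / 7 * qmass * rt c ^ 7 := by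
  simp_rw [Qc1_sq hc]
  rw [integral_sub ((integrable_Qc_pow hc 1).const_mul _) ((integrable_Qc_pow hc 4).const_mul _),
    integral_const_mul, integral_const_mul, integral_Qc_sq hc, integral_Qc_five hc]
  linear_combination (-qmass * rt c) * rt_pow hc

end GKdV

namespace GKdV

lemma integral_abs_mul_le {f g : ℝ → ℝ} (hf : Continuous f) (hg : Continuous g)
    (i1 : Integrable fun x => f x ^ 2) (i2 : Integrable fun x => g x ^ 2) :
    ∫ x, |f x * g x| ≤ √(4 * (∫ x, f x ^ 2) * ∫ x, g x ^ 2) := by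
  refine Real.le_sqrt_of_sq_le (sq_le_four_mul (integral_nonneg fun x => sq_nonneg _)
    (integral_nonneg fun x => abs_nonneg _) fun a ha => ?_)
  rw [← integral_const_mul, ← integral_div, ← integral_add (i1.const_mul a) (i2.div_const a)]
  refine integral_mono (integrable_mul_of_sq hf hg i1 i2).abs
    ((i1.const_mul a).add (i2.div_const a)) fun x => ?_
  simp only
  have h1 : a * f x ^ 2 + g x ^ 2 / a - |f x * g x| =
      a * (|f x| - |g x| / (2 * a)) ^ 2 + 3 * g x ^ 2 / (4 * a) := by
    rw [abs_mul, ← sq_abs (f x), ← sq_abs (g x)]; field_simp; ring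
  have h2 : 0 ≤ a * (|f x| - |g x| / (2 * a)) ^ 2 + 3 * g x ^ 2 / (4 * a) := by positivity
  linarith

/-- A family of profiles, each bounded, integrable and vanishing at infinity. -/
structure Prof (f : ℝ → ℝ) : Prop where
  cont : Continuous f
  int : Integrable f
  bdd : ∃ K, ∀ x, |f x| ≤ K
  zero : Tendsto f (cocompact ℝ) (nhds 0)

lemma Prof.sq {f : ℝ → ℝ} (h : Prof f) : Integrable fun x => f x ^ 2 := by
  obtain ⟨K, hK⟩ := h.bdd
  refine (h.int.abs.const_mul K).mono' (h.cont.pow 2).aestronglyMeasurable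
    (Eventually.of_forall fun x => ?_)
  rw [Real.norm_eq_abs, abs_pow, _root_.sq]
  exact mul_le_mul_of_nonneg_right (hK x) (abs_nonneg _)

lemma Prof.cross {f h : ℝ → ℝ} (hf : Prof f) (hh : Prof h) {y z : ℝ → ℝ}
    (hyz : Tendsto (fun t => |y t - z t|) atTop atTop) :
    Tendsto (fun t => ∫ x, |f (x - y t)| * |h (x - z t)|) atTop (nhds 0) := by
  obtain ⟨K, hK⟩ := hh.bdd
  have e : ∀ t, ∫ x, |f (x - y t)| * |h (x - z t)| = ∫ x, |f x| * |h (x + (y t - z t))| := fun t => by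
    rw [← integral_add_right_eq_self (fun x => |f (x - y t)| * |h (x - z t)|) (y t)]
    refine integral_congr_ae (Eventually.of_forall fun x => ?_)
    simp only; ring_nf
  simp_rw [e]
  have : (0:ℝ) = ∫ x : ℝ, (0:ℝ) := by simp
  rw [this]
  refine tendsto_integral_filter_of_dominated_convergence (fun x => |f x| * K)
    (Eventually.of_forall fun t => (hf.cont.abs.mul
      (hh.cont.comp (continuous_id.add continuous_const)).abs).aestronglyMeasurable)
    (Eventually.of_forall fun t => Eventually.of_forall fun x => ?_) (hf.int.abs.mul_const K)
    (Eventually.of_forall fun x => ?_)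
  · rw [Real.norm_eq_abs, abs_mul, abs_abs, abs_abs]
    exact mul_le_mul_of_nonneg_left (hK _) (abs_nonneg _)
  · have h1 : Tendsto (fun t => x + (y t - z t)) atTop (cocompact ℝ) := by
      rw [cocompact_eq_atBot_atTop, ← comap_abs_atTop, tendsto_comap_iff]
      refine tendsto_atTop_mono (fun t => ?_) (tendsto_atTop_add_const_right _ (-|x|) hyz)
      have := abs_sub_abs_le_abs_sub (y t - z t) (-x)
      rw [abs_neg, sub_neg_eq_add, add_comm (y t - z t)] at this
      simpa [Function.comp] using this
    simpa using ((hh.zero.comp h1).abs).const_mul |f x|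

lemma sum_almost_additive {ι : Type*} [DecidableEq ι] {g : ℝ → ℝ} {S : Set ℝ} {C : ℝ} (s : Finset ι)
    (b : ι → ℝ) (hS : ∀ s' ⊆ s, ∑ i ∈ s', b i ∈ S) (g0 : g 0 = 0) (hC : 0 ≤ C)
    (gA : ∀ A ∈ S, ∀ p ∈ S, |g (A + p) - g A - g p| ≤ C * (|A| * |p|)) :
    |g (∑ i ∈ s, b i) - ∑ i ∈ s, g (b i)| ≤ C * ∑ i ∈ s, ∑ k ∈ s.erase i, |b i| * |b k| := by
  induction s using Finset.induction_on with
  | empty => simp [g0]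
  | insert a s ha ih =>
    have ih := ih fun s' hs' => hS s' (hs'.trans (Finset.subset_insert a s))
    have h1 := hS s (Finset.subset_insert a s)
    have h2 := hS {a} (by simp)
    rw [Finset.sum_singleton] at h2
    have h3 := gA _ h1 _ h2
    rw [Finset.sum_insert ha, Finset.sum_insert ha, Finset.sum_insert ha, Finset.erase_insert ha]
    have h4 : |∑ i ∈ s, b i| * |b a| ≤ ∑ k ∈ s, |b a| * |b k| := by
      rw [← Finset.mul_sum, mul_comm]
      exact mul_le_mul_of_nonneg_left (Finset.abs_sum_le_sum_abs _ _) (abs_nonneg _)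
    have h5 : ∑ i ∈ s, ∑ k ∈ s.erase i, |b i| * |b k| ≤
        ∑ i ∈ s, ∑ k ∈ (insert a s).erase i, |b i| * |b k| := by
      refine Finset.sum_le_sum fun i hi => Finset.sum_le_sum_of_subset_of_nonneg
        (Finset.erase_subset_erase _ (Finset.subset_insert a s)) fun k _ _ => by positivity
    have h6 : g (b a + ∑ i ∈ s, b i) - (g (b a) + ∑ i ∈ s, g (b i)) =
        (g (∑ i ∈ s, b i + b a) - g (∑ i ∈ s, b i) - g (b a)) +
        (g (∑ i ∈ s, b i) - ∑ i ∈ s, g (b i)) := by rw [add_comm (b a)]; ring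
    rw [h6]
    refine (abs_add_le _ _).trans ?_
    have h7 := mul_le_mul_of_nonneg_left (add_le_add h4 h5) hC
    have h8 := mul_le_mul_of_nonneg_left h4 hC
    rw [mul_add] at h7 ⊢
    have h9 := mul_le_mul_of_nonneg_left h5 hC
    linarith

/-- Almost additive functionals decouple on sums of separating profiles. -/
lemma tendsto_integral_profiles {s : Finset ℕ} {f y : ℕ → ℝ → ℝ} {ε w : ℝ → ℝ → ℝ} {l : ℕ → ℝ}
    {g : ℝ → ℝ} {S : Set ℝ} {C : ℝ} (hC : 0 ≤ C) (hf : ∀ i ∈ s, Prof (f i))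
    (hy : ∀ i ∈ s, ∀ k ∈ s, i ≠ k → Tendsto (fun t => |y i t - y k t|) atTop atTop)
    (g0 : g 0 = 0) (gc : Continuous g) (gC : ∀ q ∈ S, |g q| ≤ C * q ^ 2)
    (gA : ∀ A ∈ S, ∀ p ∈ S, |g (A + p) - g A - g p| ≤ C * (|A| * |p|))
    (hS : ∀ s' ⊆ s, ∀ z : ℕ → ℝ, ∑ i ∈ s', f i (z i) ∈ S)
    (εS : ∀ᶠ t in atTop, ∀ x, ε t x ∈ S) (εc : ∀ t, Continuous (ε t))
    (εi : ∀ t, Integrable fun x => ε t x ^ 2)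
    (ε0 : Tendsto (fun t => ∫ x, ε t x ^ 2) atTop (nhds 0))
    (wc : ∀ t, Continuous (w t)) (w1 : ∀ t x, |w t x| ≤ 1)
    (hw : ∀ i ∈ s, ∀ z, Tendsto (fun t => w t (z + y i t)) atTop (nhds (l i))) :
    Tendsto (fun t => ∫ x, g (∑ i ∈ s, f i (x - y i t) + ε t x) * w t x) atTop
      (nhds (∑ i ∈ s, l i * ∫ x, g (f i x))) := by
  have fS : ∀ i ∈ s, ∀ x, f i x ∈ S := fun i hi x => by
    have := hS {i} (by simpa using hi) (fun _ => x)
    simpa using this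
  have ig : ∀ i ∈ s, Integrable fun x => g (f i x) := fun i hi =>
    ((hf i hi).sq.const_mul C).mono' (gc.comp (hf i hi).cont).aestronglyMeasurable
      (Eventually.of_forall fun x => gC _ (fS i hi x))
  have main : Tendsto (fun t => ∑ i ∈ s, ∫ x, g (f i (x - y i t)) * w t x) atTop
      (nhds (∑ i ∈ s, l i * ∫ x, g (f i x))) := by
    refine tendsto_finsetSum _ fun i hi => ?_
    have e : ∀ t, ∫ x, g (f i (x - y i t)) * w t x = ∫ x, g (f i x) * w t (x + y i t) := fun t => by
      rw [← integral_add_right_eq_self (fun x => g (f i (x - y i t)) * w t x) (y i t)]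
      simp
    simp_rw [e]
    rw [mul_comm, ← integral_mul_const]
    refine tendsto_integral_filter_of_dominated_convergence (fun x => |g (f i x)|)
      (Eventually.of_forall fun t => ((gc.comp (hf i hi).cont).mul
        ((wc t).comp (continuous_id.add continuous_const))).aestronglyMeasurable)
      (Eventually.of_forall fun t => Eventually.of_forall fun x => ?_) (ig i hi).abs
      (Eventually.of_forall fun x => ?_)
    · rw [Real.norm_eq_abs, abs_mul]
      exact mul_le_of_le_one_right (abs_nonneg _) (w1 _ _)
    · exact (hw i hi x).const_mul _
  set X : ℝ → ℝ → ℝ := fun t x => C * ∑ i ∈ s, ∑ k ∈ s.erase i, |f i (x - y i t)| * |f k (x - y k t)| +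
    C * ∑ i ∈ s, |f i (x - y i t) * ε t x| + C * ε t x ^ 2 with hX
  have ip : ∀ i ∈ s, ∀ k ∈ s, ∀ t, Integrable fun x => |f i (x - y i t)| * |f k (x - y k t)| :=
    fun i hi k hk t => by
      have := (integrable_mul_of_sq ((hf i hi).cont.comp (continuous_sub_right (y i t)))
        ((hf k hk).cont.comp (continuous_sub_right (y k t))) ((hf i hi).sq.comp_sub_right _)
        ((hf k hk).sq.comp_sub_right _)).abs
      simpa [abs_mul] using this
  have ie : ∀ i ∈ s, ∀ t, Integrable fun x => |f i (x - y i t) * ε t x| := fun i hi t =>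
    (integrable_mul_of_sq ((hf i hi).cont.comp (continuous_sub_right (y i t))) (εc t)
      ((hf i hi).sq.comp_sub_right _) (εi t)).abs
  have iX1 : ∀ t, Integrable fun x =>
      ∑ i ∈ s, ∑ k ∈ s.erase i, |f i (x - y i t)| * |f k (x - y k t)| := fun t =>
    integrable_finsetSum _ fun i hi => integrable_finsetSum _ fun k hk =>
      ip i hi k (Finset.mem_of_mem_erase hk) t
  have iX2 : ∀ t, Integrable fun x => ∑ i ∈ s, |f i (x - y i t) * ε t x| := fun t =>
    integrable_finsetSum _ fun i hi => ie i hi t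
  have iX12 : ∀ t, Integrable fun x =>
      C * ∑ i ∈ s, ∑ k ∈ s.erase i, |f i (x - y i t)| * |f k (x - y k t)| +
      C * ∑ i ∈ s, |f i (x - y i t) * ε t x| := fun t =>
    ((iX1 t).const_mul C).add ((iX2 t).const_mul C)
  have iX : ∀ t, Integrable (X t) := fun t => (iX12 t).add ((εi t).const_mul C)
  have X0 : Tendsto (fun t => ∫ x, X t x) atTop (nhds 0) := by
    have e : ∀ t, ∫ x, X t x =
        C * (∑ i ∈ s, ∑ k ∈ s.erase i, ∫ x, |f i (x - y i t)| * |f k (x - y k t)|) +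
        C * (∑ i ∈ s, ∫ x, |f i (x - y i t) * ε t x|) + C * ∫ x, ε t x ^ 2 := fun t => by
      simp only [hX]
      rw [integral_add (iX12 t) ((εi t).const_mul C),
        integral_add ((iX1 t).const_mul C) ((iX2 t).const_mul C), integral_const_mul,
        integral_const_mul, integral_const_mul, integral_finsetSum _ fun i hi => ie i hi t,
        integral_finsetSum _ fun i hi => integrable_finsetSum _ fun k hk =>
          ip i hi k (Finset.mem_of_mem_erase hk) t]
      congr 3
      refine Finset.sum_congr rfl fun i hi => ?_
      rw [integral_finsetSum _ fun k hk => ip i hi k (Finset.mem_of_mem_erase hk) t]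
    simp_rw [e]
    have t1 : Tendsto (fun t => ∑ i ∈ s, ∑ k ∈ s.erase i,
        ∫ x, |f i (x - y i t)| * |f k (x - y k t)|) atTop (nhds 0) := by
      have : (0:ℝ) = ∑ i ∈ s, ∑ k ∈ s.erase i, (0:ℝ) := by simp
      rw [this]
      refine tendsto_finsetSum _ fun i hi => tendsto_finsetSum _ fun k hk => ?_
      have hk' := Finset.mem_of_mem_erase hk
      exact (hf i hi).cross (hf k hk') (hy i hi k hk' (Finset.ne_of_mem_erase hk).symm)
    have t2 : Tendsto (fun t => ∑ i ∈ s, ∫ x, |f i (x - y i t) * ε t x|) atTop (nhds 0) := by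
      have : (0:ℝ) = ∑ i ∈ s, (0:ℝ) := by simp
      rw [this]
      refine tendsto_finsetSum _ fun i hi => ?_
      refine squeeze_zero (g := fun t => √(4 * (∫ x, f i x ^ 2) * ∫ x, ε t x ^ 2))
        (fun t => integral_nonneg fun x => abs_nonneg _) (fun t => ?_) ?_
      · have := integral_abs_mul_le ((hf i hi).cont.comp (continuous_sub_right (y i t))) (εc t)
          ((hf i hi).sq.comp_sub_right _) (εi t)
        simp only [Function.comp] at this
        rwa [integral_sub_right_eq_self (fun x => f i x ^ 2) (y i t)] at this
      · have := (ε0.const_mul (4 * (∫ x, f i x ^ 2))).sqrt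
        simpa using this
    simpa using ((t1.const_mul C).add (t2.const_mul C)).add (ε0.const_mul C)
  have diff : ∀ᶠ t in atTop, |(∫ x, g (∑ i ∈ s, f i (x - y i t) + ε t x) * w t x) -
      ∑ i ∈ s, ∫ x, g (f i (x - y i t)) * w t x| ≤ ∫ x, X t x := by
    filter_upwards [εS] with t ht
    have pt : ∀ x, |g (∑ i ∈ s, f i (x - y i t) + ε t x) - ∑ i ∈ s, g (f i (x - y i t))| ≤ X t x :=
      fun x => by
        have h1 := sum_almost_additive s (fun i => f i (x - y i t))
          (fun s' hs' => hS s' hs' fun i => x - y i t) g0 hC gA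
        have h2 := gA _ (hS s (Finset.Subset.refl s) fun i => x - y i t) _ (ht x)
        have h3 := gC _ (ht x)
        have h4 : |∑ i ∈ s, f i (x - y i t)| * |ε t x| ≤ ∑ i ∈ s, |f i (x - y i t) * ε t x| := by
          simp_rw [abs_mul]
          rw [← Finset.sum_mul]
          exact mul_le_mul_of_nonneg_right (Finset.abs_sum_le_sum_abs _ _) (abs_nonneg _)
        have h5 := mul_le_mul_of_nonneg_left h4 hC
        simp only [hX]
        rw [abs_le] at *
        constructor <;> linarith
    have ir : ∀ i ∈ s, Integrable fun x => g (f i (x - y i t)) * w t x := fun i hi =>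
      ((ig i hi).comp_sub_right (y i t)).mul_bdd (c := 1) (wc t).aestronglyMeasurable
        (Eventually.of_forall fun x => w1 t x)
    have cs : Continuous fun x => ∑ i ∈ s, f i (x - y i t) :=
      continuous_finsetSum _ fun i hi => (hf i hi).cont.comp (continuous_sub_right (y i t))
    have il : Integrable fun x => g (∑ i ∈ s, f i (x - y i t) + ε t x) * w t x := by
      refine Integrable.mul_bdd (c := 1) ?_ (wc t).aestronglyMeasurable
        (Eventually.of_forall fun x => w1 t x)
      refine ((iX t).add (integrable_finsetSum s fun i hi =>
        ((ig i hi).comp_sub_right (y i t)).abs)).mono'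
        (gc.comp (cs.add (εc t))).aestronglyMeasurable (Eventually.of_forall fun x => ?_)
      have h1 := pt x
      have h2 := Finset.abs_sum_le_sum_abs (fun i => g (f i (x - y i t))) s
      simp only [Pi.add_apply, Real.norm_eq_abs]
      have := abs_sub_abs_le_abs_sub (g (∑ i ∈ s, f i (x - y i t) + ε t x))
        (∑ i ∈ s, g (f i (x - y i t)))
      linarith
    rw [← integral_finsetSum _ ir, ← integral_sub il (integrable_finsetSum _ ir),
      ← Real.norm_eq_abs]
    refine norm_integral_le_of_norm_le (iX t) (Eventually.of_forall fun x => ?_)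
    rw [← Finset.sum_mul, ← sub_mul, norm_mul]
    exact (mul_le_of_le_one_right (norm_nonneg _) (w1 t x)).trans (pt x)
  have t3 : Tendsto (fun t => (∫ x, g (∑ i ∈ s, f i (x - y i t) + ε t x) * w t x) -
      ∑ i ∈ s, ∫ x, g (f i (x - y i t)) * w t x) atTop (nhds 0) :=
    squeeze_zero_norm' diff X0
  simpa using t3.add main

end GKdV

namespace GKdV
variable {u : ℝ → ℝ → ℝ}

lemma wt_sigmoid (β : ℝ) : Wt (fun z => sigmoid (β * z)) (fun z => β * bell (β * z))
    (fun z => β ^ 2 * bell1 (β * z)) (fun z => β ^ 3 * bell2 (β * z)) := by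
  have hd : ∀ x, HasDerivAt (fun z => β * z) β x := fun x => by
    simpa using (hasDerivAt_id x).const_mul β
  refine ⟨fun x => ?_, fun x => ?_, fun x => ?_, ?_, 1 + |β| + |β| ^ 2 + |β| ^ 3, fun x => ?_⟩
  · exact ((hasDerivAt_sig _).comp x (hd x)).congr_deriv (by ring)
  · exact (((hasDerivAt_bell _).comp x (hd x)).const_mul β).congr_deriv (by ring)
  · exact (((hasDerivAt_bell1 _).comp x (hd x)).const_mul (β ^ 2)).congr_deriv (by ring)
  · exact continuous_const.mul (continuous_bell2.comp (continuous_const.mul continuous_id))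
  · have h0 := bell_le (β * x)
    have h1 := abs_bell1 (β * x)
    have h2 := abs_bell2 (β * x)
    have h3 : |bell (β * x)| ≤ 1 := by rw [abs_of_pos (bell_pos _)]; linarith
    have h4 : |sigmoid (β * x)| ≤ 1 := by
      rw [abs_of_pos (sigmoid_pos _)]; exact (sigmoid_lt_one _).le
    have b0 := abs_nonneg β
    have b2 : 0 ≤ |β| ^ 2 := by positivity
    have b3 : 0 ≤ |β| ^ 3 := by positivity
    simp only [abs_mul, abs_pow]
    refine ⟨by linarith, ?_, ?_, ?_⟩
    · nlinarith [mul_le_of_le_one_right b0 h3]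
    · nlinarith [mul_le_of_le_one_right b2 (h1.trans (by linarith : bell (β * x) ≤ 1))]
    · nlinarith [mul_le_of_le_one_right b3 (h2.trans (by linarith : bell (β * x) ≤ 1))]

/-- The localized combination of energy and mass to the right of `y`. -/
noncomputable def Psi (u : ℝ → ℝ → ℝ) (l β t y : ℝ) : ℝ :=
  ∫ x, (en u t x + l * u t x ^ 2) * sigmoid (β * (x - y))

lemma flux_density_le {m β l η v v1 F k σ : ℝ} (hm : 0 < m) (h1 : β ^ 2 ≤ l)
    (h2 : β ^ 4 / 3 ≤ l * (m - β ^ 2 / 4)) (hσ : σ ^ 2 = 1 - 4 * k) (hk : 0 ≤ k) (hv : |v| ≤ η) :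
    -((3 / 2 * F ^ 2 - v ^ 4 * F) + l * (3 * v1 ^ 2 - 8 / 5 * v ^ 5) +
      m * ((1 / 2 * v1 ^ 2 - 1 / 5 * v ^ 5) + l * v ^ 2)) +
      (-(v1 * F) - 3 * l * (v * v1)) * (β * σ) - l * (1 / 2 * v ^ 2) * (β ^ 2 * (1 - 6 * k)) ≤
    (η ^ 6 / 3 + (m + 8 * l) / 5 * η ^ 3 - l * (m - β ^ 2 / 4) / 2) * v ^ 2 := by
  have l0 : 0 ≤ l := (sq_nonneg β).trans h1
  have p5 : v ^ 5 ≤ η ^ 3 * v ^ 2 := (le_abs_self _).trans (abs_pow5_le hv)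
  have p8 : v ^ 8 ≤ η ^ 6 * v ^ 2 := by
    have : |v| ^ 6 ≤ η ^ 6 := pow_le_pow_left₀ (abs_nonneg _) hv 6
    have e : |v| ^ 6 = v ^ 6 := by
      rw [show (6:ℕ) = 2 * 3 from rfl, pow_mul, sq_abs, ← pow_mul]
    rw [e] at this
    calc v ^ 8 = v ^ 6 * v ^ 2 := by ring
      _ ≤ _ := mul_le_mul_of_nonneg_right this (sq_nonneg v)
  have q5 : (m + 8 * l) / 5 * v ^ 5 ≤ (m + 8 * l) / 5 * (η ^ 3 * v ^ 2) :=
    mul_le_mul_of_nonneg_left p5 (by positivity)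
  set w := β * σ * v / 2 with hw
  have hβσ : (β * σ * v1) ^ 2 ≤ β ^ 2 * v1 ^ 2 := by
    have : (β * σ * v1) ^ 2 = β ^ 2 * v1 ^ 2 * σ ^ 2 := by ring
    rw [this, hσ]
    nlinarith [mul_nonneg (mul_nonneg (sq_nonneg β) (sq_nonneg v1)) hk]
  have hwv : w ^ 2 ≤ β ^ 2 / 4 * v ^ 2 := by
    have : w ^ 2 = β ^ 2 / 4 * v ^ 2 * σ ^ 2 := by rw [hw]; ring
    rw [this, hσ]
    nlinarith [mul_nonneg (mul_nonneg (sq_nonneg β) (sq_nonneg v)) hk]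
  have a1 : -(3 / 2 * F ^ 2) + F * (v ^ 4 - β * σ * v1) ≤ v ^ 8 / 3 + (β * σ * v1) ^ 2 / 3 := by
    nlinarith [sq_nonneg (3 * F - (v ^ 4 - β * σ * v1)), sq_nonneg (v ^ 4 + β * σ * v1)]
  have a2 : β ^ 2 / 3 * v1 ^ 2 ≤ 3 * l * (v1 + w) ^ 2 + β ^ 4 / 6 * v ^ 2 := by
    have e1 : v1 ^ 2 ≤ 2 * (v1 + w) ^ 2 + 2 * w ^ 2 := by nlinarith [sq_nonneg (v1 + 2 * w)]
    have e2 := mul_le_mul_of_nonneg_left e1 (by positivity : 0 ≤ β ^ 2 / 3)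
    have e3 := mul_le_mul_of_nonneg_left hwv (by positivity : 0 ≤ 2 * β ^ 2 / 3)
    have e4 := mul_le_mul_of_nonneg_right h1 (sq_nonneg (v1 + w))
    have e5 := mul_nonneg l0 (sq_nonneg (v1 + w))
    nlinarith
  have a3 : β ^ 4 / 6 * v ^ 2 ≤ l * (m - β ^ 2 / 4) / 2 * v ^ 2 :=
    mul_le_mul_of_nonneg_right (by linarith) (sq_nonneg v)
  have a4 : 0 ≤ m / 2 * v1 ^ 2 := by positivity
  have key : -((3 / 2 * F ^ 2 - v ^ 4 * F) + l * (3 * v1 ^ 2 - 8 / 5 * v ^ 5) +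
      m * ((1 / 2 * v1 ^ 2 - 1 / 5 * v ^ 5) + l * v ^ 2)) +
      (-(v1 * F) - 3 * l * (v * v1)) * (β * σ) - l * (1 / 2 * v ^ 2) * (β ^ 2 * (1 - 6 * k)) =
      (-(3 / 2 * F ^ 2) + F * (v ^ 4 - β * σ * v1)) - m / 2 * v1 ^ 2 - 3 * l * (v1 + w) ^ 2
      - l * (m - β ^ 2 / 4) * v ^ 2 + (m + 8 * l) / 5 * v ^ 5
      + 3 / 4 * l * β ^ 2 * v ^ 2 * (σ ^ 2 - (1 - 4 * k)) := by rw [hw]; ring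
  rw [key, hσ]
  nlinarith

lemma Psi_mono {B m β l η : ℝ} (hu : IsGKdVSolution u) (hB : ∀ a b, HB u a b B)
    (hβ : 0 < β) (hm : 0 < m) (h1 : β ^ 2 ≤ l) (h2 : β ^ 4 / 3 ≤ l * (m - β ^ 2 / 4))
    (hη : η ^ 6 / 3 + (m + 8 * l) / 5 * η ^ 3 ≤ l * (m - β ^ 2 / 4) / 2) :
    ∃ C, 0 ≤ C ∧ ∀ a b y, ∀ d : ℝ → ℝ, a ≤ b → Continuous d →
      (∀ t ∈ Set.Icc a b, ∀ x, |x - (m * t + y)| < d t → |u t x| ≤ η) →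
      Psi u l β b (m * b + y) ≤ Psi u l β a (m * a + y) + ∫ t in a..b, C * exp (-(β * d t)) := by
  have s := sol_sm hu
  have B0 : 0 ≤ B := (hB 0 0).nonneg le_rfl
  have l0 : 0 ≤ l := (sq_nonneg β).trans h1
  set K := (1 + B) ^ 6 / 3 + (m + 8 * l) / 5 * (1 + B) ^ 3 with hK
  have K0 : 0 ≤ K := by positivity
  refine ⟨β * K * B, by positivity, fun a b y d hab hd hs => ?_⟩
  rcases hab.eq_or_lt with rfl | hlt
  · simp
  obtain ⟨m0, m1, m2, m3⟩ := (hB a b).law_bdd hu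
  obtain ⟨e0, e1, e2⟩ := (hB a b).energy_bdd hu hlt
  have L := (energy_law hu).add (mass_law hu) l
  have sc : ∀ {f : ℝ → ℝ → ℝ}, BddL1 f a b → Sm f → BddL1 (fun t x => l * f t x) a b :=
    fun {f} hf sf => hf.of_le (fun t => (sf.const_mul l).cont_x t) |l| fun t _ x => by rw [abs_mul]
  have M := mass_law hu
  refine L.le (wt_sigmoid β) hab m y (e0.add (sc m0 M.sD))
    ((BddL1.zero a b).add (sc (BddL1.zero a b) (Sm.const 0))) (e1.add (sc m1 M.s1))
    (e2.add (sc m2 M.s2)) ((BddL1.zero a b).add (sc m3 M.s3)) _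
    (Continuous.intervalIntegrable (by fun_prop) a b) fun t ht => ?_
  have ig : Integrable fun x => β * K * exp (-(β * d t)) * hden u t x := (hden_int hu t).const_mul _
  have hpos : ∀ x, 0 ≤ β * K * exp (-(β * d t)) * hden u t x := fun x => by
    have := hden_nonneg (u := u) t x
    positivity
  have hfin : ∫ x, β * K * exp (-(β * d t)) * hden u t x ≤ β * K * B * exp (-(β * d t)) := by
    rw [integral_const_mul]
    have := mul_le_mul_of_nonneg_left (hB a b t ht) (by positivity : 0 ≤ β * K * exp (-(β * d t)))
    linarith
  refine le_trans ?_ hfin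
  by_cases hi : Integrable (fun x => flux (fun t x => en u t x + l * u t x ^ 2)
      (fun t x => 0 + l * 0)
      (fun t x => 1 / 2 * pot u t x ^ 2 + px (px u) t x * pot u t x +
        l * (3 * px u t x ^ 2 - 8 / 5 * u t x ^ 5))
      (fun t x => (-1) * (px u t x * pot u t x) + l * (-3 * (u t x * px u t x)))
      (fun t x => 0 + l * (1 / 2 * u t x ^ 2)) (fun z => sigmoid (β * z))
      (fun z => β * bell (β * z)) (fun z => β ^ 2 * bell1 (β * z)) (fun z => β ^ 3 * bell2 (β * z))
      m y t x)
  swap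
  · rw [integral_undef hi]; exact integral_nonneg hpos
  refine integral_mono hi ig fun x => ?_
  set z := β * (x - (m * t + y)) with hz
  have hk := bell_pos z
  have hσ : (1 - 2 * sigmoid z) ^ 2 = 1 - 4 * bell z := by unfold bell; ring
  have J := fun η' (h : |u t x| ≤ η') => flux_density_le (v1 := px u t x) (F := pot u t x)
    hm h1 h2 hσ hk.le h
  set JJ := -((3 / 2 * pot u t x ^ 2 - u t x ^ 4 * pot u t x) + l * (3 * px u t x ^ 2 - 8 / 5 * u t x ^ 5) +
      m * ((1 / 2 * px u t x ^ 2 - 1 / 5 * u t x ^ 5) + l * u t x ^ 2)) +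
      (-(px u t x * pot u t x) - 3 * l * (u t x * px u t x)) * (β * (1 - 2 * sigmoid z))
      - l * (1 / 2 * u t x ^ 2) * (β ^ 2 * (1 - 6 * bell z)) with hJJ
  have e : flux (fun t x => en u t x + l * u t x ^ 2)
      (fun t x => 0 + l * 0)
      (fun t x => 1 / 2 * pot u t x ^ 2 + px (px u) t x * pot u t x +
        l * (3 * px u t x ^ 2 - 8 / 5 * u t x ^ 5))
      (fun t x => (-1) * (px u t x * pot u t x) + l * (-3 * (u t x * px u t x)))
      (fun t x => 0 + l * (1 / 2 * u t x ^ 2)) (fun z => sigmoid (β * z))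
      (fun z => β * bell (β * z)) (fun z => β ^ 2 * bell1 (β * z)) (fun z => β ^ 3 * bell2 (β * z))
      m y t x = β * bell z * JJ := by
    simp only [flux, ← hz, bell1, bell2, hJJ, en]
    have : px (px u) t x = pot u t x - u t x ^ 4 := by unfold pot; ring
    rw [this]; ring
  show flux _ _ _ _ _ _ _ _ _ _ _ _ _ ≤ _
  rw [e]
  have hv2 : u t x ^ 2 ≤ hden u t x := by unfold hden; linarith [sq_nonneg (px u t x)]
  by_cases hx : |x - (m * t + y)| < d t
  · have := J η (hs t ht x hx)
    have h3 : JJ ≤ 0 := this.trans (mul_nonpos_of_nonpos_of_nonneg (by linarith) (sq_nonneg _))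
    exact (mul_nonpos_of_nonneg_of_nonpos (by positivity) h3).trans (hpos x)
  · have h3 : JJ ≤ K * hden u t x := (J _ ((hB a b).ptw hu ht x)).trans (by
      refine le_trans ?_ (mul_le_mul_of_nonneg_left hv2 K0)
      refine mul_le_mul_of_nonneg_right ?_ (sq_nonneg _)
      have : 0 ≤ β ^ 4 / 3 := by positivity
      linarith)
    have h4 : bell z ≤ exp (-(β * d t)) := by
      refine (bell_le_exp z).trans (exp_le_exp.2 ?_)
      rw [hz, abs_mul, abs_of_pos hβ]
      push Not at hx
      linarith [mul_le_mul_of_nonneg_left hx hβ.le]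
    have h5 : 0 ≤ K * hden u t x := mul_nonneg K0 (hden_nonneg t x)
    calc β * bell z * JJ ≤ β * bell z * (K * hden u t x) :=
          mul_le_mul_of_nonneg_left h3 (by positivity)
      _ ≤ β * exp (-(β * d t)) * (K * hden u t x) :=
          mul_le_mul_of_nonneg_right (mul_le_mul_of_nonneg_left h4 hβ.le) h5
      _ = _ := by ring

end GKdV

namespace GKdV
variable {u : ℝ → ℝ → ℝ} {N : ℕ} {c Δ : ℕ → ℝ}

/-- `u` is asymptotic, as `t → +∞`, to a sum of decoupled solitons. -/
structure Out (u : ℝ → ℝ → ℝ) (N : ℕ) (c Δ : ℕ → ℝ) : Prop where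
  pos : ∀ j ∈ Finset.Icc 1 N, 0 < c j
  dec : ∀ i ∈ Finset.Icc 1 N, ∀ j ∈ Finset.Icc 1 N, i < j → c j < c i
  lim : Tendsto (fun t => H1norm (fun x =>
    u t x - ∑ j ∈ Finset.Icc 1 N, Qc (c j) (x - c j * t - Δ j))) atTop (nhds 0)

lemma prof_Qc {c : ℝ} (hc : 0 < c) : Prof (Qc c) := by
  have h0 : Tendsto (fun x => 3 * rt c ^ 2 * exp (-(√c * |x|))) (cocompact ℝ) (nhds 0) := by
    have h1 : Tendsto (fun x : ℝ => √c * |x|) (cocompact ℝ) atTop :=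
      (tendsto_norm_cocompact_atTop (E := ℝ)).const_mul_atTop (sqrt_pos.2 hc)
    simpa using (tendsto_exp_neg_atTop_nhds_zero.comp h1).const_mul (3 * rt c ^ 2)
  refine ⟨continuous_Qc hc, by simpa using integrable_Qc_pow hc 0, ⟨3 * rt c ^ 2, fun x => ?_⟩,
    squeeze_zero (fun x => (Qc_pos hc x).le) (Qc_le_exp hc) h0⟩
  rw [abs_of_pos (Qc_pos hc x)]
  refine (Qc_le_exp hc x).trans (mul_le_of_le_one_right (by have := rt_pos hc; positivity) ?_)
  rw [exp_le_one_iff]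
  have : 0 ≤ √c * |x| := by positivity
  linarith

lemma prof_Qc1 {c : ℝ} (hc : 0 < c) : Prof (Qc1 c) := by
  have h := prof_Qc hc
  obtain ⟨K, hK⟩ := h.bdd
  have r := rt_pos hc
  have le : ∀ x, ‖Qc1 c x‖ ≤ rt c ^ 3 * Qc c x := abs_Qc1_le hc
  refine ⟨continuous_Qc1, (h.int.const_mul (rt c ^ 3)).mono' continuous_Qc1.aestronglyMeasurable
    (Eventually.of_forall le), ⟨rt c ^ 3 * K, fun x => (le x).trans ?_⟩,
    squeeze_zero_norm le (by simpa using h.zero.const_mul (rt c ^ 3))⟩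
  exact mul_le_mul_of_nonneg_left ((le_abs_self _).trans (hK x)) (by positivity)

/-- The remainder after subtracting the solitons. -/
noncomputable def rem (u : ℝ → ℝ → ℝ) (N : ℕ) (c Δ : ℕ → ℝ) (t x : ℝ) : ℝ :=
  u t x - ∑ j ∈ Finset.Icc 1 N, Qc (c j) (x - (c j * t + Δ j))

/-- The space derivative of the remainder. -/
noncomputable def rem1 (u : ℝ → ℝ → ℝ) (N : ℕ) (c Δ : ℕ → ℝ) (t x : ℝ) : ℝ :=
  px u t x - ∑ j ∈ Finset.Icc 1 N, Qc1 (c j) (x - (c j * t + Δ j))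

lemma integrable_sub_sq {f g : ℝ → ℝ} (hf : Continuous f) (hg : Continuous g)
    (i1 : Integrable fun x => f x ^ 2) (i2 : Integrable fun x => g x ^ 2) :
    Integrable fun x => (f x - g x) ^ 2 := by
  have := (i1.add i2).sub ((integrable_mul_of_sq hf hg i1 i2).const_mul 2)
  refine this.congr (Eventually.of_forall fun x => ?_)
  simp only [Pi.add_apply, Pi.sub_apply]; ring

lemma integrable_sum_sq {s : Finset ℕ} {f : ℕ → ℝ → ℝ} (hf : ∀ i ∈ s, Continuous (f i))
    (hi : ∀ i ∈ s, Integrable fun x => f i x ^ 2) :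
    Integrable fun x => (∑ i ∈ s, f i x) ^ 2 := by
  simp_rw [_root_.sq, Finset.sum_mul_sum]
  exact integrable_finsetSum _ fun i h => integrable_finsetSum _ fun j h' =>
    integrable_mul_of_sq (hf i h) (hf j h') (hi i h) (hi j h')

lemma Out.hasDerivAt_rem (ho : Out u N c Δ) (s : Sm u) (t x : ℝ) :
    HasDerivAt (rem u N c Δ t) (rem1 u N c Δ t x) x := by
  unfold rem rem1
  refine (s.hasDerivAt_x t x).sub (HasDerivAt.fun_sum fun j hj => ?_)
  exact ((hasDerivAt_Qc (ho.pos j hj) (x - (c j * t + Δ j))).comp x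
    ((hasDerivAt_id x).sub_const (c j * t + Δ j))).congr_deriv (mul_one _)

lemma Out.cont_rem (ho : Out u N c Δ) (hu : IsGKdVSolution u) (t : ℝ) :
    Continuous (rem u N c Δ t) :=
  continuous_iff_continuousAt.2 fun x => (ho.hasDerivAt_rem (sol_sm hu) t x).continuousAt

lemma Out.cont_rem1 (hu : IsGKdVSolution u) (t : ℝ) : Continuous (rem1 u N c Δ t) :=
  ((sol_sm hu).px.cont_x t).sub (continuous_finsetSum _ fun _ _ =>
    continuous_Qc1.comp (continuous_sub_right _))

lemma Out.int_rem (ho : Out u N c Δ) (hu : IsGKdVSolution u) (t : ℝ) :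
    Integrable fun x => rem u N c Δ t x ^ 2 :=
  integrable_sub_sq ((sol_sm hu).cont_x t) (continuous_finsetSum _ fun j hj =>
    (continuous_Qc (ho.pos j hj)).comp (continuous_sub_right _)) (sol_int0 hu t)
    (integrable_sum_sq (fun j hj => (continuous_Qc (ho.pos j hj)).comp (continuous_sub_right _))
      fun j hj => (prof_Qc (ho.pos j hj)).sq.comp_sub_right _)

lemma Out.int_rem1 (ho : Out u N c Δ) (hu : IsGKdVSolution u) (t : ℝ) :
    Integrable fun x => rem1 u N c Δ t x ^ 2 :=
  integrable_sub_sq ((sol_sm hu).px.cont_x t) (continuous_finsetSum _ fun _ _ =>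
    continuous_Qc1.comp (continuous_sub_right _)) (sol_int1 hu t)
    (integrable_sum_sq (fun _ _ => continuous_Qc1.comp (continuous_sub_right _))
      fun j hj => (prof_Qc1 (ho.pos j hj)).sq.comp_sub_right _)

lemma Out.tendsto_H1 (ho : Out u N c Δ) (hu : IsGKdVSolution u) :
    Tendsto (fun t => ∫ x, (rem u N c Δ t x ^ 2 + rem1 u N c Δ t x ^ 2)) atTop
    (nhds 0) := by
  have e : ∀ t, H1norm (fun x => u t x - ∑ j ∈ Finset.Icc 1 N, Qc (c j) (x - c j * t - Δ j)) ^ 2 =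
      ∫ x, (rem u N c Δ t x ^ 2 + rem1 u N c Δ t x ^ 2) := fun t => by
    have e1 : (fun x => u t x - ∑ j ∈ Finset.Icc 1 N, Qc (c j) (x - c j * t - Δ j)) =
        rem u N c Δ t := by
      funext x; unfold rem; simp_rw [sub_sub]
    rw [e1, H1norm, sq_sqrt (integral_nonneg fun x => by positivity)]
    simp_rw [(ho.hasDerivAt_rem (sol_sm hu) t _).deriv]
  simp_rw [← e]
  simpa using ho.lim.pow 2

lemma Out.tendsto_rem (ho : Out u N c Δ) (hu : IsGKdVSolution u) :
    Tendsto (fun t => ∫ x, rem u N c Δ t x ^ 2) atTop (nhds 0) :=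
  squeeze_zero (fun t => integral_nonneg fun x => sq_nonneg _) (fun t =>
    integral_mono (ho.int_rem hu t) ((ho.int_rem hu t).add (ho.int_rem1 hu t)) fun x => by
      simp only [Pi.add_apply]; linarith [sq_nonneg (rem1 u N c Δ t x)]) (ho.tendsto_H1 hu)

lemma Out.tendsto_rem1 (ho : Out u N c Δ) (hu : IsGKdVSolution u) :
    Tendsto (fun t => ∫ x, rem1 u N c Δ t x ^ 2) atTop (nhds 0) :=
  squeeze_zero (fun t => integral_nonneg fun x => sq_nonneg _) (fun t =>
    integral_mono (ho.int_rem1 hu t) ((ho.int_rem hu t).add (ho.int_rem1 hu t)) fun x => by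
      simp only [Pi.add_apply]; linarith [sq_nonneg (rem u N c Δ t x)]) (ho.tendsto_H1 hu)

lemma Out.rem_small (ho : Out u N c Δ) (hu : IsGKdVSolution u)
    {η : ℝ} (hη : 0 < η) : ∀ᶠ t in atTop, ∀ x, |rem u N c Δ t x| ≤ η := by
  filter_upwards [(ho.tendsto_H1 hu).eventually (gt_mem_nhds (by positivity : 0 < η ^ 2))] with t ht x
  have := sq_le_H1 (ho.hasDerivAt_rem (sol_sm hu) t) (Out.cont_rem1 hu t) (ho.int_rem hu t)
    (ho.int_rem1 hu t) x
  exact abs_le_of_sq_le_sq (this.trans ht.le) hη.le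

/-- Far from the solitons the solution is small. -/
lemma Out.small (ho : Out u N c Δ) (hu : IsGKdVSolution u)
    {η : ℝ} (hη : 0 < η) : ∃ L, 0 < L ∧ ∀ᶠ t in atTop, ∀ x,
    (∀ j ∈ Finset.Icc 1 N, L ≤ |x - (c j * t + Δ j)|) → |u t x| ≤ η := by
  have hq : 0 < η / (2 * (N + 1)) := by positivity
  have h : ∀ j ∈ Finset.Icc 1 N, ∃ L, ∀ z, L ≤ |z| → Qc (c j) z ≤ η / (2 * (N + 1)) := fun j hj => by
    have := (prof_Qc (ho.pos j hj)).zero.eventually (gt_mem_nhds hq)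
    rw [cocompact_eq_atBot_atTop, ← comap_abs_atTop, eventually_comap, eventually_atTop] at this
    obtain ⟨L, hL⟩ := this
    exact ⟨L, fun z hz => (hL _ hz z rfl).le⟩
  choose! Lf hL using h
  refine ⟨1 + ∑ j ∈ Finset.Icc 1 N, |Lf j|, by positivity, ?_⟩
  filter_upwards [ho.rem_small hu (half_pos hη)] with t ht x hx
  have h1 : ∀ j ∈ Finset.Icc 1 N, |Qc (c j) (x - (c j * t + Δ j))| ≤ η / (2 * (N + 1)) := fun j hj => by
    rw [abs_of_pos (Qc_pos (ho.pos j hj) _)]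
    refine hL j hj _ (le_trans ?_ (hx j hj))
    have := Finset.single_le_sum (f := fun j => |Lf j|) (fun i _ => abs_nonneg _) hj
    have := le_abs_self (Lf j)
    linarith
  have h2 := (Finset.abs_sum_le_sum_abs (fun j => Qc (c j) (x - (c j * t + Δ j))) _).trans
    (Finset.sum_le_sum h1)
  rw [Finset.sum_const, Nat.card_Icc, nsmul_eq_mul] at h2
  simp only [Nat.add_sub_cancel] at h2
  have h3 : (N:ℝ) * (η / (2 * (N + 1))) ≤ η / 2 := by
    rw [mul_div_assoc', div_le_div_iff₀ (by positivity) (by norm_num)]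
    nlinarith
  have h4 : u t x = rem u N c Δ t x + ∑ j ∈ Finset.Icc 1 N, Qc (c j) (x - (c j * t + Δ j)) := by
    unfold rem; ring
  rw [h4]
  exact (abs_add_le _ _).trans (by linarith [ht x])

/-- The combination of energy and mass carried by one soliton. -/
noncomputable def sol1 (l c : ℝ) : ℝ := -(qmass / 14) * rt c ^ 7 + l * (qmass * rt c)

lemma Out.separate (ho : Out u N c Δ) : ∀ i ∈ Finset.Icc 1 N, ∀ k ∈ Finset.Icc 1 N, i ≠ k →
    Tendsto (fun t => |(c i * t + Δ i) - (c k * t + Δ k)|) atTop atTop := fun i hi k hk hik => by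
  have hne : c i - c k ≠ 0 := by
    rcases lt_or_gt_of_ne hik with h | h
    · linarith [ho.dec i hi k hk h]
    · have := ho.dec k hk i hi h
      intro h'; linarith
  have e : ∀ t, (c i * t + Δ i) - (c k * t + Δ k) = (c i - c k) * t + (Δ i - Δ k) := fun t => by ring
  simp_rw [e]
  refine tendsto_atTop_mono (fun t => ?_)
    (tendsto_atTop_add_const_right atTop (-|Δ i - Δ k|) (tendsto_id.const_mul_atTop (abs_pos.2 hne)))
  have h1 := abs_sub_abs_le_abs_sub ((c i - c k) * t) (-(Δ i - Δ k))
  rw [sub_neg_eq_add, abs_neg, abs_mul] at h1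
  have h2 := mul_le_mul_of_nonneg_left (le_abs_self t) (abs_nonneg (c i - c k))
  simp only [id]
  linarith

lemma Out.tendsto_weighted (ho : Out u N c Δ) (hu : IsGKdVSolution u)
    (l : ℝ) {w : ℝ → ℝ → ℝ} {p : ℕ → ℝ} (wc : ∀ t, Continuous (w t))
    (w1 : ∀ t x, |w t x| ≤ 1)
    (hw : ∀ j ∈ Finset.Icc 1 N, ∀ z, Tendsto (fun t => w t (z + (c j * t + Δ j))) atTop (nhds (p j))) :
    Tendsto (fun t => ∫ x, (en u t x + l * u t x ^ 2) * w t x) atTop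
      (nhds (∑ j ∈ Finset.Icc 1 N, p j * sol1 l (c j))) := by
  have s := sol_sm hu
  have eu : ∀ t x, u t x = ∑ j ∈ Finset.Icc 1 N, Qc (c j) (x - (c j * t + Δ j)) + rem u N c Δ t x :=
    fun t x => by unfold rem; ring
  have eu1 : ∀ t x, px u t x =
      ∑ j ∈ Finset.Icc 1 N, Qc1 (c j) (x - (c j * t + Δ j)) + rem1 u N c Δ t x :=
    fun t x => by unfold rem1; ring
  have g2 : ∀ A ∈ (Set.univ : Set ℝ), ∀ q ∈ (Set.univ : Set ℝ),
      |(A + q) ^ 2 - A ^ 2 - q ^ 2| ≤ 2 * (|A| * |q|) := fun A _ q _ => by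
    rw [show (A + q) ^ 2 - A ^ 2 - q ^ 2 = 2 * (A * q) by ring, abs_mul, abs_mul]; simp
  have T1 : Tendsto (fun t => ∫ x, u t x ^ 2 * w t x) atTop
      (nhds (∑ j ∈ Finset.Icc 1 N, p j * ∫ x, Qc (c j) x ^ 2)) := by
    have := tendsto_integral_profiles (s := Finset.Icc 1 N) (f := fun j => Qc (c j))
      (y := fun j t => c j * t + Δ j) (g := fun q => q ^ 2) (S := Set.univ) (C := 2) (by norm_num)
      (fun j hj => prof_Qc (ho.pos j hj)) ho.separate (by simp) (by fun_prop)
      (fun q _ => by rw [abs_sq]; linarith [sq_nonneg q]) g2 (fun _ _ _ => trivial)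
      (Eventually.of_forall fun _ _ => trivial) (ho.cont_rem hu) (ho.int_rem hu) (ho.tendsto_rem hu)
      wc w1 hw
    simpa only [← eu] using this
  have T2 : Tendsto (fun t => ∫ x, px u t x ^ 2 * w t x) atTop
      (nhds (∑ j ∈ Finset.Icc 1 N, p j * ∫ x, Qc1 (c j) x ^ 2)) := by
    have := tendsto_integral_profiles (s := Finset.Icc 1 N) (f := fun j => Qc1 (c j))
      (y := fun j t => c j * t + Δ j) (g := fun q => q ^ 2) (S := Set.univ) (C := 2) (by norm_num)
      (fun j hj => prof_Qc1 (ho.pos j hj)) ho.separate (by simp) (by fun_prop)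
      (fun q _ => by rw [abs_sq]; linarith [sq_nonneg q]) g2 (fun _ _ _ => trivial)
      (Eventually.of_forall fun _ _ => trivial) (Out.cont_rem1 hu) (ho.int_rem1 hu)
      (ho.tendsto_rem1 hu) wc w1 hw
    simpa only [← eu1] using this
  have hb : ∀ j ∈ Finset.Icc 1 N, ∃ K, ∀ x, |Qc (c j) x| ≤ K := fun j hj => (prof_Qc (ho.pos j hj)).bdd
  choose! Kf hK using hb
  have Kf0 : ∀ j ∈ Finset.Icc 1 N, 0 ≤ Kf j := fun j hj => (abs_nonneg _).trans (hK j hj 0)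
  set K : ℝ := 1 + ∑ j ∈ Finset.Icc 1 N, Kf j with hKdef
  have K1 : 1 ≤ K := by linarith [Finset.sum_nonneg Kf0]
  have T5 : Tendsto (fun t => ∫ x, u t x ^ 5 * w t x) atTop
      (nhds (∑ j ∈ Finset.Icc 1 N, p j * ∫ x, Qc (c j) x ^ 5)) := by
    have := tendsto_integral_profiles (s := Finset.Icc 1 N) (f := fun j => Qc (c j))
      (y := fun j t => c j * t + Δ j) (g := fun q => q ^ 5) (S := {q | |q| ≤ K}) (C := 30 * K ^ 3)
      (by positivity)
      (fun j hj => prof_Qc (ho.pos j hj)) ho.separate (by simp) (by fun_prop)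
      (fun q hq => (abs_pow5_le hq).trans (mul_le_mul_of_nonneg_right (by
        have : 0 ≤ K ^ 3 := by positivity
        linarith) (sq_nonneg q)))
      (fun A hA q hq => by
        have hA : |A| ≤ K := hA
        have hq : |q| ≤ K := hq
        have e : (A + q) ^ 5 - A ^ 5 - q ^ 5 =
          (5 * A ^ 3 + 10 * (A ^ 2 * q) + 10 * (A * q ^ 2) + 5 * q ^ 3) * (A * q) := by ring
        rw [e, abs_mul, abs_mul A q]
        refine mul_le_mul_of_nonneg_right ?_ (by positivity)
        have p1 : |A ^ 3| ≤ K ^ 3 := by rw [abs_pow]; exact pow_le_pow_left₀ (abs_nonneg _) hA 3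
        have p4 : |q ^ 3| ≤ K ^ 3 := by rw [abs_pow]; exact pow_le_pow_left₀ (abs_nonneg _) hq 3
        have A2 : |A ^ 2| ≤ K ^ 2 := by rw [abs_pow]; exact pow_le_pow_left₀ (abs_nonneg _) hA 2
        have q2 : |q ^ 2| ≤ K ^ 2 := by rw [abs_pow]; exact pow_le_pow_left₀ (abs_nonneg _) hq 2
        have p2 : |A ^ 2 * q| ≤ K ^ 3 := by
          rw [abs_mul]
          exact (mul_le_mul A2 hq (abs_nonneg _) (by positivity)).trans (by ring_nf; exact le_rfl)
        have p3 : |A * q ^ 2| ≤ K ^ 3 := by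
          rw [abs_mul]
          exact (mul_le_mul hA q2 (abs_nonneg _) (by positivity)).trans (by ring_nf; exact le_rfl)
        rw [abs_le] at *
        constructor <;> linarith)
      (fun s' hs' z => by
        refine (Finset.abs_sum_le_sum_abs _ _).trans ((Finset.sum_le_sum fun i hi =>
          hK i (hs' hi) (z i)).trans ?_)
        have := Finset.sum_le_sum_of_subset_of_nonneg hs' (f := Kf) fun i hi _ => Kf0 i hi
        linarith)
      ((ho.rem_small hu one_pos).mono fun t ht x => (ht x).trans K1) (ho.cont_rem hu) (ho.int_rem hu)
      (ho.tendsto_rem hu) wc w1 hw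
    simpa only [← eu] using this
  have lim := ((T2.const_mul (1 / 2)).sub (T5.const_mul (1 / 5))).add (T1.const_mul l)
  have val : 1 / 2 * (∑ j ∈ Finset.Icc 1 N, p j * ∫ x, Qc1 (c j) x ^ 2)
      - 1 / 5 * (∑ j ∈ Finset.Icc 1 N, p j * ∫ x, Qc (c j) x ^ 5)
      + l * (∑ j ∈ Finset.Icc 1 N, p j * ∫ x, Qc (c j) x ^ 2) =
      ∑ j ∈ Finset.Icc 1 N, p j * sol1 l (c j) := by
    rw [Finset.mul_sum, Finset.mul_sum, Finset.mul_sum, ← Finset.sum_sub_distrib,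
      ← Finset.sum_add_distrib]
    refine Finset.sum_congr rfl fun j hj => ?_
    have hc := ho.pos j hj
    rw [integral_Qc1_sq hc, integral_Qc_five hc, integral_Qc_sq hc, sol1]; ring
  rw [val] at lim
  refine lim.congr fun t => ?_
  have bw : ∀ {f : ℝ → ℝ}, Integrable f → Integrable fun x => f x * w t x := fun hf =>
    hf.mul_bdd (c := 1) (wc t).aestronglyMeasurable (Eventually.of_forall fun x => w1 t x)
  have i5 : Integrable fun x => u t x ^ 5 := by
    refine ((((sol_int1 hu t).const_mul (1 / 2)).sub (en_int hu t)).const_mul 5).congr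
      (Eventually.of_forall fun x => ?_)
    simp only [en, Pi.sub_apply]; ring
  have i15 : Integrable fun x => 1 / 2 * (px u t x ^ 2 * w t x) - 1 / 5 * (u t x ^ 5 * w t x) :=
    ((bw (sol_int1 hu t)).const_mul _).sub ((bw i5).const_mul _)
  rw [← integral_const_mul, ← integral_const_mul, ← integral_const_mul, ← integral_sub
    ((bw (sol_int1 hu t)).const_mul _) ((bw i5).const_mul _), ← integral_add
    i15 ((bw (sol_int0 hu t)).const_mul _)]
  refine integral_congr_ae (Eventually.of_forall fun x => ?_)
  simp only [en]; ring

/-- The conserved value of energy plus `l` times mass. -/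
lemma Out.total (ho : Out u N c Δ) (hu : IsGKdVSolution u) (l t : ℝ) :
    ∫ x, (en u t x + l * u t x ^ 2) = ∑ j ∈ Finset.Icc 1 N, sol1 l (c j) := by
  have h := ho.tendsto_weighted hu l (w := fun _ _ => 1) (p := fun _ => 1)
    (fun _ => continuous_const) (by simp) (fun _ _ _ => tendsto_const_nhds)
  simp only [mul_one, one_mul] at h
  have e : ∀ r, ∫ x, (en u r x + l * u r x ^ 2) = ∫ x, (en u t x + l * u t x ^ 2) := fun r => by
    rw [integral_add (en_int hu r) ((sol_int0 hu r).const_mul l), integral_add (en_int hu t)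
      ((sol_int0 hu t).const_mul l), integral_const_mul, integral_const_mul, (conserved hu t r).1,
      (conserved hu t r).2]
  simp_rw [e] at h
  exact tendsto_nhds_unique tendsto_const_nhds h

lemma Out.tendsto_Psi (ho : Out u N c Δ) (hu : IsGKdVSolution u)
    (l : ℝ) {β m : ℝ} (hβ : 0 < β) (y : ℝ) (hm : ∀ j ∈ Finset.Icc 1 N, c j ≠ m) :
    Tendsto (fun t => Psi u l β t (m * t + y)) atTop
      (nhds (∑ j ∈ Finset.Icc 1 N, if m < c j then sol1 l (c j) else 0)) := by
  have h := ho.tendsto_weighted hu l (w := fun t x => sigmoid (β * (x - (m * t + y))))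
    (p := fun j => if m < c j then 1 else 0)
    (fun t => continuous_sigmoid.comp (by fun_prop)) (fun t x => by
      rw [abs_of_pos (sigmoid_pos _)]; exact (sigmoid_lt_one _).le) (fun j hj z => ?_)
  · simpa [ite_mul, Psi] using h
  have e : ∀ t, β * (z + (c j * t + Δ j) - (m * t + y)) =
      β * (c j - m) * t + β * (z + Δ j - y) := fun t => by ring
  simp_rw [e]
  split_ifs with hlt
  · exact tendsto_sigmoid_atTop.comp (tendsto_atTop_add_const_right _ _
      (tendsto_id.const_mul_atTop (mul_pos hβ (sub_pos.2 hlt))))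
  · have : β * (c j - m) < 0 := mul_neg_of_pos_of_neg hβ
      (sub_neg.2 (lt_of_le_of_ne (not_lt.1 hlt) (hm j hj)))
    exact tendsto_sigmoid_atBot.comp (tendsto_atBot_add_const_right _ _
      (tendsto_id.const_mul_atTop_of_neg this))

lemma Psi_reflect (hu : IsGKdVSolution u) (l β t y : ℝ) : Psi u l β t y =
    (∫ x, (en (fun t x => u (-t) (-x)) (-t) x + l * u t (-x) ^ 2)) -
      Psi (fun t x => u (-t) (-x)) l β (-t) (-y) := by
  have i : Integrable fun x => en u t x + l * u t x ^ 2 :=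
    (en_int hu t).add ((sol_int0 hu t).const_mul l)
  have e : ∀ x, en (fun t x => u (-t) (-x)) (-t) x = en u t (-x) := fun x => by
    simp only [en, reflect_px (sol_sm hu), neg_neg]; ring
  have e2 : ∫ x, (en u t (-x) + l * u t (-x) ^ 2) = ∫ x, (en u t x + l * u t x ^ 2) :=
    integral_neg_eq_self (fun x => en u t x + l * u t x ^ 2) volume
  have e3 : ∫ x, (en u t (-x) + l * u t (-x) ^ 2) * sigmoid (β * (x - -y)) =
      ∫ x, (en u t x + l * u t x ^ 2) * sigmoid (β * (-x - -y)) := by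
    rw [← integral_neg_eq_self _ volume]
    simp only [neg_neg]
  simp only [Psi, e, neg_neg]
  have i2 : Integrable fun x => (en u t x + l * u t x ^ 2) * sigmoid (β * (-x - -y)) :=
    i.mul_bdd (c := 1) (Continuous.aestronglyMeasurable
      (continuous_sigmoid.comp (by fun_prop : Continuous fun x : ℝ => β * (-x - -y))))
      (Eventually.of_forall fun x => by
        rw [Real.norm_eq_abs, abs_of_pos (sigmoid_pos _)]; exact (sigmoid_lt_one _).le)
  rw [e2, e3, ← integral_sub i i2]
  refine integral_congr_ae (Eventually.of_forall fun x => ?_)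
  simp only
  rw [show β * (-x - -y) = -(β * (x - y)) by ring, sigmoid_neg]; ring

end GKdV

namespace GKdV
variable {u : ℝ → ℝ → ℝ} {N M : ℕ} {c Δ c' Δ' : ℕ → ℝ}

lemma integral_exp_mul_le {r : ℝ} (hr : 0 < r) (a b : ℝ) :
    ∫ t in a..b, exp (r * t) ≤ exp (r * b) / r := by
  rw [intervalIntegral.integral_comp_mul_left (fun x => exp x) hr.ne', integral_exp, smul_eq_mul,
    div_eq_inv_mul]
  refine mul_le_mul_of_nonneg_left ?_ (inv_nonneg.2 hr.le)
  linarith [exp_pos (r * a)]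

lemma exists_small_threshold {p q : ℝ} (hp : 0 ≤ p) (hq : 0 < q) :
    ∃ η : ℝ, 0 < η ∧ η ≤ 1 ∧ η ^ 6 / 3 + p * η ^ 3 ≤ q := by
  have hk : 0 < 1 / 3 + p := by linarith
  refine ⟨min 1 (q / (1 / 3 + p)), lt_min one_pos (div_pos hq hk), min_le_left _ _, ?_⟩
  set η := min 1 (q / (1 / 3 + p)) with hη
  have h0 : 0 ≤ η := (lt_min one_pos (div_pos hq hk)).le
  have h1 : η ≤ 1 := min_le_left _ _
  have h2 : η * (1 / 3 + p) ≤ q := by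
    rw [← le_div_iff₀ hk]; exact min_le_right _ _
  have h3 : η ^ 3 ≤ η := by simpa using pow_le_pow_of_le_one h0 h1 (by norm_num : 1 ≤ 3)
  have h6 : η ^ 6 ≤ η := by simpa using pow_le_pow_of_le_one h0 h1 (by norm_num : 1 ≤ 6)
  nlinarith [mul_le_mul_of_nonneg_left h3 hp]

lemma Psi_push {B m β l η w D : ℝ} (hu : IsGKdVSolution u) (hB : ∀ a b, HB u a b B)
    (hβ : 0 < β) (hm : 0 < m) (h1 : β ^ 2 ≤ l) (h2 : β ^ 4 / 3 ≤ l * (m - β ^ 2 / 4))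
    (hη : η ^ 6 / 3 + (m + 8 * l) / 5 * η ^ 3 ≤ l * (m - β ^ 2 / 4) / 2) (hw : m < w) :
    ∃ C, 0 ≤ C ∧ ∀ a b y, a ≤ b →
      (∀ t ∈ Set.Icc a b, ∀ x, w * t + D ≤ x → |u t x| ≤ η) →
      Psi u l β b y ≤ Psi u l β a (y - m * (b - a)) + C * exp (-(β * (y - w * b))) := by
  obtain ⟨C, C0, hC⟩ := Psi_mono hu hB hβ hm h1 h2 hη
  have hr : 0 < β * (w - m) := mul_pos hβ (sub_pos.2 hw)
  refine ⟨C * exp (β * D) / (β * (w - m)), by positivity, fun a b y hab hs => ?_⟩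
  have h := hC a b (y - m * b) (fun t => (m - w) * t + (y - m * b) - D) hab (by fun_prop)
    fun t ht x hx => hs t ht x (by rw [abs_lt] at hx; linarith)
  have e1 : m * b + (y - m * b) = y := by ring
  have e2 : m * a + (y - m * b) = y - m * (b - a) := by ring
  rw [e1, e2] at h
  refine h.trans (add_le_add le_rfl ?_)
  have e3 : ∀ t, C * exp (-(β * ((m - w) * t + (y - m * b) - D))) =
      C * exp (β * (D - (y - m * b))) * exp (β * (w - m) * t) := fun t => by
    rw [mul_assoc, ← exp_add]; ring_nf
  simp_rw [e3]
  rw [intervalIntegral.integral_const_mul]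
  refine (mul_le_mul_of_nonneg_left (integral_exp_mul_le hr a b) (by positivity)).trans_eq ?_
  have e4 : exp (-(β * (y - w * b))) * exp (β * D) =
      exp (β * (D - (y - m * b))) * exp (β * (w - m) * b) := by
    rw [← exp_add, ← exp_add]; ring_nf
  rw [mul_div_assoc', mul_assoc, ← e4]; ring

lemma half_hden_le {A l t x : ℝ} (h : |u t x| ≤ A) (hl : A ^ 3 + 1 ≤ l) :
    1 / 2 * hden u t x ≤ en u t x + l * u t x ^ 2 := by
  have A0 : 0 ≤ A := (abs_nonneg _).trans h
  have h1 := (le_abs_self _).trans (abs_pow5_le h)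
  have h2 := mul_le_mul_of_nonneg_right hl (sq_nonneg (u t x))
  have h3 : 0 ≤ A ^ 3 * u t x ^ 2 := by positivity
  unfold hden en
  nlinarith [sq_nonneg (u t x)]

lemma sq_le_Psi {B l β : ℝ} (hu : IsGKdVSolution u) (hB : ∀ a b, HB u a b B) (hβ : 0 < β)
    (hl : (1 + B) ^ 3 + 1 ≤ l) (t y : ℝ) : u t y ^ 2 ≤ 4 * Psi u l β t y := by
  have s := sol_sm hu
  have h := sq_le_H1_Ioi (f := u t) (f' := px u t) (s.hasDerivAt_x t) (s.px.cont_x t) (sol_int0 hu t)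
    (sol_int1 hu t) y
  refine h.trans ?_
  have le : ∀ x, 1 / 2 * hden u t x ≤ en u t x + l * u t x ^ 2 := fun x =>
    half_hden_le ((hB t t).ptw hu ⟨le_rfl, le_rfl⟩ x) hl
  have i : Integrable fun x => (en u t x + l * u t x ^ 2) * sigmoid (β * (x - y)) :=
    ((en_int hu t).add ((sol_int0 hu t).const_mul l)).mul_bdd (c := 1)
      (Continuous.aestronglyMeasurable (continuous_sigmoid.comp
        (by fun_prop : Continuous fun x : ℝ => β * (x - y))))
      (Eventually.of_forall fun x => by
        rw [Real.norm_eq_abs, abs_of_pos (sigmoid_pos _)]; exact (sigmoid_lt_one _).le)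
  have nn : ∀ x, 0 ≤ (en u t x + l * u t x ^ 2) * sigmoid (β * (x - y)) := fun x =>
    mul_nonneg (le_trans (by linarith [hden_nonneg (u := u) t x]) (le x)) (sigmoid_pos _).le
  have h1 : ∫ x in Set.Ioi y, (en u t x + l * u t x ^ 2) * sigmoid (β * (x - y)) ≤ Psi u l β t y :=
    setIntegral_le_integral i (Eventually.of_forall nn)
  have h2 : ∫ x in Set.Ioi y, (u t x ^ 2 + px u t x ^ 2) ≤
      ∫ x in Set.Ioi y, 4 * ((en u t x + l * u t x ^ 2) * sigmoid (β * (x - y))) := by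
    refine setIntegral_mono_on (hden_int hu t).integrableOn (i.const_mul 4).integrableOn
      measurableSet_Ioi fun x hx => ?_
    have h3 : 1 / 2 ≤ sigmoid (β * (x - y)) := by
      rw [show (1 / 2 : ℝ) = sigmoid 0 by rw [sigmoid_zero]; norm_num]
      exact sigmoid_monotone (mul_nonneg hβ.le (sub_nonneg.2 (le_of_lt hx)))
    have h4 := le x
    have h5 := hden_nonneg (u := u) t x
    have h6 := mul_le_mul_of_nonneg_left h3 (by linarith : 0 ≤ en u t x + l * u t x ^ 2)
    unfold hden at h4 h5
    linarith
  rw [integral_const_mul] at h2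
  linarith

set_option maxHeartbeats 1600000 in
/-- Exponential decay on the right of all solitons, with rate governed by the slowest speeds. -/
lemma right_tail (hu : IsGKdVSolution u) (ho : Out u N c Δ)
    (hi : Out (fun t x => u (-t) (-x)) M c' Δ') {m β v V : ℝ} (hβ : 0 < β) (hβm : β ^ 2 / 4 < m)
    (hv : m < v) (hvc : ∀ j ∈ Finset.Icc 1 M, v ≤ c' j) (hV : m < V)
    (hVc : ∀ j ∈ Finset.Icc 1 N, c j ≤ V) :
    ∃ C, 0 < C ∧ ∀ t y, |u t y| ≤ C * exp (-(β / 2 * (y - V * max t 0))) := by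
  obtain ⟨B, B0, hB⟩ := exists_HB hu
  have hm : 0 < m := lt_of_le_of_lt (by positivity) hβm
  have hκ : 0 < m - β ^ 2 / 4 := sub_pos.2 hβm
  set A := 1 + B with hA
  set l := A ^ 3 + 1 + β ^ 2 + β ^ 4 / 3 / (m - β ^ 2 / 4) with hl
  have d0 : 0 ≤ β ^ 4 / 3 / (m - β ^ 2 / 4) := by positivity
  have A30 : 0 ≤ A ^ 3 := by positivity
  have l1 : β ^ 2 ≤ l := by linarith
  have l2 : β ^ 4 / 3 ≤ l * (m - β ^ 2 / 4) := by
    rw [← div_le_iff₀ hκ]; nlinarith [sq_nonneg β]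
  have l3 : A ^ 3 + 1 ≤ l := by nlinarith [sq_nonneg β]
  have l0 : 0 < l := by linarith
  obtain ⟨η, η0, -, hη⟩ := exists_small_threshold (p := (m + 8 * l) / 5)
    (q := l * (m - β ^ 2 / 4) / 2) (by positivity) (by positivity)
  set D0 : ℝ := ∑ j ∈ Finset.Icc 1 N, |Δ j| with hD0
  set D0' : ℝ := ∑ j ∈ Finset.Icc 1 M, |Δ' j| with hD0'
  obtain ⟨L, L0, hL⟩ := ho.small hu η0
  obtain ⟨L', L0', hL'⟩ := hi.small (reflect_sol hu) η0
  obtain ⟨T, hT⟩ := eventually_atTop.1 (hL.and (hL'.and (eventually_ge_atTop 0)))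
  have T0 : 0 ≤ T := (hT T le_rfl).2.2
  -- smallness to the right, late times
  have sm3 : ∀ t, T ≤ t → ∀ x, V * t + (D0 + L) ≤ x → |u t x| ≤ η := fun t ht x hx =>
    (hT t ht).1 x fun j hj => by
      have h1 := Finset.single_le_sum (f := fun j => |Δ j|) (fun i _ => abs_nonneg _) hj
      have h2 := mul_le_mul_of_nonneg_right (hVc j hj) (T0.trans ht)
      have h3 := le_abs_self (Δ j)
      exact le_trans (by linarith) (le_abs_self _)
  have sm1 : ∀ t, t ≤ -T → ∀ x, v * t + (D0' + L') ≤ x → |u t x| ≤ η := fun t ht x hx => by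
    have := (hT (-t) (by linarith)).2.1 (-x) fun j hj => by
      have h1 := Finset.single_le_sum (f := fun j => |Δ' j|) (fun i _ => abs_nonneg _) hj
      have h2 := mul_le_mul_of_nonneg_right (hvc j hj) (by linarith : 0 ≤ -t)
      have h3 := neg_abs_le (Δ' j)
      exact le_trans (by linarith) (neg_le_abs _)
    simpa using this
  obtain ⟨C1, C10, hC1⟩ := Psi_push (D := D0' + L') hu hB hβ hm l1 l2 hη hv
  obtain ⟨C3, C30, hC3⟩ := Psi_push (D := D0 + L) hu hB hβ hm l1 l2 hη hV
  set m2 := m + 2 * (A ^ 6 / 3 + 8 * l / 5 * A ^ 3 + l * (β ^ 2 / 8)) with hm2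
  have m2m : m ≤ m2 := by
    have : 0 ≤ A ^ 6 / 3 + 8 * l / 5 * A ^ 3 + l * (β ^ 2 / 8) := by positivity
    linarith
  have hη2 : A ^ 6 / 3 + (m2 + 8 * l) / 5 * A ^ 3 ≤ l * (m2 - β ^ 2 / 4) / 2 := by
    have h1 : m2 / 2 ≤ (l / 2 - A ^ 3 / 5) * m2 :=
      (by linarith : m2 / 2 = 1 / 2 * m2).trans_le
        (mul_le_mul_of_nonneg_right (by linarith) (hm.le.trans m2m))
    nlinarith
  obtain ⟨C2, C20, hC2⟩ := Psi_mono hu hB hβ (hm.trans_le m2m) l1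
    (l2.trans (mul_le_mul_of_nonneg_left (by linarith) l0.le)) hη2
  have stage1 : ∀ t, t ≤ -T → ∀ y, Psi u l β t y ≤ C1 * exp (-(β * y)) := fun t ht y => by
    have key : ∀ a, a ≤ t → Psi u l β t y - C1 * exp (-(β * (y - v * t))) ≤
        Psi u l β a (m * a + (y - m * t)) := fun a ha => by
      have := hC1 a t y ha fun r hr x hx => sm1 r (hr.2.trans ht) x hx
      rw [show y - m * (t - a) = m * a + (y - m * t) by ring] at this
      linarith
    have lim : Tendsto (fun a => Psi u l β a (m * a + (y - m * t))) atBot (nhds 0) := by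
      have h1 := hi.tendsto_Psi (reflect_sol hu) l hβ (m := m) (-(y - m * t))
        fun j hj => by linarith [hvc j hj]
      have h2 := (tendsto_const_nhds (x := ∑ j ∈ Finset.Icc 1 M, sol1 l (c' j))).sub
        (h1.comp tendsto_neg_atBot_atTop)
      have h3 : ∑ j ∈ Finset.Icc 1 M, (if m < c' j then sol1 l (c' j) else 0) =
          ∑ j ∈ Finset.Icc 1 M, sol1 l (c' j) := Finset.sum_congr rfl fun j hj => by
        rw [if_pos (by linarith [hvc j hj])]
      rw [h3, sub_self] at h2
      refine h2.congr fun a => ?_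
      have h4 := hi.total (reflect_sol hu) l (-a)
      simp only [neg_neg] at h4
      rw [Psi_reflect hu l β a, h4]
      simp only [Function.comp]
      congr 2
      ring
    have h0 := ge_of_tendsto lim ((eventually_le_atBot t).mono fun a ha => key a ha)
    have h1 : exp (-(β * (y - v * t))) ≤ exp (-(β * y)) := exp_le_exp.2 (by
      have := mul_nonpos_of_nonneg_of_nonpos hβ.le
        (mul_nonpos_of_nonneg_of_nonpos (by linarith : 0 ≤ v) (by linarith : t ≤ 0))
      linarith)
    linarith [mul_le_mul_of_nonneg_left h1 C10]
  set K2 := C1 * exp (β * (m2 * (2 * T))) + C2 * (2 * T) with hK2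
  have K20 : 0 ≤ K2 := by positivity
  have stage2 : ∀ t, -T ≤ t → t ≤ T → ∀ y, Psi u l β t y ≤ K2 * exp (-(β * y)) := fun t h1 h2 y => by
    have h := hC2 (-T) t (y - m2 * t) (fun _ => y) h1 continuous_const
      fun r _ x _ => (hB r r).ptw hu ⟨le_rfl, le_rfl⟩ x
    rw [show m2 * t + (y - m2 * t) = y by ring, intervalIntegral.integral_const, smul_eq_mul] at h
    have h3 := stage1 (-T) le_rfl (m2 * -T + (y - m2 * t))
    have h4 : exp (-(β * (m2 * -T + (y - m2 * t)))) ≤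
        exp (β * (m2 * (2 * T))) * exp (-(β * y)) := by
      rw [← exp_add, exp_le_exp]
      have := mul_nonneg hβ.le (mul_nonneg (hm.le.trans m2m) (by linarith : 0 ≤ T - t))
      linarith
    have h5 := mul_le_mul_of_nonneg_left h4 C10
    have h6 : (t - -T) * (C2 * exp (-(β * y))) ≤ 2 * T * (C2 * exp (-(β * y))) :=
      mul_le_mul_of_nonneg_right (by linarith) (by positivity)
    rw [hK2]
    linarith
  set K3 := K2 + C3 with hK3
  have stage3 : ∀ t, T ≤ t → ∀ y, Psi u l β t y ≤ K3 * exp (-(β * (y - V * t))) := fun t ht y => by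
    have h := hC3 T t y ht fun r hr x hx => sm3 r hr.1 x hx
    have h1 := stage2 T (by linarith) le_rfl (y - m * (t - T))
    have h2 : exp (-(β * (y - m * (t - T)))) ≤ exp (-(β * (y - V * t))) := exp_le_exp.2 (by
      have h3 : m * (t - T) ≤ V * t := mul_le_mul hV.le (by linarith) (by linarith) (by linarith)
      linarith [mul_le_mul_of_nonneg_left h3 hβ.le])
    have h3 := mul_le_mul_of_nonneg_left h2 K20
    rw [hK3]; linarith
  have all : ∀ t y, Psi u l β t y ≤ (C1 + K3) * exp (-(β * (y - V * max t 0))) := fun t y => by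
    have hmono : ∀ t, exp (-(β * y)) ≤ exp (-(β * (y - V * max t 0))) := fun t => exp_le_exp.2 (by
      have : 0 ≤ β * (V * max t 0) := mul_nonneg hβ.le (mul_nonneg (by linarith) (le_max_right _ _))
      linarith)
    have hp := exp_pos (-(β * (y - V * max t 0)))
    rcases le_total t (-T) with h | h
    · have h1 := stage1 t h y
      have h2 := mul_le_mul_of_nonneg_left (hmono t) C10
      have h3 : 0 ≤ K3 * exp (-(β * (y - V * max t 0))) := by positivity
      linarith
    · rcases le_total t T with h' | h'
      · have h1 := stage2 t h h' y
        have h2 := mul_le_mul_of_nonneg_left (hmono t) K20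
        have h3 : 0 ≤ (C1 + C3) * exp (-(β * (y - V * max t 0))) := by positivity
        rw [hK3]; linarith
      · have h1 := stage3 t h' y
        rw [max_eq_left (T0.trans h')] at hp ⊢
        linarith [mul_nonneg C10 hp.le]
  refine ⟨1 + 4 * (C1 + K3), by positivity, fun t y => ?_⟩
  refine abs_le_of_sq_le_sq ?_ (by positivity)
  have h1 := sq_le_Psi hu hB hβ l3 t y
  have h2 := all t y
  have h3 : (exp (-(β / 2 * (y - V * max t 0)))) ^ 2 = exp (-(β * (y - V * max t 0))) := by
    rw [← exp_nat_mul]; congr 1; push_cast; ring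
  rw [mul_pow, h3]
  have h4 : 4 * (C1 + K3) ≤ (1 + 4 * (C1 + K3)) ^ 2 := by
    have : 0 ≤ C1 + K3 := by positivity
    nlinarith only [this]
  have h5 := mul_le_mul_of_nonneg_right h4 (exp_pos (-(β * (y - V * max t 0)))).le
  linarith

end GKdV

namespace GKdV

/-- The Bogomolny density attached to the amplitude `y`. -/
noncomputable def bog (y s : ℝ) : ℝ := √(2 / 5) * |s| * √(y ^ 3 - s ^ 3)

lemma continuous_bog (y : ℝ) : Continuous (bog y) := by unfold bog; fun_prop

lemma bog_nonneg (y s : ℝ) : 0 ≤ bog y s := by unfold bog; positivity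

lemma bog_sq {y s : ℝ} (h : s ≤ y) : bog y s ^ 2 = 2 / 5 * s ^ 2 * (y ^ 3 - s ^ 3) := by
  have h1 : s ^ 3 ≤ y ^ 3 := by
    have := (Odd.pow_le_pow (n := 3) (by decide)).2 h
    exact this
  unfold bog
  rw [mul_pow, mul_pow, Real.sq_sqrt (by norm_num), Real.sq_sqrt (by linarith), _root_.sq_abs]

noncomputable def bogInt (y s : ℝ) : ℝ := ∫ z in (0 : ℝ)..s, bog y z

lemma hasDerivAt_bogInt (y s : ℝ) : HasDerivAt (bogInt y) (bog y s) s :=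
  intervalIntegral.integral_hasDerivAt_right ((continuous_bog y).intervalIntegrable _ _)
    (continuous_bog y).aestronglyMeasurable.stronglyMeasurableAtFilter
    (continuous_bog y).continuousAt

lemma bogInt_le {c y s : ℝ} (hc : 0 < c) (hy : y ^ 3 = 5 / 2 * c) :
    bogInt y s ≤ √c / 2 * s ^ 2 := by
  unfold bogInt
  rcases le_total 0 s with h | h
  · have h1 : ∀ z ∈ Set.Icc 0 s, bog y z ≤ √c * z := fun z hz => by
      unfold bog
      rw [abs_of_nonneg hz.1, hy]
      have h2 : √(5 / 2 * c - z ^ 3) ≤ √(5 / 2 * c) :=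
        Real.sqrt_le_sqrt (by have := pow_nonneg hz.1 3; linarith)
      have h3 : √(2 / 5) * √(5 / 2 * c) = √c := by
        rw [← Real.sqrt_mul (by norm_num)]; congr 1; ring
      calc _ ≤ √(2 / 5) * z * √(5 / 2 * c) :=
            mul_le_mul_of_nonneg_left h2 (mul_nonneg (Real.sqrt_nonneg _) hz.1)
        _ = _ := by rw [← h3]; ring
    have h2 := intervalIntegral.integral_mono_on h ((continuous_bog y).intervalIntegrable _ _)
      ((by fun_prop : Continuous fun z => √c * z).intervalIntegrable (μ := volume) _ _) h1
    refine h2.trans (le_of_eq ?_)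
    rw [intervalIntegral.integral_const_mul, integral_id]; ring
  · rw [intervalIntegral.integral_symm]
    have := intervalIntegral.integral_nonneg (μ := volume) h (fun z _ => bog_nonneg y z)
    have : 0 ≤ √c / 2 * s ^ 2 := by positivity
    linarith

lemma bog_step {f f' : ℝ → ℝ} (hf : ∀ x, HasDerivAt f (f' x) x) (hc' : Continuous f')
    {c y p q : ℝ} (hy : y ^ 3 = 5 / 2 * c) (hpq : p ≤ q) (hle : ∀ x ∈ Set.Icc p q, f x ≤ y) :
    |bogInt y (f q) - bogInt y (f p)| ≤
      ∫ x in p..q, (1 / 2 * f' x ^ 2 - 1 / 5 * f x ^ 5 + c / 2 * f x ^ 2) := by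
  have cf : Continuous f := continuous_iff_continuousAt.2 fun x => (hf x).continuousAt
  have cb : Continuous fun x => bog y (f x) * f' x := ((continuous_bog y).comp cf).mul hc'
  have h1 : ∫ x in p..q, bog y (f x) * f' x = bogInt y (f q) - bogInt y (f p) :=
    intervalIntegral.integral_eq_sub_of_hasDerivAt
      (fun x _ => (hasDerivAt_bogInt y (f x)).comp x (hf x)) (cb.intervalIntegrable _ _)
  rw [← h1]
  refine (intervalIntegral.abs_integral_le_integral_abs hpq).trans
    (intervalIntegral.integral_mono_on hpq (cb.abs.intervalIntegrable _ _)
      (Continuous.intervalIntegrable (by fun_prop) _ _) fun x hx => ?_)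
  have h2 := bog_sq (hle x hx)
  rw [hy] at h2
  rw [abs_le]
  constructor
  · linarith [sq_nonneg (bog y (f x) + f' x)]
  · linarith [sq_nonneg (bog y (f x) - f' x)]

lemma Qc_zero_cube {c : ℝ} (hc : 0 < c) : Qc c 0 ^ 3 = 5 / 2 * c := by
  have h := Qc1_sq hc 0
  have h1 : Qc1 c 0 = 0 := by
    have := (hasDerivAt_Qc hc 0)
    have h2 := (hasDerivAt_Qc hc (-0)).scomp (0:ℝ) (hasDerivAt_neg (0:ℝ))
    have h3 : (Qc c ∘ Neg.neg) = Qc c := by funext x; simp [Qc_neg]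
    rw [h3] at h2
    have := this.unique h2
    simp at this; linarith
  rw [h1] at h
  have := Qc_pos hc 0
  have h4 : Qc c 0 ^ 2 * (c - 2 / 5 * Qc c 0 ^ 3) = 0 := by linarith
  rcases mul_eq_zero.1 h4 with h5 | h5
  · exact absurd h5 (by positivity)
  · linarith

end GKdV

namespace GKdV

lemma Qc_le_zero {c : ℝ} (hc : 0 < c) (x : ℝ) : Qc c x ≤ Qc c 0 := by
  have h := Qc1_sq hc x
  have p := Qc_pos hc x
  have h1 : 0 ≤ Qc c x ^ 2 * (c - 2 / 5 * Qc c x ^ 3) := by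
    linarith [sq_nonneg (Qc1 c x)]
  have h2 := nonneg_of_mul_nonneg_right h1 (by positivity)
  refine le_of_pow_le_pow_left₀ (n := 3) (by norm_num) (Qc_pos hc 0).le ?_
  rw [Qc_zero_cube hc]; linarith

lemma bog_Qc {c : ℝ} (hc : 0 < c) (x : ℝ) : bog (Qc c 0) (Qc c x) = |Qc1 c x| := by
  rw [← abs_of_nonneg (bog_nonneg _ _), ← sq_eq_sq_iff_abs_eq_abs, bog_sq (Qc_le_zero hc x), Qc1_sq hc,
    Qc_zero_cube hc]
  ring

lemma mul_Qc1_nonpos {c : ℝ} (hc : 0 < c) (x : ℝ) : x * Qc1 c x ≤ 0 := by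
  have h : 0 ≤ x * tanh (3 * (rt c ^ 3 * x) / 2) := by
    have := rt_pos hc
    rw [tanh_eq_sinh_div_cosh, mul_div_assoc']
    refine div_nonneg ?_ (cosh_pos _).le
    rcases le_total 0 x with h | h
    · exact mul_nonneg h (sinh_nonneg_iff.2 (by positivity))
    · refine mul_nonneg_of_nonpos_of_nonpos h (sinh_nonpos_iff.2 ?_)
      have := mul_nonpos_of_nonneg_of_nonpos (pow_pos this 3).le h
      linarith
  have h2 : x * Qc1 c x = -(rt c ^ 5 * Q (rt c ^ 3 * x) * (x * tanh (3 * (rt c ^ 3 * x) / 2))) := by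
    unfold Qc1 Q1; ring
  have := rt_pos hc
  have := Q_pos (rt c ^ 3 * x)
  rw [h2, neg_nonpos]
  positivity

lemma le_two_bogInt {c : ℝ} (hc : 0 < c) :
    3 / 7 * qmass * rt c ^ 7 ≤ 2 * bogInt (Qc c 0) (Qc c 0) := by
  have lim := intervalIntegral_tendsto_integral (integrable_Qc1_sq hc) tendsto_neg_atTop_atBot
    tendsto_id
  rw [integral_Qc1_sq hc] at lim
  refine le_of_tendsto lim ((eventually_ge_atTop 0).mono fun R hR => ?_)
  have cb : Continuous fun x => bog (Qc c 0) (Qc c x) * Qc1 c x :=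
    ((continuous_bog _).comp (continuous_Qc hc)).mul continuous_Qc1
  have ftc : ∀ p q, ∫ x in p..q, bog (Qc c 0) (Qc c x) * Qc1 c x =
      bogInt (Qc c 0) (Qc c q) - bogInt (Qc c 0) (Qc c p) := fun p q =>
    intervalIntegral.integral_eq_sub_of_hasDerivAt
      (fun x _ => (hasDerivAt_bogInt _ (Qc c x)).comp x (hasDerivAt_Qc hc x))
      (cb.intervalIntegrable _ _)
  have cq : Continuous fun x => Qc1 c x ^ 2 := continuous_Qc1.pow 2
  have nn : ∀ x, 0 ≤ bogInt (Qc c 0) (Qc c x) := fun x =>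
    intervalIntegral.integral_nonneg (Qc_pos hc x).le fun z _ => bog_nonneg _ z
  have h1 : ∫ x in (-R)..0, Qc1 c x ^ 2 = ∫ x in (-R)..0, bog (Qc c 0) (Qc c x) * Qc1 c x := by
    refine intervalIntegral.integral_congr_ae (Eventually.of_forall fun x hx => ?_)
    rw [Set.uIoc_of_le (by linarith)] at hx
    rw [bog_Qc hc]
    rcases eq_or_lt_of_le hx.2 with h | h
    · rw [← _root_.sq_abs]
      have : Qc1 c x = 0 := by subst h; simp [Qc1, Q1]
      simp [this]
    · have := mul_Qc1_nonpos hc x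
      rw [abs_of_nonneg (by nlinarith)]; ring
  have h2 : ∫ x in (0:ℝ)..R, Qc1 c x ^ 2 = ∫ x in (0:ℝ)..R, -(bog (Qc c 0) (Qc c x) * Qc1 c x) := by
    refine intervalIntegral.integral_congr_ae (Eventually.of_forall fun x hx => ?_)
    rw [Set.uIoc_of_le hR] at hx
    have := mul_Qc1_nonpos hc x
    have h3 : Qc1 c x ≤ 0 := by
      by_contra! h; nlinarith [hx.1, mul_pos hx.1 h]
    rw [bog_Qc hc, abs_of_nonpos h3]; ring
  rw [intervalIntegral.integral_neg] at h2
  simp only [id]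
  rw [← intervalIntegral.integral_add_adjacent_intervals (cq.intervalIntegrable (-R) 0)
    (cq.intervalIntegrable 0 R), h1, h2, ftc, ftc]
  linarith [nn (-R), nn R]

/-- Sharp lower bound of the energy on an interval in terms of the mass, up to boundary terms. -/
lemma window_energy {f f' : ℝ → ℝ} (hf : ∀ x, HasDerivAt f (f' x) x) (hc' : Continuous f')
    {A p q : ℝ} (hpq : p ≤ q) (hA : ∀ x, |f x| ≤ A) :
    -(qmass / 14) * ((∫ x in p..q, f x ^ 2) / qmass) ^ 7 - (1 + A ^ 3) * (f p ^ 2 + f q ^ 2) ≤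
      ∫ x in p..q, (1 / 2 * f' x ^ 2 - 1 / 5 * f x ^ 5) := by
  have cf : Continuous f := continuous_iff_continuousAt.2 fun x => (hf x).continuousAt
  have m0 := qmass_pos
  have A0 : 0 ≤ A := (abs_nonneg _).trans (hA 0)
  have i0 : 0 ≤ ∫ x in p..q, f x ^ 2 := intervalIntegral.integral_nonneg hpq fun x _ => sq_nonneg _
  obtain ⟨z, hz, hmax⟩ := isCompact_Icc.exists_isMaxOn (Set.nonempty_Icc.2 hpq) cf.continuousOn
  have hle : ∀ x ∈ Set.Icc p q, f x ≤ f z := fun x hx => hmax hx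
  set b := (∫ x in p..q, f x ^ 2) / qmass with hb
  have b0 : 0 ≤ b := by positivity
  rcases le_or_gt (f z) 0 with h | h
  · have : 0 ≤ ∫ x in p..q, (1 / 2 * f' x ^ 2 - 1 / 5 * f x ^ 5) :=
      intervalIntegral.integral_nonneg hpq fun x hx => by
        have h1 : f x ^ 5 ≤ 0 := by
          have := (Odd.pow_nonpos_iff (n := 5) (by decide) (a := f x)).2 ((hle x hx).trans h)
          exact this
        have := sq_nonneg (f' x)
        linarith
    have h2 : 0 ≤ qmass / 14 * b ^ 7 := by positivity
    have h3 : 0 ≤ (1 + A ^ 3) * (f p ^ 2 + f q ^ 2) := by positivity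
    linarith
  · set c := 2 / 5 * f z ^ 3 with hc
    have c0 : 0 < c := by positivity
    have hy : f z ^ 3 = 5 / 2 * c := by rw [hc]; ring
    have hy' : f z = Qc c 0 := by
      have := hy.trans (Qc_zero_cube c0).symm
      exact (pow_left_inj₀ h.le (Qc_pos c0 0).le (by norm_num)).1 this
    have s1 := bog_step hf hc' hy hz.1 fun x hx => hle x ⟨hx.1, hx.2.trans hz.2⟩
    have s2 := bog_step hf hc' hy hz.2 fun x hx => hle x ⟨hz.1.trans hx.1, hx.2⟩
    have cg : Continuous fun x => 1 / 2 * f' x ^ 2 - 1 / 5 * f x ^ 5 := by fun_prop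
    have cg2 : Continuous fun x => c / 2 * f x ^ 2 := by fun_prop
    have s3 := intervalIntegral.integral_add_adjacent_intervals (μ := volume)
      ((cg.add cg2).intervalIntegrable p z) ((cg.add cg2).intervalIntegrable z q)
    have s4 := intervalIntegral.integral_add (μ := volume)
      (cg.intervalIntegrable p q) (cg2.intervalIntegrable p q)
    rw [intervalIntegral.integral_const_mul] at s4
    have s5 := le_two_bogInt c0
    rw [← hy'] at s5
    have s6 := bogInt_le (s := f p) c0 hy
    have s7 := bogInt_le (s := f q) c0 hy
    have s8 := le_abs_self (bogInt (f z) (f z) - bogInt (f z) (f p))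
    have s9 := neg_abs_le (bogInt (f z) (f q) - bogInt (f z) (f z))
    have r0 := rt_pos c0
    have hsq : √c / 2 ≤ 1 + A ^ 3 := by
      have h1 : c ≤ A ^ 3 := by
        have := pow_le_pow_left₀ h.le ((le_abs_self _).trans (hA z)) 3
        have := pow_nonneg A0 3
        linarith
      have h2 := Real.sq_sqrt c0.le
      nlinarith [sq_nonneg (√c - 1)]
    have s10 := mul_le_mul_of_nonneg_right hsq (by positivity : 0 ≤ f p ^ 2 + f q ^ 2)
    have hM : ∫ x in p..q, f x ^ 2 = qmass * b := by rw [hb]; field_simp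
    rw [hM] at s4
    have key : 0 ≤ 6 * rt c ^ 7 - 7 * rt c ^ 6 * b + b ^ 7 := by
      have : 6 * rt c ^ 7 - 7 * rt c ^ 6 * b + b ^ 7 = (b - rt c) ^ 2 *
        (b ^ 5 + 2 * b ^ 4 * rt c + 3 * b ^ 3 * rt c ^ 2 + 4 * b ^ 2 * rt c ^ 3 +
          5 * b * rt c ^ 4 + 6 * rt c ^ 5) := by ring
      rw [this]; positivity
    rw [rt_pow c0] at key
    have key2 := mul_nonneg (by positivity : 0 ≤ qmass / 14) key
    simp only [Pi.add_apply] at s3 s4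
    linarith

end GKdV

namespace GKdV

/-- Energy plus `l` times mass of a soliton of size `b` (speed `b ^ 6`). -/
noncomputable def solv (l b : ℝ) : ℝ := -(qmass / 14) * b ^ 7 + l * (qmass * b)

lemma sol1_eq (l c : ℝ) : sol1 l c = solv l (rt c) := rfl

lemma pow_seven_sub {a b : ℝ} :
    b ^ 7 - a ^ 7 = (b - a) * (b ^ 6 + b ^ 5 * a + b ^ 4 * a ^ 2 + b ^ 3 * a ^ 3 + b ^ 2 * a ^ 4 +
      b * a ^ 5 + a ^ 6) := by ring

lemma pow_seven_quot_le {a b R : ℝ} (a0 : 0 ≤ a) (b0 : 0 ≤ b) (ha : a ≤ R) (hb : b ≤ R) :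
    b ^ 6 + b ^ 5 * a + b ^ 4 * a ^ 2 + b ^ 3 * a ^ 3 + b ^ 2 * a ^ 4 + b * a ^ 5 + a ^ 6 ≤
      7 * R ^ 6 := by
  have R0 := a0.trans ha
  have h : b ^ 6 + b ^ 5 * a + b ^ 4 * a ^ 2 + b ^ 3 * a ^ 3 + b ^ 2 * a ^ 4 + b * a ^ 5 + a ^ 6 ≤
      R ^ 6 + R ^ 5 * R + R ^ 4 * R ^ 2 + R ^ 3 * R ^ 3 + R ^ 2 * R ^ 4 + R * R ^ 5 + R ^ 6 := by
    gcongr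
  linarith [h]

lemma solv_lip {a b R l : ℝ} (a0 : 0 ≤ a) (b0 : 0 ≤ b) (ha : a ≤ R) (hb : b ≤ R) (l0 : 0 ≤ l) :
    |solv l b - solv l a| ≤ qmass * (R ^ 6 / 2 + l) * |b - a| := by
  have m0 := qmass_pos
  have h := pow_seven_quot_le a0 b0 ha hb
  set P := b ^ 6 + b ^ 5 * a + b ^ 4 * a ^ 2 + b ^ 3 * a ^ 3 + b ^ 2 * a ^ 4 + b * a ^ 5 + a ^ 6
  have P0 : 0 ≤ P := by positivity
  have e : solv l b - solv l a = qmass * (l - P / 14) * (b - a) := by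
    have := pow_seven_sub (a := a) (b := b)
    unfold solv
    linear_combination -(qmass / 14) * this
  rw [e, abs_mul, abs_mul, abs_of_pos m0]
  refine mul_le_mul_of_nonneg_right (mul_le_mul_of_nonneg_left ?_ m0.le) (abs_nonneg _)
  rw [abs_le]; constructor <;> linarith

lemma solv_pin {α R : ℝ} (hα : 0 < α) : ∃ K, 0 ≤ K ∧ ∀ a b δ, α ≤ a → 0 ≤ b → a ≤ R → b ≤ R →
    0 ≤ δ → solv (α ^ 6 / 28) b ≤ solv (α ^ 6 / 28) a + δ →
    solv (R ^ 6 / 2 + 1) b ≤ solv (R ^ 6 / 2 + 1) a + δ → |b - a| ≤ K * δ := by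
  have m0 := qmass_pos
  refine ⟨28 / (qmass * α ^ 6) + 1 / qmass, by positivity, fun a b δ h1 h2 h3 h4 h5 h6 h7 => ?_⟩
  have a0 : 0 < a := hα.trans_le h1
  rw [add_mul]
  rcases le_total b a with h | h
  · have e1 : qmass * α ^ 6 * (a - b) ≤ 28 * δ := by
      have g1 : b ^ 7 ≤ a ^ 6 * b := by
        have := mul_le_mul_of_nonneg_right (pow_le_pow_left₀ h2 h 6) h2
        calc b ^ 7 = b ^ 6 * b := by ring
          _ ≤ _ := this
      have g2 := mul_le_mul_of_nonneg_right (pow_le_pow_left₀ hα.le h1 6) (sub_nonneg.2 h)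
      unfold solv at h6
      have g3 : a ^ 7 - b ^ 7 ≥ α ^ 6 * (a - b) := by
        have : a ^ 7 = a ^ 6 * a := by ring
        linarith
      have g4 := mul_le_mul_of_nonneg_left g3.le m0.le
      linarith
    have e2 : a - b ≤ 28 / (qmass * α ^ 6) * δ := by
      rw [div_mul_eq_mul_div, le_div_iff₀ (by positivity)]; linarith
    have e3 : 0 ≤ 1 / qmass * δ := by positivity
    rw [abs_of_nonpos (by linarith)]; linarith
  · have e1 : qmass * (b - a) ≤ δ := by
      have g1 := pow_seven_quot_le a0.le h2 h3 h4
      have g2 := mul_le_mul_of_nonneg_left g1 (sub_nonneg.2 h)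
      rw [← pow_seven_sub] at g2
      have g3 := mul_le_mul_of_nonneg_left g2 m0.le
      unfold solv at h7
      linarith
    have e2 : b - a ≤ 1 / qmass * δ := by
      rw [div_mul_eq_mul_div, le_div_iff₀ (by positivity)]; linarith
    have e3 : 0 ≤ 28 / (qmass * α ^ 6) * δ := by positivity
    rw [abs_of_nonneg (by linarith)]; linarith

/-- If all partial sums, at a small and a large multiplier, are bounded by the soliton values, then
each size is close to the soliton one. -/
lemma sizes_pinned {α R : ℝ} (hα : 0 < α) (N k : ℕ) (hk : k ≤ N) :
    ∃ K, 0 ≤ K ∧ ∀ (a b : ℕ → ℝ) (δ : ℝ), 0 ≤ δ →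
      (∀ i, α ≤ a i ∧ a i ≤ R ∧ 0 ≤ b i ∧ b i ≤ R) →
      (∀ j < N, ∑ i ∈ Finset.Ioc j N, solv (α ^ 6 / 28) (b i) ≤
        (∑ i ∈ Finset.Ioc j N, solv (α ^ 6 / 28) (a i)) + δ) →
      (∀ j < N, ∑ i ∈ Finset.Ioc j N, solv (R ^ 6 / 2 + 1) (b i) ≤
        (∑ i ∈ Finset.Ioc j N, solv (R ^ 6 / 2 + 1) (a i)) + δ) →
      ∀ i ∈ Finset.Ioc (N - k) N, |b i - a i| ≤ K * δ := by
  have m0 := qmass_pos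
  induction k with
  | zero => exact ⟨0, le_rfl, fun a b δ _ _ _ _ i hi => by simp at hi⟩
  | succ k ih =>
    obtain ⟨K, K0, hK⟩ := ih (by omega)
    obtain ⟨K1, K10, hK1⟩ := solv_pin (R := R) hα
    have R0 : 0 ≤ R ^ 6 := by positivity
    set P := qmass * (R ^ 6 / 2 + (α ^ 6 / 28 + (R ^ 6 / 2 + 1))) with hP
    have P0 : 0 ≤ P := by positivity
    refine ⟨K + K1 * (1 + N * (P * K)), by positivity, fun a b δ δ0 hab h1 h2 i hi => ?_⟩
    have old := hK a b δ δ0 hab h1 h2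
    have hKd : K * δ ≤ (K + K1 * (1 + N * (P * K))) * δ := by
      have : 0 ≤ K1 * (1 + N * (P * K)) * δ := by positivity
      linarith
    by_cases hi' : i ∈ Finset.Ioc (N - k) N
    · exact (old i hi').trans hKd
    have hiN : i = N - (k + 1) + 1 := by simp at hi hi'; omega
    have hik : N - k = i := by omega
    have step : ∀ l, 0 ≤ l → l ≤ α ^ 6 / 28 + (R ^ 6 / 2 + 1) →
        (∑ i ∈ Finset.Ioc (N - (k + 1)) N, solv l (b i) ≤
        (∑ i ∈ Finset.Ioc (N - (k + 1)) N, solv l (a i)) + δ) →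
        solv l (b i) ≤ solv l (a i) + (1 + N * (P * K)) * δ := fun l l0 l1 h => by
      have cons : ∀ g : ℕ → ℝ, ∑ r ∈ Finset.Ioc (N - (k + 1)) N, g r =
          g i + ∑ r ∈ Finset.Ioc (N - k) N, g r := fun g => by
        rw [← Finset.sum_Ioc_consecutive g (m := N - (k + 1)) (n := N - k) (by omega) (by omega)]
        congr 1
        rw [show N - k = N - (k + 1) + 1 by omega, Nat.Ioc_succ_singleton, Finset.sum_singleton, hiN]
      rw [cons, cons] at h
      have h3 : ∑ r ∈ Finset.Ioc (N - k) N, solv l (a r) - ∑ r ∈ Finset.Ioc (N - k) N, solv l (b r)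
          ≤ N * (P * (K * δ)) := by
        rw [← Finset.sum_sub_distrib]
        have h4 : ∀ r ∈ Finset.Ioc (N - k) N, solv l (a r) - solv l (b r) ≤ P * (K * δ) :=
          fun r hr => by
            obtain ⟨q1, q2, q3, q4⟩ := hab r
            have q5 := solv_lip (hα.le.trans q1) q3 q2 q4 l0
            have q6 := neg_abs_le (solv l (b r) - solv l (a r))
            have q7 : qmass * (R ^ 6 / 2 + l) * |b r - a r| ≤ P * (K * δ) := by
              refine mul_le_mul ?_ (old r hr) (abs_nonneg _) P0
              exact mul_le_mul_of_nonneg_left (by linarith) m0.le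
            linarith
        refine (Finset.sum_le_card_nsmul _ _ _ h4).trans ?_
        rw [nsmul_eq_mul]
        refine mul_le_mul_of_nonneg_right ?_ (by positivity)
        simp only [Nat.card_Ioc]
        exact_mod_cast by omega
      linarith
    have A6 : 0 ≤ α ^ 6 / 28 := by positivity
    have s1 := step _ A6 (by linarith) (h1 _ (by omega))
    have s2 := step _ (by linarith) (by linarith) (h2 _ (by omega))
    obtain ⟨q1, q2, q3, q4⟩ := hab i
    have := hK1 (a i) (b i) _ q1 q3 q2 q4 (by positivity) s1 s2
    have : 0 ≤ K * δ := by positivity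
    linarith

/-- Splitting of a weighted integral over disjoint windows. -/
lemma window_sum {I S : Finset ℕ} (hSI : S ⊆ I) {p q : ℕ → ℝ}
    (disj : (I : Set ℕ).PairwiseDisjoint fun i => Set.Icc (p i) (q i)) {g h θ : ℝ → ℝ} {ε : ℝ}
    (ε0 : 0 ≤ ε) (ig : Integrable g) (ih : Integrable h) (itg : Integrable fun x => g x * θ x)
    (hgh : ∀ x, |g x| ≤ h x) (h1 : ∀ i ∈ S, ∀ x ∈ Set.Icc (p i) (q i), |θ x - 1| ≤ ε)
    (h2 : ∀ i ∈ I, i ∉ S → ∀ x ∈ Set.Icc (p i) (q i), |θ x| ≤ ε) :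
    ∑ i ∈ S, (∫ x in Set.Icc (p i) (q i), g x) +
      ∫ x in (⋃ i ∈ I, Set.Icc (p i) (q i))ᶜ, g x * θ x ≤ (∫ x, g x * θ x) + ε * ∫ x, h x := by
  have h0 : ∀ x, 0 ≤ h x := fun x => (abs_nonneg _).trans (hgh x)
  have meas : MeasurableSet (⋃ i ∈ I, Set.Icc (p i) (q i)) :=
    I.measurableSet_biUnion fun i _ => measurableSet_Icc
  have split : ∀ k : ℝ → ℝ, Integrable k → ∫ x, k x =
      ∑ i ∈ I, (∫ x in Set.Icc (p i) (q i), k x) + ∫ x in (⋃ i ∈ I, Set.Icc (p i) (q i))ᶜ, k x :=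
    fun k ik => by
      rw [← integral_add_compl meas ik]
      congr 1
      exact integral_biUnion_finset I (fun i _ => measurableSet_Icc) disj
        fun i _ => ik.integrableOn
  have low : ∀ i ∈ I, (if i ∈ S then ∫ x in Set.Icc (p i) (q i), g x else 0) ≤
      (∫ x in Set.Icc (p i) (q i), g x * θ x) + ε * ∫ x in Set.Icc (p i) (q i), h x := fun i hi => by
    rw [← integral_const_mul, ← integral_add itg.integrableOn (ih.const_mul ε).integrableOn]
    split_ifs with hS
    · refine setIntegral_mono_on ig.integrableOn (itg.add (ih.const_mul ε)).integrableOn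
        measurableSet_Icc fun x hx => ?_
      have e1 := mul_le_mul (hgh x) (h1 i hS x hx) (abs_nonneg _) (h0 x)
      rw [← abs_mul] at e1
      have := neg_abs_le (g x * (θ x - 1))
      linarith
    · refine setIntegral_nonneg measurableSet_Icc fun x hx => ?_
      have e1 := mul_le_mul (hgh x) (h2 i hi hS x hx) (abs_nonneg _) (h0 x)
      rw [← abs_mul] at e1
      have := neg_abs_le (g x * θ x)
      linarith
  have e1 := Finset.sum_le_sum low
  rw [← Finset.sum_filter, Finset.filter_mem_eq_inter, Finset.inter_eq_right.2 hSI,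
    Finset.sum_add_distrib, ← Finset.mul_sum] at e1
  have e2 := split _ itg
  have e3 := split _ ih
  have e4 : 0 ≤ ∫ x in (⋃ i ∈ I, Set.Icc (p i) (q i))ᶜ, h x :=
    integral_nonneg fun x => h0 x
  have e5 := mul_nonneg ε0 e4
  have e6 : ε * ∫ x, h x = ε * ∑ i ∈ I, (∫ x in Set.Icc (p i) (q i), h x) +
    ε * ∫ x in (⋃ i ∈ I, Set.Icc (p i) (q i))ᶜ, h x := by rw [e3]; ring
  linarith

/-- Mean value choice of a point where `f ^ 2` is controlled by the average of `h`. -/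
lemma exists_sq_le_avg {f h : ℝ → ℝ} (hf : Continuous f) {r L : ℝ} (hL : 0 < L)
    (ih : Integrable h) (hfh : ∀ x, f x ^ 2 ≤ h x) {s : Set ℝ} (hs : Set.Ioo r (r + L) ⊆ s) :
    ∃ z ∈ Set.Icc r (r + L), f z ^ 2 ≤ (∫ x in s, h x) / L := by
  obtain ⟨z, hz, hmin⟩ := isCompact_Icc.exists_isMinOn (Set.nonempty_Icc.2 (by linarith : r ≤ r + L))
    (hf.pow 2).continuousOn
  refine ⟨z, hz, ?_⟩
  rw [le_div_iff₀ hL]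
  have h1 : ∫ x in Set.Ioo r (r + L), f z ^ 2 ≤ ∫ x in Set.Ioo r (r + L), h x :=
    setIntegral_mono_on (integrableOn_const (by simp)) ih.integrableOn measurableSet_Ioo
      fun x hx => (hmin ⟨hx.1.le, hx.2.le⟩ : f z ^ 2 ≤ f x ^ 2).trans (hfh x)
  have h2 : ∫ x in Set.Ioo r (r + L), h x ≤ ∫ x in s, h x :=
    setIntegral_mono_set ih.integrableOn
      (Eventually.of_forall fun x => (sq_nonneg (f x)).trans (hfh x)) hs.eventuallyLE
  rw [setIntegral_const, smul_eq_mul, measureReal_def, Real.volume_Ioo,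
    ENNReal.toReal_ofReal (by linarith)] at h1
  linarith

end GKdV

namespace GKdV

/-- The points at distance more than `r` from all centres `x 1, …, x N`. -/
def far (N : ℕ) (x : ℕ → ℝ) (r : ℝ) : Set ℝ := {z | ∀ i ∈ Finset.Ioc 0 N, r < |z - x i|}

lemma exists_windows {N : ℕ} {x : ℕ → ℝ} {r L : ℝ} (hr : 0 ≤ r) (hL : 0 < L)
    (sep : ∀ i ∈ Finset.Ioc 0 N, ∀ k ∈ Finset.Ioc 0 N, i ≠ k → 2 * (r + L) < |x i - x k|)
    {f h : ℝ → ℝ} (hf : Continuous f) (ih : Integrable h) (hfh : ∀ x, f x ^ 2 ≤ h x) :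
    ∃ p q : ℕ → ℝ, ∀ i ∈ Finset.Ioc 0 N, x i - (r + L) ≤ p i ∧ p i ≤ x i - r ∧ x i + r ≤ q i ∧
      q i ≤ x i + (r + L) ∧ f (p i) ^ 2 ≤ (∫ z in far N x r, h z) / L ∧
      f (q i) ^ 2 ≤ (∫ z in far N x r, h z) / L := by
  have key : ∀ i ∈ Finset.Ioc 0 N, ∀ z, r < |z - x i| → |z - x i| < r + L → z ∈ far N x r :=
    fun i hi z h1 h2 k hk => by
      rcases eq_or_ne i k with rfl | hik
      · exact h1
      have h3 := sep i hi k hk hik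
      have h4 : |x i - x k| ≤ |z - x i| + |z - x k| := by
        have := abs_sub_le (x i) z (x k)
        rwa [abs_sub_comm (x i) z] at this
      linarith
  have hp : ∀ i, ∃ p, i ∈ Finset.Ioc 0 N → x i - (r + L) ≤ p ∧ p ≤ x i - r ∧
      f p ^ 2 ≤ (∫ z in far N x r, h z) / L := fun i => by
    by_cases hi : i ∈ Finset.Ioc 0 N
    · obtain ⟨z, hz, h1⟩ := exists_sq_le_avg hf hL (r := x i - (r + L)) ih hfh (s := far N x r)
        fun z hz => key i hi z (by rw [abs_of_neg] <;> linarith [hz.1, hz.2])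
          (by rw [abs_of_neg] <;> linarith [hz.1, hz.2])
      exact ⟨z, fun _ => ⟨hz.1, by linarith [hz.2], h1⟩⟩
    · exact ⟨0, fun h => absurd h hi⟩
  have hq : ∀ i, ∃ q, i ∈ Finset.Ioc 0 N → x i + r ≤ q ∧ q ≤ x i + (r + L) ∧
      f q ^ 2 ≤ (∫ z in far N x r, h z) / L := fun i => by
    by_cases hi : i ∈ Finset.Ioc 0 N
    · obtain ⟨z, hz, h1⟩ := exists_sq_le_avg hf hL (r := x i + r) ih hfh (s := far N x r)
        fun z hz => key i hi z (by rw [abs_of_pos] <;> linarith [hz.1, hz.2])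
          (by rw [abs_of_pos] <;> linarith [hz.1, hz.2])
      exact ⟨z, fun _ => ⟨hz.1, by linarith [hz.2], h1⟩⟩
    · exact ⟨0, fun h => absurd h hi⟩
  choose p hp using hp
  choose q hq using hq
  exact ⟨p, q, fun i hi => ⟨(hp i hi).1, (hp i hi).2.1, (hq i hi).1, (hq i hi).2.1, (hp i hi).2.2,
    (hq i hi).2.2⟩⟩

lemma gap_step {N : ℕ} {α R A B : ℝ} (hN : 0 < N) (hα : 0 < α) (hBR : B ≤ qmass * R) :
    ∃ C, 0 ≤ C ∧ ∀ (a : ℕ → ℝ) (f f' : ℝ → ℝ) (x : ℕ → ℝ) (r L ε η : ℝ) (θ : ℕ → ℝ → ℝ),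
      (∀ i, α ≤ a i ∧ a i ≤ R) → (∀ x, HasDerivAt f (f' x) x) → Continuous f' →
      (Integrable fun x => f x ^ 2 + f' x ^ 2) → ∫ x, (f x ^ 2 + f' x ^ 2) ≤ B →
      (∀ x, |f x| ≤ A) → 0 ≤ r → 0 < L → 0 ≤ ε → 0 ≤ η → η ^ 3 ≤ α ^ 6 / 28 →
      (∀ i ∈ Finset.Ioc 0 N, ∀ k ∈ Finset.Ioc 0 N, i ≠ k → 2 * (r + L) < |x i - x k|) →
      (∀ j, Continuous (θ j)) → (∀ j z, 0 ≤ θ j z ∧ θ j z ≤ 1) → (∀ z, θ 0 z = 1) →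
      (∀ j < N, ∀ i ∈ Finset.Ioc 0 N, ∀ z, |z - x i| ≤ r + L →
        (j < i → |θ j z - 1| ≤ ε) ∧ (i ≤ j → |θ j z| ≤ ε)) →
      (∀ z, (∀ i ∈ Finset.Ioc 0 N, r ≤ |z - x i|) → |f z| ≤ η) →
      (∀ j < N, ∀ l, l = α ^ 6 / 28 ∨ l = R ^ 6 / 2 + 1 →
        ∫ z, (1 / 2 * f' z ^ 2 - 1 / 5 * f z ^ 5 + l * f z ^ 2) * θ j z ≤
          (∑ i ∈ Finset.Ioc j N, solv l (a i)) + ε) →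
      ∫ z in far N x (r + L), (f z ^ 2 + f' z ^ 2) ≤
        C * (ε + (∫ z in far N x r, (f z ^ 2 + f' z ^ 2)) / L) := by
  have m0 := qmass_pos
  obtain ⟨K, K0, hK⟩ := sizes_pinned (R := R) hα N N le_rfl
  set l1 := α ^ 6 / 28 with hl1
  set l2 := R ^ 6 / 2 + 1 with hl2
  have l10 : 0 < l1 := by positivity
  have l20 : 0 < l2 := by positivity
  set D := 1 + |A| ^ 3 + l1 + l2 with hD
  have D0 : 0 < D := by positivity
  set P := 1 + D * |B| + 2 * N * (1 + |A| ^ 3) with hP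
  have P0 : 0 ≤ P := by positivity
  set k0 := min (1 / 2) (l1 / 2) with hk0
  have k00 : 0 < k0 := by positivity
  refine ⟨(1 + N * (qmass * (R ^ 6 / 2 + l1) * K)) * P / k0, by positivity, ?_⟩
  intro a f f' x r L ε η θ ha hf cf' ih hB hA hr hL ε0 η0 hη sep cθ θ01 θ0 hθ small hE
  have cf : Continuous f := continuous_iff_continuousAt.2 fun x => (hf x).continuousAt
  have A0 : 0 ≤ A := (abs_nonneg _).trans (hA 0)
  have B0 : 0 ≤ B := le_trans (integral_nonneg fun z => by positivity) hB
  rw [abs_of_nonneg A0] at hD hP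
  rw [abs_of_nonneg B0] at hP
  set G := ∫ z in far N x r, (f z ^ 2 + f' z ^ 2) with hG
  have G0 : 0 ≤ G := integral_nonneg fun z => by positivity
  obtain ⟨p, q, hpq⟩ := exists_windows hr hL sep cf ih fun z => by nlinarith [sq_nonneg (f' z)]
  have le : ∀ i ∈ Finset.Ioc 0 N, p i ≤ q i := fun i hi => by
    obtain ⟨h1, h2, h3, h4, -⟩ := hpq i hi; linarith
  have near : ∀ i ∈ Finset.Ioc 0 N, ∀ z ∈ Set.Icc (p i) (q i), |z - x i| ≤ r + L :=
    fun i hi z hz => by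
      obtain ⟨h1, h2, h3, h4, -⟩ := hpq i hi
      rw [abs_le]; constructor <;> linarith [hz.1, hz.2]
  have disj : ((Finset.Ioc 0 N : Finset ℕ) : Set ℕ).PairwiseDisjoint
      fun i => Set.Icc (p i) (q i) := fun i hi k hk hik => by
    refine Set.disjoint_left.2 fun z hz hz' => ?_
    have h1 := near i hi z hz
    have h2 := near k hk z hz'
    have h3 := sep i hi k hk hik
    have h4 := abs_sub_le (x i) z (x k)
    rw [abs_sub_comm (x i) z] at h4
    linarith
  set W := ⋃ i ∈ Finset.Ioc 0 N, Set.Icc (p i) (q i) with hW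
  have meas : MeasurableSet Wᶜ :=
    (Finset.measurableSet_biUnion _ fun i _ => measurableSet_Icc).compl
  have out : ∀ z ∈ Wᶜ, |f z| ≤ η := fun z hz => small z fun i hi => by
    by_contra! h
    refine hz (Set.mem_biUnion hi ?_)
    obtain ⟨h1, h2, h3, h4, -⟩ := hpq i hi
    rw [abs_lt] at h
    exact ⟨by linarith, by linarith⟩
  -- the density and its bounds
  have pw : ∀ l, 0 ≤ l → l ≤ l1 + l2 → ∀ z,
      |1 / 2 * f' z ^ 2 - 1 / 5 * f z ^ 5 + l * f z ^ 2| ≤ D * (f z ^ 2 + f' z ^ 2) :=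
    fun l h0 h1 z => by
      have e1 := abs_le.1 (abs_pow5_le (hA z))
      have e2 := sq_nonneg (f z)
      have e3 := sq_nonneg (f' z)
      have e4 := mul_le_mul_of_nonneg_right h1 e2
      have e5 := mul_nonneg h0 e2
      have e6 : 0 ≤ A ^ 3 * f z ^ 2 := by positivity
      have e7 : 0 ≤ A ^ 3 * f' z ^ 2 := by positivity
      have e8 : 0 ≤ (l1 + l2) * f' z ^ 2 := by positivity
      rw [hD, abs_le]
      constructor <;> linarith [e1.1, e1.2]
  have cg : ∀ l, Continuous fun z => 1 / 2 * f' z ^ 2 - 1 / 5 * f z ^ 5 + l * f z ^ 2 :=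
    fun l => by fun_prop
  have igl : ∀ l, 0 ≤ l → l ≤ l1 + l2 →
      Integrable fun z => 1 / 2 * f' z ^ 2 - 1 / 5 * f z ^ 5 + l * f z ^ 2 := fun l h0 h1 =>
    (ih.const_mul D).mono' (cg l).aestronglyMeasurable
      (Eventually.of_forall fun z => by rw [norm_eq_abs]; exact pw l h0 h1 z)
  have igt : ∀ j l, 0 ≤ l → l ≤ l1 + l2 →
      Integrable fun z => (1 / 2 * f' z ^ 2 - 1 / 5 * f z ^ 5 + l * f z ^ 2) * θ j z :=
    fun j l h0 h1 =>
      (ih.const_mul D).mono' ((cg l).mul (cθ j)).aestronglyMeasurable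
        (Eventually.of_forall fun z => by
          rw [norm_eq_abs, abs_mul, abs_of_nonneg (θ01 j z).1]
          exact (mul_le_of_le_one_right (abs_nonneg _) (θ01 j z).2).trans (pw l h0 h1 z))
  have coer : ∀ l, l1 ≤ l → ∀ z ∈ Wᶜ,
      k0 * (f z ^ 2 + f' z ^ 2) ≤ 1 / 2 * f' z ^ 2 - 1 / 5 * f z ^ 5 + l * f z ^ 2 :=
    fun l hl z hz => by
      have e1 := (abs_le.1 (abs_pow5_le (out z hz))).2
      have e2 := mul_le_mul_of_nonneg_right hη (sq_nonneg (f z))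
      have e3 := mul_le_mul_of_nonneg_right hl (sq_nonneg (f z))
      have e4 := mul_le_mul_of_nonneg_right (min_le_left (1 / 2) (l1 / 2)) (sq_nonneg (f' z))
      have e5 := mul_le_mul_of_nonneg_right (min_le_right (1 / 2) (l1 / 2)) (sq_nonneg (f z))
      have e6 : 0 ≤ l1 * f z ^ 2 := by positivity
      linarith
  set b : ℕ → ℝ := fun i => (∫ z in Set.Icc (p i) (q i), f z ^ 2) / qmass with hb
  have isq : Integrable fun z => f z ^ 2 := ih.mono' (cf.pow 2).aestronglyMeasurable
    (Eventually.of_forall fun z => by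
      rw [norm_eq_abs, abs_of_nonneg (sq_nonneg _)]; nlinarith [sq_nonneg (f' z)])
  have b0 : ∀ i, 0 ≤ b i := fun i =>
    div_nonneg (integral_nonneg fun z => sq_nonneg _) m0.le
  have bR : ∀ i, b i ≤ R := fun i => by
    rw [hb, div_le_iff₀ m0, mul_comm R]
    refine le_trans ?_ hBR
    refine le_trans ?_ hB
    refine (setIntegral_le_integral isq (Eventually.of_forall fun z => sq_nonneg _)).trans
      (integral_mono isq ih fun z => ?_)
    nlinarith [sq_nonneg (f' z)]
  set δ := P * (ε + G / L) with hδ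
  have δ0 : 0 ≤ δ := by positivity
  have win : ∀ l, 0 ≤ l → l ≤ l1 + l2 → ∀ i ∈ Finset.Ioc 0 N, solv l (b i) - 2 * (1 + A ^ 3) * (G / L) ≤
      ∫ z in Set.Icc (p i) (q i), (1 / 2 * f' z ^ 2 - 1 / 5 * f z ^ 5 + l * f z ^ 2) :=
    fun l h0 h1 i hi => by
      have e1 := window_energy hf cf' (le i hi) hA
      have cE : Continuous fun z => 1 / 2 * f' z ^ 2 - 1 / 5 * f z ^ 5 := by fun_prop
      have cM : Continuous fun z => l * f z ^ 2 := by fun_prop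
      have e2 := intervalIntegral.integral_add (μ := volume) (cE.intervalIntegrable (p i) (q i))
        (cM.intervalIntegrable (p i) (q i))
      rw [intervalIntegral.integral_const_mul] at e2
      have e3 : ∫ z in (p i)..(q i), f z ^ 2 = qmass * b i := by
        rw [intervalIntegral.integral_of_le (le i hi), ← integral_Icc_eq_integral_Ioc, hb]
        field_simp
      rw [integral_Icc_eq_integral_Ioc, ← intervalIntegral.integral_of_le (le i hi), e2, e3]
      rw [e3, mul_div_cancel_left₀ _ m0.ne'] at e1
      obtain ⟨-, -, -, -, h5, h6⟩ := hpq i hi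
      have e4 := mul_le_mul_of_nonneg_left (add_le_add h5 h6) (by positivity : 0 ≤ 1 + A ^ 3)
      unfold solv
      linarith
  have main : ∀ j < N, ∀ l, (l = l1 ∨ l = l2) → l1 ≤ l → ∑ i ∈ Finset.Ioc j N, solv l (b i) +
      ∫ z in Wᶜ, (1 / 2 * f' z ^ 2 - 1 / 5 * f z ^ 5 + l * f z ^ 2) * θ j z ≤
        (∑ i ∈ Finset.Ioc j N, solv l (a i)) + δ := fun j hj l hl hl1 => by
    have h0 : 0 ≤ l := l10.le.trans hl1
    have h1 : l ≤ l1 + l2 := by rcases hl with rfl | rfl <;> linarith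
    have sub : Finset.Ioc j N ⊆ Finset.Ioc 0 N := Finset.Ioc_subset_Ioc_left (Nat.zero_le _)
    have e1 := window_sum sub disj ε0 (igl l h0 h1) (ih.const_mul D) (igt j l h0 h1) (pw l h0 h1)
      (fun i hi z hz => (hθ j hj i (sub hi) z (near i (sub hi) z hz)).1 (Finset.mem_Ioc.1 hi).1)
      (fun i hi hi' z hz => (hθ j hj i hi z (near i hi z hz)).2 (by
        by_contra! h; exact hi' (Finset.mem_Ioc.2 ⟨h, (Finset.mem_Ioc.1 hi).2⟩)))
    have e2 := Finset.sum_le_sum fun i hi => win l h0 h1 i (sub hi)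
    rw [Finset.sum_sub_distrib, Finset.sum_const, nsmul_eq_mul, Nat.card_Ioc] at e2
    have e3 : ((N - j : ℕ) : ℝ) * (2 * (1 + A ^ 3) * (G / L)) ≤ N * (2 * (1 + A ^ 3) * (G / L)) :=
      mul_le_mul_of_nonneg_right (by exact_mod_cast Nat.sub_le N j) (by positivity)
    have e4 := hE j hj l hl
    rw [integral_const_mul] at e1
    have e5 := mul_le_mul_of_nonneg_left (mul_le_mul_of_nonneg_left hB D0.le) ε0
    have e6 : ε + ε * (D * B) + N * (2 * (1 + A ^ 3) * (G / L)) ≤ δ := by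
      rw [hδ, hP]
      have g1 : 0 ≤ G / L := by positivity
      have g2 : 0 ≤ 2 * N * (1 + A ^ 3) * ε := by positivity
      have g3 : 0 ≤ (1 + D * B) * (G / L) := by positivity
      linarith
    linarith
  have pos : ∀ j l, l1 ≤ l →
      0 ≤ ∫ z in Wᶜ, (1 / 2 * f' z ^ 2 - 1 / 5 * f z ^ 5 + l * f z ^ 2) * θ j z := fun j l hl =>
    setIntegral_nonneg meas fun z hz => mul_nonneg
      (le_trans (by positivity) (coer l hl z hz)) (θ01 j z).1
  have hall : ∀ i, α ≤ a i ∧ a i ≤ R ∧ 0 ≤ b i ∧ b i ≤ R := fun i =>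
    ⟨(ha i).1, (ha i).2, b0 i, bR i⟩
  have l12 : l1 ≤ l2 := by
    have : α ^ 6 ≤ R ^ 6 := pow_le_pow_left₀ hα.le ((ha 0).1.trans (ha 0).2) 6
    have : 0 ≤ R ^ 6 := by positivity
    linarith
  have pin := hK a b δ δ0 hall
    (fun j hj => by linarith [main j hj l1 (Or.inl rfl) le_rfl, pos j l1 le_rfl])
    (fun j hj => by linarith [main j hj l2 (Or.inr rfl) l12, pos j l2 l12])
  rw [Nat.sub_self] at pin
  have fin := main 0 hN l1 (Or.inl rfl) le_rfl
  simp only [θ0, mul_one] at fin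
  have low : (∑ i ∈ Finset.Ioc 0 N, solv l1 (a i)) - ∑ i ∈ Finset.Ioc 0 N, solv l1 (b i) ≤
      N * (qmass * (R ^ 6 / 2 + l1) * (K * δ)) := by
    rw [← Finset.sum_sub_distrib]
    have h4 : ∀ i ∈ Finset.Ioc 0 N, solv l1 (a i) - solv l1 (b i) ≤
        qmass * (R ^ 6 / 2 + l1) * (K * δ) := fun i hi => by
      have q5 := solv_lip (hα.le.trans (ha i).1) (b0 i) (ha i).2 (bR i) l10.le
      have q6 := neg_abs_le (solv l1 (b i) - solv l1 (a i))
      have q7 := mul_le_mul_of_nonneg_left (pin i hi)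
        (by positivity : 0 ≤ qmass * (R ^ 6 / 2 + l1))
      linarith
    refine (Finset.sum_le_card_nsmul _ _ _ h4).trans (le_of_eq ?_)
    rw [nsmul_eq_mul, Nat.card_Ioc, Nat.sub_zero]
  have c1 : ∫ z in Wᶜ, k0 * (f z ^ 2 + f' z ^ 2) ≤
      ∫ z in Wᶜ, (1 / 2 * f' z ^ 2 - 1 / 5 * f z ^ 5 + l1 * f z ^ 2) :=
    setIntegral_mono_on (ih.const_mul k0).integrableOn (igl l1 l10.le (by linarith)).integrableOn
      meas (coer l1 le_rfl)
  rw [integral_const_mul] at c1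
  have c2 : ∫ z in far N x (r + L), (f z ^ 2 + f' z ^ 2) ≤ ∫ z in Wᶜ, (f z ^ 2 + f' z ^ 2) := by
    have sub : far N x (r + L) ⊆ Wᶜ := fun z hz hzW => by
      obtain ⟨i, hi, hzi⟩ := Set.mem_iUnion₂.1 hzW
      exact absurd (near i hi z hzi) (not_le.2 (hz i hi))
    exact setIntegral_mono_set ih.integrableOn (Eventually.of_forall fun z => by positivity)
      sub.eventuallyLE
  have c3 : k0 * ∫ z in far N x (r + L), (f z ^ 2 + f' z ^ 2) ≤
      (1 + N * (qmass * (R ^ 6 / 2 + l1) * K)) * δ := by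
    have := mul_le_mul_of_nonneg_left c2 k00.le
    linarith
  rw [div_mul_eq_mul_div, le_div_iff₀ k00, mul_comm, mul_assoc, ← hδ]
  exact c3

end GKdV

namespace GKdV

variable {u : ℝ → ℝ → ℝ} {N : ℕ} {c Δ : ℕ → ℝ}

lemma exists_pos_le_of_finset (s : Finset ℕ) (f : ℕ → ℝ) (h : ∀ i ∈ s, 0 < f i) :
    ∃ g, 0 < g ∧ ∀ i ∈ s, g ≤ f i := by
  induction s using Finset.induction_on with
  | empty => exact ⟨1, one_pos, fun i hi => by simp at hi⟩
  | insert a s _ ih =>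
    obtain ⟨g, g0, hg⟩ := ih fun i hi => h i (Finset.mem_insert_of_mem hi)
    refine ⟨min g (f a), lt_min g0 (h a (Finset.mem_insert_self _ _)), fun i hi => ?_⟩
    rcases Finset.mem_insert.1 hi with rfl | hi
    · exact min_le_right _ _
    · exact (min_le_left _ _).trans (hg i hi)

lemma one_sub_sigmoid_le (x : ℝ) : 1 - sigmoid x ≤ exp (-x) := by
  have h := exp_pos (-x)
  have : 1 - sigmoid x = exp (-x) / (1 + exp (-x)) := by
    rw [sigmoid_def]; field_simp; ring
  rw [this]
  exact div_le_self h.le (by linarith)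

lemma sigmoid_le_exp (x : ℝ) : sigmoid x ≤ exp x := by
  have := one_sub_sigmoid_le (-x)
  rw [sigmoid_neg, neg_neg] at this
  linarith

lemma integral_exp_neg_mul_le {k : ℝ} (hk : 0 < k) (a b : ℝ) :
    ∫ t in a..b, exp (-(k * t)) ≤ exp (-(k * a)) / k := by
  have h : ∀ t ∈ Set.uIcc a b, HasDerivAt (fun t => -(exp (-(k * t)) / k)) (exp (-(k * t))) t :=
    fun t _ => by
      have := (((hasDerivAt_const_mul k (x := t)).fun_neg.exp).div_const k).fun_neg
      rwa [mul_neg, neg_div, neg_neg, mul_div_cancel_right₀ _ hk.ne'] at this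
  rw [intervalIntegral.integral_eq_sub_of_hasDerivAt h
    (Continuous.intervalIntegrable (by fun_prop) _ _)]
  have : 0 < exp (-(k * b)) / k := by positivity
  linarith

/-- The energy-mass to the left of a line separating the solitons is at most the one of the
solitons on that side, up to an exponentially small error. -/
lemma left_mass (hu : IsGKdVSolution u) (ho : Out u N c Δ) {B m β l η d : ℝ}
    (hB : ∀ a b, HB u a b B) (hβ : 0 < β) (hm : 0 < m) (h1 : β ^ 2 ≤ l)
    (h2 : β ^ 4 / 3 ≤ l * (m - β ^ 2 / 4)) (η0 : 0 < η)
    (hη : η ^ 6 / 3 + (m + 8 * l) / 5 * η ^ 3 ≤ l * (m - β ^ 2 / 4) / 2) (hd : 0 < d)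
    (hc : ∀ j ∈ Finset.Icc 1 N, d ≤ |c j - m|) :
    ∃ C, 0 ≤ C ∧ ∀ᶠ t in atTop, ∫ x, (en u t x + l * u t x ^ 2) * (1 - sigmoid (β * (x - m * t))) ≤
      (∑ j ∈ Finset.Icc 1 N, if m < c j then 0 else sol1 l (c j)) + C * exp (-(β * d * t)) := by
  obtain ⟨L, L0, hL⟩ := ho.small hu η0
  obtain ⟨T, hT⟩ := eventually_atTop.1 (hL.and (eventually_ge_atTop 0))
  obtain ⟨C, C0, hC⟩ := Psi_mono hu hB hβ hm h1 h2 hη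
  set D := L + ∑ j ∈ Finset.Icc 1 N, |Δ j| with hD
  have hk : 0 < β * d := mul_pos hβ hd
  refine ⟨C * exp (β * D) / (β * d), by positivity, eventually_atTop.2 ⟨T, fun t ht => ?_⟩⟩
  have lim := ho.tendsto_Psi hu l hβ (m := m) 0 fun j hj h => by
    have := hc j hj
    rw [h, sub_self, abs_zero] at this
    linarith
  have key : ∀ b, t ≤ b → Psi u l β b (m * b + 0) ≤
      Psi u l β t (m * t) + C * exp (β * D) / (β * d) * exp (-(β * d * t)) := fun b hb => by
    have h := hC t b 0 (fun s => d * s - D) hb (by fun_prop) fun s hs x hx => by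
      refine (hT s (ht.trans hs.1)).1 x fun j hj => ?_
      have s0 : 0 ≤ s := (hT s (ht.trans hs.1)).2
      have e1 := Finset.single_le_sum (f := fun j => |Δ j|) (fun i _ => abs_nonneg _) hj
      have e2 := mul_le_mul_of_nonneg_right (hc j hj) s0
      have e3 : |c j - m| * s ≤ |x - (c j * s + Δ j)| + |x - (m * s + 0)| + |Δ j| := by
        rw [← abs_of_nonneg s0, ← abs_mul, abs_of_nonneg s0]
        calc |(c j - m) * s| = |-(x - (c j * s + Δ j)) + (x - (m * s + 0)) + -Δ j| := by
              congr 1; ring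
          _ ≤ _ := by
            refine (abs_add_le _ _).trans ?_
            rw [abs_neg (Δ j)]
            gcongr
            refine (abs_add_le _ _).trans ?_
            rw [abs_neg]
      linarith
    rw [add_zero (m * t)] at h
    refine h.trans (add_le_add_right ?_ _)
    have e : ∀ s, C * exp (-(β * (d * s - D))) = C * exp (β * D) * exp (-(β * d * s)) := fun s => by
      rw [mul_assoc, ← exp_add]; congr 2; ring
    simp_rw [e]
    rw [intervalIntegral.integral_const_mul]
    have := mul_le_mul_of_nonneg_left (integral_exp_neg_mul_le hk t b)
      (by positivity : 0 ≤ C * exp (β * D))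
    refine this.trans (le_of_eq ?_)
    ring
  have h0 := le_of_tendsto lim ((eventually_ge_atTop t).mono key)
  have tot := ho.total hu l t
  have i1 : Integrable fun x => en u t x + l * u t x ^ 2 :=
    (en_int hu t).add ((sol_int0 hu t).const_mul l)
  have i2 : Integrable fun x => (en u t x + l * u t x ^ 2) * sigmoid (β * (x - m * t)) :=
    i1.mul_bdd (c := 1) (continuous_sigmoid.comp (by fun_prop)).aestronglyMeasurable
      (Eventually.of_forall fun x => by
        rw [norm_eq_abs, abs_of_pos (sigmoid_pos _)]; exact (sigmoid_lt_one _).le)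
  have e1 : ∫ x, (en u t x + l * u t x ^ 2) * (1 - sigmoid (β * (x - m * t))) =
      (∫ x, (en u t x + l * u t x ^ 2)) - Psi u l β t (m * t) := by
    unfold Psi
    rw [← integral_sub i1 i2]
    congr 1; funext x; ring
  have e2 : ∑ j ∈ Finset.Icc 1 N, sol1 l (c j) =
      (∑ j ∈ Finset.Icc 1 N, if m < c j then sol1 l (c j) else 0) +
      ∑ j ∈ Finset.Icc 1 N, if m < c j then 0 else sol1 l (c j) := by
    rw [← Finset.sum_add_distrib]
    refine Finset.sum_congr rfl fun j _ => ?_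
    split_ifs <;> simp
  rw [e1, tot, e2]
  linarith

end GKdV

namespace GKdV

variable {u : ℝ → ℝ → ℝ} {N : ℕ} {c Δ : ℕ → ℝ}

/-- The energy-mass estimates at all separating lines, with uniform weights. -/
lemma left_masses (hu : IsGKdVSolution u) (ho : Out u N c Δ) {B g k l1 l2 : ℝ}
    (hB : ∀ a b, HB u a b B) (g0 : 0 < g) (k0 : 0 < k) (hk : ∀ j ∈ Finset.Icc 1 N, k ≤ c j)
    (hg : ∀ i ∈ Finset.Ioc 0 N, ∀ j ∈ Finset.Ioc 0 N, i < j → c j + g ≤ c i) (l10 : 0 < l1)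
    (l12 : l1 ≤ l2) :
    ∃ β η C, 0 < β ∧ 0 < η ∧ η ^ 3 ≤ l1 ∧ 0 ≤ C ∧ ∀ᶠ t in atTop, ∀ j, 0 < j → j < N →
      ∀ l, l = l1 ∨ l = l2 →
      ∫ x, (en u t x + l * u t x ^ 2) * (1 - sigmoid (β * (x - (c j + c (j + 1)) / 2 * t))) ≤
        (∑ i ∈ Finset.Ioc j N, sol1 l (c i)) + C * exp (-(β * (g / 2) * t)) := by
  set β := √(min l1 k) with hβ
  have mn : 0 < min l1 k := lt_min l10 k0
  have β0 : 0 < β := sqrt_pos.2 mn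
  have β2 : β ^ 2 = min l1 k := sq_sqrt mn.le
  have β2l : β ^ 2 ≤ l1 := β2.trans_le (min_le_left _ _)
  have β2k : β ^ 2 ≤ k := β2.trans_le (min_le_right _ _)
  set S := ∑ j ∈ Finset.Icc 1 N, |c j| with hS
  have S0 : 0 ≤ S := Finset.sum_nonneg fun _ _ => abs_nonneg _
  have l20 : 0 < l2 := l10.trans_le l12
  set p := (S + 8 * l2) / 5 with hp
  have p0 : 0 < p := by positivity
  obtain ⟨η, η0, -, hη⟩ := exists_small_threshold p0.le
    (lt_min (by positivity : 0 < l1 * (k * (3 / 4)) / 2) (mul_pos p0 l10))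
  have η3 : η ^ 3 ≤ l1 := by
    have h1 := hη.trans (min_le_right _ _)
    have h2 : 0 ≤ η ^ 6 / 3 := by positivity
    exact le_of_mul_le_mul_left (by linarith : p * η ^ 3 ≤ p * l1) p0
  have hη' := hη.trans (min_le_left _ _)
  have idx : Finset.Icc 1 N = Finset.Ioc 0 N := rfl
  have one : ∀ j, 0 < j → j < N → ∀ l, l1 ≤ l → l ≤ l2 → ∃ C, 0 ≤ C ∧ ∀ᶠ t in atTop,
      ∫ x, (en u t x + l * u t x ^ 2) * (1 - sigmoid (β * (x - (c j + c (j + 1)) / 2 * t))) ≤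
        (∑ i ∈ Finset.Ioc j N, sol1 l (c i)) + C * exp (-(β * (g / 2) * t)) :=
    fun j j0 jN l hl hl' => by
      set m := (c j + c (j + 1)) / 2 with hm
      have hj : j ∈ Finset.Ioc 0 N := Finset.mem_Ioc.2 ⟨j0, jN.le⟩
      have hj1 : j + 1 ∈ Finset.Ioc 0 N := Finset.mem_Ioc.2 ⟨by omega, by omega⟩
      have gap := hg j hj (j + 1) hj1 (by omega)
      have km : k ≤ m := by linarith [hk j hj, hk _ hj1]
      have mS : m ≤ S := by
        have e1 : |c j| ≤ S := Finset.single_le_sum (s := Finset.Icc 1 N) (f := fun j => |c j|)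
          (fun i _ => abs_nonneg _) hj
        have e2 := le_abs_self (c j)
        linarith
      have left : ∀ i ∈ Finset.Icc 1 N, i ≤ j → m + g / 2 ≤ c i := fun i hi hij => by
        rcases hij.eq_or_lt with rfl | h
        · linarith
        · linarith [hg i hi j hj h]
      have right : ∀ i ∈ Finset.Icc 1 N, j < i → c i ≤ m - g / 2 := fun i hi hij => by
        rcases (Nat.succ_le_of_lt hij).eq_or_lt with h | h
        · rw [← h]; simp only [Nat.succ_eq_add_one]; linarith
        · linarith [hg (j + 1) hj1 i hi h]
      have l0 : 0 < l := l10.trans_le hl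
      have kk : k * (3 / 4) ≤ m - β ^ 2 / 4 := by linarith
      have q1 : l1 * (k * (3 / 4)) ≤ l * (m - β ^ 2 / 4) := by
        gcongr
      have q2 : β ^ 4 / 3 ≤ l * (m - β ^ 2 / 4) := by
        have : β ^ 4 ≤ l1 * k := by
          calc β ^ 4 = β ^ 2 * β ^ 2 := by ring
            _ ≤ _ := by gcongr
        have : 0 < l1 * k := by positivity
        linarith
      have q3 : η ^ 6 / 3 + (m + 8 * l) / 5 * η ^ 3 ≤ l * (m - β ^ 2 / 4) / 2 := by
        have : (m + 8 * l) / 5 * η ^ 3 ≤ p * η ^ 3 := by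
          rw [hp]; gcongr
        linarith
      obtain ⟨C, C0, hC⟩ := left_mass hu ho (d := g / 2) hB β0 (k0.trans_le km) (β2l.trans hl) q2 η0
        q3 (by positivity) fun i hi => by
          rcases le_or_gt i j with h | h
          · exact (by linarith [left i hi h] : g / 2 ≤ c i - m).trans (le_abs_self _)
          · exact (by linarith [right i hi h] : g / 2 ≤ -(c i - m)).trans (neg_le_abs _)
      refine ⟨C, C0, hC.mono fun t ht => ht.trans (le_of_eq ?_)⟩
      congr 1
      rw [idx, ← Finset.sum_Ioc_consecutive _ (Nat.zero_le j) jN.le]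
      rw [Finset.sum_eq_zero fun i hi => ?_, zero_add]
      · refine Finset.sum_congr rfl fun i hi => ?_
        obtain ⟨h1, h2⟩ := Finset.mem_Ioc.1 hi
        rw [if_neg (by linarith [right i (Finset.mem_Icc.2 ⟨by omega, h2⟩) h1])]
      · obtain ⟨h1, h2⟩ := Finset.mem_Ioc.1 hi
        rw [if_pos (by linarith [left i (Finset.mem_Icc.2 ⟨by omega, by omega⟩) h2])]
  have both : ∀ j ∈ Finset.Ioo 0 N, ∃ C, 0 ≤ C ∧ ∀ᶠ t in atTop, ∀ l, l = l1 ∨ l = l2 →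
      ∫ x, (en u t x + l * u t x ^ 2) * (1 - sigmoid (β * (x - (c j + c (j + 1)) / 2 * t))) ≤
        (∑ i ∈ Finset.Ioc j N, sol1 l (c i)) + C * exp (-(β * (g / 2) * t)) := fun j hj => by
    obtain ⟨h1, h2⟩ := Finset.mem_Ioo.1 hj
    obtain ⟨C, C0, hC⟩ := one j h1 h2 l1 le_rfl l12
    obtain ⟨C', C0', hC'⟩ := one j h1 h2 l2 l12 le_rfl
    refine ⟨C + C', by positivity, (hC.and hC').mono fun t ht l hl => ?_⟩
    have e := exp_pos (-(β * (g / 2) * t))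
    have e1 := mul_nonneg C0 e.le
    have e2 := mul_nonneg C0' e.le
    rcases hl with rfl | rfl
    · linarith [ht.1]
    · linarith [ht.2]
  choose! C C0 hC using both
  refine ⟨β, η, ∑ j ∈ Finset.Ioo 0 N, C j, β0, η0, η3, Finset.sum_nonneg C0, ?_⟩
  filter_upwards [(Finset.eventually_all _).2 hC] with t ht j h1 h2 l hl
  have hj := Finset.mem_Ioo.2 ⟨h1, h2⟩
  refine (ht j hj l hl).trans (add_le_add_right (mul_le_mul_of_nonneg_right
    (Finset.single_le_sum C0 hj) (exp_pos _).le) _)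

end GKdV

namespace GKdV

variable {u : ℝ → ℝ → ℝ} {N : ℕ} {c Δ : ℕ → ℝ}

lemma Out.exists_gap (ho : Out u N c Δ) : ∃ g, 0 < g ∧
    ∀ i ∈ Finset.Ioc 0 N, ∀ j ∈ Finset.Ioc 0 N, i < j → c j + g ≤ c i := by
  obtain ⟨g, g0, hg⟩ := exists_pos_le_of_finset (Finset.Ioo 0 N) (fun j => c j - c (j + 1))
    fun j hj => by
      obtain ⟨h1, h2⟩ := Finset.mem_Ioo.1 hj
      exact sub_pos.2 (ho.dec j (Finset.mem_Icc.2 ⟨h1, h2.le⟩) (j + 1)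
        (Finset.mem_Icc.2 ⟨by omega, h2⟩) (by omega))
  refine ⟨g, g0, fun i hi j hj hij => ?_⟩
  obtain ⟨i1, i2⟩ := Finset.mem_Ioc.1 hi
  obtain ⟨j1, j2⟩ := Finset.mem_Ioc.1 hj
  have h1 := hg i (Finset.mem_Ioo.2 ⟨i1, by omega⟩)
  have h2 : c j ≤ c (i + 1) := by
    rcases (Nat.succ_le_of_lt hij).eq_or_lt with h | h
    · rw [← h]
    · exact (ho.dec (i + 1) (Finset.mem_Icc.2 ⟨by omega, by omega⟩) j hj h).le
  linarith

/-- The step of the iteration: the `H¹` mass far from the solitons decreases geometrically. -/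
lemma Out.gap_recursion (hu : IsGKdVSolution u) (ho : Out u N c Δ) (hN : 0 < N) :
    ∃ r0 L E κ ν T, 0 < L ∧ 0 < E ∧ 0 < κ ∧ 0 < ν ∧ 0 ≤ T ∧ ∀ t, T ≤ t → ∀ r, r0 ≤ r → r + L ≤ κ * t →
      ∫ x in far N (fun i => c i * t + Δ i) (r + L), hden u t x ≤
        E * exp (-(ν * t)) + (∫ x in far N (fun i => c i * t + Δ i) r, hden u t x) / 4 := by
  obtain ⟨B, B0, hB⟩ := exists_HB hu
  have m0 := qmass_pos
  obtain ⟨g, g0, hg⟩ := ho.exists_gap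
  obtain ⟨k, k0, hk⟩ := exists_pos_le_of_finset (Finset.Icc 1 N) c ho.pos
  obtain ⟨α, hα, hαc⟩ := exists_pos_le_of_finset (Finset.Ioc 0 N) (fun i => rt (c i))
    fun i hi => rt_pos (ho.pos i hi)
  set R := B / qmass + ∑ i ∈ Finset.Ioc 0 N, rt (c i) with hR
  have BR : B ≤ qmass * R := by
    have : 0 ≤ qmass * ∑ i ∈ Finset.Ioc 0 N, rt (c i) :=
      mul_nonneg m0.le (Finset.sum_nonneg fun i hi => (rt_pos (ho.pos i hi)).le)
    rw [hR, mul_add, mul_div_cancel₀ _ m0.ne']; linarith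
  have cR : ∀ i ∈ Finset.Ioc 0 N, rt (c i) ≤ R := fun i hi => by
    have e1 : rt (c i) ≤ ∑ i ∈ Finset.Ioc 0 N, rt (c i) :=
      Finset.single_le_sum (f := fun i => rt (c i)) (fun i hi => (rt_pos (ho.pos i hi)).le) hi
    have : 0 ≤ B / qmass := by positivity
    linarith
  have h1N : 1 ∈ Finset.Ioc 0 N := Finset.mem_Ioc.2 ⟨one_pos, hN⟩
  set a : ℕ → ℝ := fun i => if i ∈ Finset.Ioc 0 N then rt (c i) else rt (c 1) with ha
  have haR : ∀ i, α ≤ a i ∧ a i ≤ R := fun i => by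
    rw [ha]; dsimp only; split_ifs with h
    · exact ⟨hαc i h, cR i h⟩
    · exact ⟨hαc 1 h1N, cR 1 h1N⟩
  have a_eq : ∀ i ∈ Finset.Ioc 0 N, a i = rt (c i) := fun i hi => by rw [ha]; exact if_pos hi
  have αR : α ≤ R := (hαc 1 h1N).trans (cR 1 h1N)
  have l10 : 0 < α ^ 6 / 28 := by positivity
  have l12 : α ^ 6 / 28 ≤ R ^ 6 / 2 + 1 := by
    have : α ^ 6 ≤ R ^ 6 := pow_le_pow_left₀ hα.le αR 6
    have : 0 ≤ R ^ 6 := by positivity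
    linarith
  obtain ⟨β, η, C1, β0, η0, hη, C10, hC1⟩ := left_masses hu ho hB g0 k0 hk hg l10 l12
  obtain ⟨r0, r00, hr0⟩ := ho.small hu η0
  obtain ⟨C2, C20, hC2⟩ := gap_step (A := 1 + B) hN hα BR
  obtain ⟨T, hT⟩ := eventually_atTop.1 (hC1.and hr0)
  set D := ∑ j ∈ Finset.Ioc 0 N, |Δ j| with hD
  have D0 : 0 ≤ D := Finset.sum_nonneg fun _ _ => abs_nonneg _
  have ΔD : ∀ i ∈ Finset.Ioc 0 N, |Δ i| ≤ D := fun i hi =>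
    Finset.single_le_sum (f := fun j => |Δ j|) (fun i _ => abs_nonneg _) hi
  refine ⟨r0, 4 * C2 + 1, (C2 + 1) * (C1 + exp (β * D)), g / 8, β * (3 * g / 8), |T| + (4 * D + 1) / g,
    by positivity, by positivity, by positivity, by positivity, by positivity, ?_⟩
  intro t ht r hr hrL
  set L := 4 * C2 + 1 with hL
  have L0 : 0 < L := by positivity
  have t0 : 0 ≤ t := le_trans (by positivity) ht
  have tT : T ≤ t := by
    have : 0 ≤ (4 * D + 1) / g := by positivity
    linarith [le_abs_self T]
  have tD : 4 * D + 1 ≤ g * t := by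
    have : (4 * D + 1) / g ≤ t := by linarith [abs_nonneg T]
    rw [div_le_iff₀ g0] at this; linarith
  obtain ⟨hA, hs⟩ := hT t tT
  set ε := (C1 + exp (β * D)) * exp (-(β * (3 * g / 8) * t)) with hε
  have ε0 : 0 ≤ ε := by positivity
  have sep : ∀ i ∈ Finset.Ioc 0 N, ∀ j ∈ Finset.Ioc 0 N, i < j →
      2 * (r + L) < |c i * t + Δ i - (c j * t + Δ j)| := fun i hi j hj hij => by
    have e1 := mul_le_mul_of_nonneg_right (hg i hi j hj hij) t0
    have e2 := (abs_le.1 (ΔD i hi)).1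
    have e3 := (abs_le.1 (ΔD j hj)).2
    refine lt_of_lt_of_le ?_ (le_abs_self _)
    linarith
  set θ : ℕ → ℝ → ℝ := fun j z => if j = 0 then 1 else 1 - sigmoid (β * (z - (c j + c (j + 1)) / 2 * t))
    with hθ
  have s := sol_sm hu
  have sum_a : ∀ j l, ∑ i ∈ Finset.Ioc j N, solv l (a i) = ∑ i ∈ Finset.Ioc j N, sol1 l (c i) :=
    fun j l => Finset.sum_congr rfl fun i hi => by
      rw [a_eq i (Finset.Ioc_subset_Ioc_left (Nat.zero_le j) hi), sol1_eq]
  have small_exp : ∀ w, 3 * g / 8 * t - D ≤ w → exp (-(β * w)) ≤ ε := fun w hw => by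
    calc exp (-(β * w)) ≤ exp (β * D) * exp (-(β * (3 * g / 8) * t)) := by
          rw [← exp_add, exp_le_exp]
          linarith [mul_le_mul_of_nonneg_left hw β0.le]
      _ ≤ ε := mul_le_mul_of_nonneg_right (by linarith) (exp_pos _).le
  have res := hC2 a (u t) (px u t) (fun i => c i * t + Δ i) r L ε η θ haR (s.hasDerivAt_x t)
    (s.px.cont_x t) (hden_int hu t) (hB t t t ⟨le_rfl, le_rfl⟩)
    ((hB t t).ptw hu ⟨le_rfl, le_rfl⟩) (r00.le.trans hr) L0 ε0 η0.le hη
    (fun i hi j hj hij => by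
      rcases hij.lt_or_gt with h | h
      · exact sep i hi j hj h
      · rw [abs_sub_comm]; exact sep j hj i hi h)
    (fun j => by
      rw [hθ]; dsimp only
      split_ifs
      · exact continuous_const
      · exact continuous_const.sub (continuous_sigmoid.comp (by fun_prop)))
    (fun j z => by
      rw [hθ]; dsimp only
      split_ifs
      · exact ⟨zero_le_one, le_rfl⟩
      · exact ⟨by linarith [sigmoid_lt_one (β * (z - (c j + c (j + 1)) / 2 * t))],
          by linarith [sigmoid_pos (β * (z - (c j + c (j + 1)) / 2 * t))]⟩)
    (fun z => by simp [hθ])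
    (fun j hj i hi z hz => by
      rcases Nat.eq_zero_or_pos j with rfl | hj0
      · exact ⟨fun _ => by simp [hθ, ε0], fun h => by have := (Finset.mem_Ioc.1 hi).1; omega⟩
      have hj' : j ∈ Finset.Ioc 0 N := Finset.mem_Ioc.2 ⟨hj0, hj.le⟩
      have hj1 : j + 1 ∈ Finset.Ioc 0 N := Finset.mem_Ioc.2 ⟨by omega, by omega⟩
      have gap := hg j hj' (j + 1) hj1 (by omega)
      have e1 : θ j z = 1 - sigmoid (β * (z - (c j + c (j + 1)) / 2 * t)) := by
        rw [hθ]; exact if_neg hj0.ne'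
      have e2 := abs_le.1 (ΔD i hi)
      have e3 := abs_le.1 (hz.trans hrL)
      have p1 := sigmoid_pos (β * (z - (c j + c (j + 1)) / 2 * t))
      have p2 := sigmoid_lt_one (β * (z - (c j + c (j + 1)) / 2 * t))
      refine ⟨fun h => ?_, fun h => ?_⟩
      · have q : c i ≤ c (j + 1) := by
          rcases (Nat.succ_le_of_lt h).eq_or_lt with h | h
          · rw [← h]
          · linarith [hg (j + 1) hj1 i hi h]
        have q1 := mul_le_mul_of_nonneg_right (by linarith : c i ≤ (c j + c (j + 1)) / 2 - g / 2) t0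
        rw [e1, abs_le]
        have q2 := sigmoid_le_exp (β * (z - (c j + c (j + 1)) / 2 * t))
        have q3 := small_exp (-(z - (c j + c (j + 1)) / 2 * t)) (by linarith [e2.2, e3.2])
        rw [mul_neg, neg_neg] at q3
        constructor <;> linarith
      · have q : c j ≤ c i := by
          rcases h.eq_or_lt with h | h
          · rw [← h]
          · linarith [hg i hi j hj' h]
        have q1 := mul_le_mul_of_nonneg_right (by linarith : (c j + c (j + 1)) / 2 + g / 2 ≤ c i) t0
        rw [e1, abs_le]
        have q2 := one_sub_sigmoid_le (β * (z - (c j + c (j + 1)) / 2 * t))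
        have q3 := small_exp (z - (c j + c (j + 1)) / 2 * t) (by linarith [e2.1, e3.1])
        constructor <;> linarith)
    (fun z hz => hs z fun j hj => hr.trans (hz j hj))
    (fun j hj l hl => by
      rw [sum_a]
      rcases Nat.eq_zero_or_pos j with rfl | hj0
      · have := ho.total hu l t
        simp only [hθ, if_true, mul_one]
        exact this.le.trans (le_add_of_nonneg_right ε0)
      · have h := hA j hj0 hj l hl
        simp only [hθ, if_neg hj0.ne']
        refine h.trans (add_le_add_right ?_ _)
        refine mul_le_mul (le_add_of_nonneg_right (exp_pos _).le) (exp_le_exp.2 ?_) (exp_pos _).le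
          (by positivity)
        have : 0 ≤ β * g * t := by positivity
        linarith)
  have G0 : 0 ≤ ∫ x in far N (fun i => c i * t + Δ i) r, hden u t x :=
    integral_nonneg fun x => hden_nonneg (u := u) t x
  refine res.trans ?_
  rw [mul_add]
  refine add_le_add ?_ ?_
  · rw [mul_assoc]
    exact mul_le_mul_of_nonneg_right (by linarith) ε0
  · rw [← mul_div_assoc, div_le_div_iff₀ L0 (by norm_num)]
    have e1 := mul_nonneg C20 G0
    unfold hden at G0 ⊢
    linarith

/-- Exponential smallness of the solution away from the solitons. -/
lemma Out.gap (hu : IsGKdVSolution u) (ho : Out u N c Δ) (hN : 0 < N) :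
    ∃ K ν κ T, 0 < K ∧ 0 < ν ∧ 0 < κ ∧ 0 ≤ T ∧ ∀ t, T ≤ t → ∀ r, r ≤ κ * t →
      ∫ x in far N (fun i => c i * t + Δ i) r, hden u t x ≤ K * exp (-(ν * r)) := by
  obtain ⟨B, B0, hB⟩ := exists_HB hu
  obtain ⟨r0, L, E, κ, ν0, T, L0, E0, κ0, ν00, T0, h⟩ := ho.gap_recursion hu hN
  set ν := min (log 2 / L) (ν0 / κ) with hν
  have ν_pos : 0 < ν := lt_min (div_pos (log_pos (by norm_num)) L0) (div_pos ν00 κ0)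
  have ν1 : ν * L ≤ log 2 := by rw [← le_div_iff₀ L0]; exact min_le_left _ _
  have ν2 : ν * κ ≤ ν0 := by rw [← le_div_iff₀ κ0]; exact min_le_right _ _
  set K := B * exp (ν * (r0 + L)) + 2 * E with hK
  have K0 : 0 < K := by positivity
  refine ⟨K, ν, κ, T, K0, ν_pos, κ0, T0, fun t ht => ?_⟩
  have t0 : 0 ≤ t := T0.trans ht
  have base : ∀ r, r ≤ r0 + L →
      ∫ x in far N (fun i => c i * t + Δ i) r, hden u t x ≤ K * exp (-(ν * r)) := fun r hr => by
    have e1 := (setIntegral_le_integral (s := far N (fun i => c i * t + Δ i) r) (hden_int hu t)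
      (Eventually.of_forall fun x => hden_nonneg (u := u) t x)).trans (hB t t t ⟨le_rfl, le_rfl⟩)
    refine e1.trans ?_
    have e2 : 1 ≤ exp (ν * (r0 + L)) * exp (-(ν * r)) := by
      rw [← exp_add]
      refine one_le_exp ?_
      linarith [mul_le_mul_of_nonneg_left hr ν_pos.le]
    have e3 := mul_le_mul_of_nonneg_left e2 B0
    have e4 : 0 ≤ 2 * E * exp (-(ν * r)) := by positivity
    rw [hK]; linarith
  have ind : ∀ n : ℕ, ∀ r, r ≤ r0 + L + n * L → r ≤ κ * t →
      ∫ x in far N (fun i => c i * t + Δ i) r, hden u t x ≤ K * exp (-(ν * r)) := fun n => by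
    induction n with
    | zero => exact fun r hr _ => base r (by simpa using hr)
    | succ n ih =>
      intro r hr hrt
      rcases le_total r (r0 + L) with h' | h'
      · exact base r h'
      have e1 := ih (r - L) (by push_cast at hr; linarith) (by linarith)
      have e2 := h t ht (r - L) (by linarith) (by linarith)
      rw [sub_add_cancel] at e2
      have e3 : exp (-(ν * (r - L))) ≤ 2 * exp (-(ν * r)) := by
        rw [show -(ν * (r - L)) = ν * L + -(ν * r) by ring, exp_add]
        refine mul_le_mul_of_nonneg_right ?_ (exp_pos _).le
        rw [← exp_log (by norm_num : (0 : ℝ) < 2)]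
        exact exp_le_exp.2 ν1
      have e4 : exp (-(ν0 * t)) ≤ exp (-(ν * r)) := exp_le_exp.2 (by
        have q1 := mul_le_mul_of_nonneg_left hrt ν_pos.le
        have q2 := mul_le_mul_of_nonneg_right ν2 t0
        linarith)
      have e5 := mul_le_mul_of_nonneg_left e3 K0.le
      have e6 := mul_le_mul_of_nonneg_left e4 E0.le
      have e7 : 2 * E * exp (-(ν * r)) ≤ K * exp (-(ν * r)) :=
        mul_le_mul_of_nonneg_right (by rw [hK]; have := exp_pos (ν * (r0 + L)); nlinarith)
          (exp_pos _).le
      linarith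
  intro r hr
  obtain ⟨n, hn⟩ := exists_nat_ge ((r - (r0 + L)) / L)
  exact ind n r (by rw [div_le_iff₀ L0] at hn; linarith) hr

end GKdV

namespace GKdV

variable {u : ℝ → ℝ → ℝ} {N M : ℕ} {c Δ c' Δ' : ℕ → ℝ}

lemma sq_le_local (hu : IsGKdVSolution u) (t x : ℝ) {s : Set ℝ} (hs : Set.Ioo x (x + 1) ⊆ s) :
    u t x ^ 2 ≤ 2 * ∫ y in s, hden u t y := by
  have sm := sol_sm hu
  obtain ⟨z, hz, h1⟩ := exists_sq_le_avg (sm.cont_x t) one_pos (hden_int hu t)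
    (fun x => by unfold hden; linarith [sq_nonneg (px u t x)]) hs
  rw [div_one] at h1
  have h2 : ∫ y in x..z, 2 * (u t y * px u t y) = u t z ^ 2 - u t x ^ 2 :=
    intervalIntegral.integral_eq_sub_of_hasDerivAt (f := fun y => u t y ^ 2)
      (fun y _ => ((sm.hasDerivAt_x t y).pow 2).congr_deriv (by norm_num; ring))
      (Continuous.intervalIntegrable (by
        have := sm.cont_x t
        have := sm.px.cont_x t
        fun_prop) _ _)
  have h3 : ∫ y in x..z, -(2 * (u t y * px u t y)) ≤ ∫ y in x..z, hden u t y :=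
    intervalIntegral.integral_mono_on hz.1
      (Continuous.intervalIntegrable (by
        have := sm.cont_x t
        have := sm.px.cont_x t
        fun_prop) _ _) ((hden_sm sm).cont_x t |>.intervalIntegrable _ _) fun y _ => by
        unfold hden; linarith [sq_nonneg (u t y + px u t y)]
  have h4 : ∫ y in x..z, hden u t y ≤ ∫ y in s, hden u t y := by
    rw [intervalIntegral.integral_of_le hz.1, integral_Ioc_eq_integral_Ioo]
    exact setIntegral_mono_set (hden_int hu t).integrableOn
      (Eventually.of_forall fun y => hden_nonneg (u := u) t y)
      (((Set.Ioo_subset_Ioo_right hz.2).trans hs).eventuallyLE)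
  rw [intervalIntegral.integral_neg, h2] at h3
  linarith

/-- Pointwise form of the smallness away from the solitons. -/
lemma Out.gap_pointwise (hu : IsGKdVSolution u) (ho : Out u N c Δ) (hN : 0 < N) :
    ∃ K ν μ T, 0 < K ∧ 0 < ν ∧ 0 < μ ∧ 0 ≤ T ∧ ∀ t, T ≤ t → ∀ x, u t x ^ 2 ≤
      K * ((∑ i ∈ Finset.Ioc 0 N, exp (-(ν * |x - (c i * t + Δ i)|))) + exp (-(μ * t))) := by
  obtain ⟨K, ν, κ, T, K0, ν0, κ0, T0, h⟩ := ho.gap hu hN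
  refine ⟨2 * K * exp ν, ν, ν * κ, T, by positivity, ν0, by positivity, T0, fun t ht x => ?_⟩
  obtain ⟨i, hi, hmin⟩ := Finset.exists_min_image (Finset.Ioc 0 N) (fun i => |x - (c i * t + Δ i)|)
    ⟨1, Finset.mem_Ioc.2 ⟨one_pos, hN⟩⟩
  set d := |x - (c i * t + Δ i)| with hd
  have e1 := sq_le_local hu t x (s := far N (fun i => c i * t + Δ i) (min (d - 1) (κ * t)))
    fun z hz j hj => by
      refine (min_le_left _ _).trans_lt ?_
      have q := hmin j hj
      have q2 : |x - (c j * t + Δ j)| ≤ |x - z| + |z - (c j * t + Δ j)| := abs_sub_le _ _ _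
      have q3 : |x - z| < 1 := abs_lt.2 ⟨by linarith [hz.2], by linarith [hz.1]⟩
      dsimp only at q ⊢
      linarith
  have e2 := h t ht _ (min_le_right (d - 1) (κ * t))
  have e3 : exp (-(ν * min (d - 1) (κ * t))) ≤ exp ν * (exp (-(ν * d)) + exp (-(ν * κ * t))) := by
    rw [mul_add, ← exp_add, ← exp_add]
    rcases min_choice (d - 1) (κ * t) with q | q <;> rw [q]
    · rw [show -(ν * (d - 1)) = ν + -(ν * d) by ring]
      exact le_add_of_nonneg_right (exp_pos _).le
    · refine le_trans (exp_le_exp.2 ?_) (le_add_of_nonneg_left (exp_pos _).le)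
      linarith
  have e4 : exp (-(ν * d)) ≤ ∑ i ∈ Finset.Ioc 0 N, exp (-(ν * |x - (c i * t + Δ i)|)) :=
    Finset.single_le_sum (f := fun i => exp (-(ν * |x - (c i * t + Δ i)|)))
      (fun i _ => (exp_pos _).le) hi
  calc u t x ^ 2 ≤ 2 * (K * (exp ν * (exp (-(ν * d)) + exp (-(ν * κ * t))))) :=
        e1.trans (mul_le_mul_of_nonneg_left (e2.trans (mul_le_mul_of_nonneg_left e3 K0.le)) (by norm_num))
    _ = 2 * K * exp ν * (exp (-(ν * d)) + exp (-(ν * κ * t))) := by ring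
    _ ≤ _ := mul_le_mul_of_nonneg_left (by linarith) (by positivity)

/-- Exponential localization in space, locally uniformly in time. -/
lemma two_sided_tail (hu : IsGKdVSolution u) (ho : Out u N c Δ)
    (hi : Out (fun t x => u (-t) (-x)) M c' Δ') :
    ∃ V b0, 0 < V ∧ 0 < b0 ∧ ∀ b, 0 < b → b ≤ b0 →
      ∃ C, 0 < C ∧ ∀ t x, |u t x| ≤ C * exp (b * (V * |t| - |x|)) := by
  obtain ⟨g, g0, hg⟩ := exists_pos_le_of_finset _ c ho.pos
  obtain ⟨g', g0', hg'⟩ := exists_pos_le_of_finset _ c' hi.pos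
  set m := min g g' / 2 with hm
  have m0 : 0 < m := half_pos (lt_min g0 g0')
  have m1 : m < g := by linarith [min_le_left g g']
  have m2 : m < g' := by linarith [min_le_right g g']
  set S := ∑ j ∈ Finset.Icc 1 N, c j with hS
  set S' := ∑ j ∈ Finset.Icc 1 M, c' j with hS'
  have S0 : 0 ≤ S := Finset.sum_nonneg fun j hj => (ho.pos j hj).le
  have S0' : 0 ≤ S' := Finset.sum_nonneg fun j hj => (hi.pos j hj).le
  have cS : ∀ j ∈ Finset.Icc 1 N, c j ≤ S := fun j hj =>
    Finset.single_le_sum (f := c) (fun j hj => (ho.pos j hj).le) hj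
  have cS' : ∀ j ∈ Finset.Icc 1 M, c' j ≤ S' := fun j hj =>
    Finset.single_le_sum (f := c') (fun j hj => (hi.pos j hj).le) hj
  refine ⟨g + S + S', m / (1 + m), by positivity, by positivity, fun b b0 hb => ?_⟩
  set V := g + S + S' with hV
  have V0 : 0 < V := by positivity
  have hbm : (2 * b) ^ 2 / 4 < m := by
    have e1 : b * (1 + m) ≤ m := by rwa [le_div_iff₀ (by positivity)] at hb
    have e2 : b < 1 := by nlinarith
    nlinarith
  obtain ⟨C, C0, hC⟩ := right_tail hu ho hi (by positivity) hbm m2 hg' (by linarith : m < V)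
    fun j hj => by linarith [cS j hj]
  have ho' : Out (fun t x => (fun t x => u (-t) (-x)) (-t) (-x)) N c Δ := by simpa using ho
  obtain ⟨C', C0', hC'⟩ := right_tail (reflect_sol hu) hi ho' (by positivity) hbm m1 hg
    (by linarith : m < V) fun j hj => by linarith [cS' j hj]
  refine ⟨C + C', by positivity, fun t x => ?_⟩
  rw [add_mul]
  have t1 : max t 0 ≤ |t| := max_le (le_abs_self t) (abs_nonneg t)
  have t2 : max (-t) 0 ≤ |t| := max_le (neg_le_abs t) (abs_nonneg t)
  rcases le_total 0 x with hx | hx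
  · refine (hC t x).trans (le_trans ?_ (le_add_of_nonneg_right (by positivity)))
    refine mul_le_mul_of_nonneg_left (exp_le_exp.2 ?_) C0.le
    rw [abs_of_nonneg hx]
    linarith [mul_le_mul_of_nonneg_left t1 (mul_pos b0 V0).le]
  · have h := hC' (-t) (-x)
    simp only [neg_neg] at h
    refine h.trans (le_trans ?_ (le_add_of_nonneg_left (by positivity)))
    refine mul_le_mul_of_nonneg_left (exp_le_exp.2 ?_) C0'.le
    rw [abs_of_nonpos hx]
    linarith [mul_le_mul_of_nonneg_left t2 (mul_pos b0 V0).le]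

lemma bddL1_of_outs (hu : IsGKdVSolution u) (ho : Out u N c Δ)
    (hi : Out (fun t x => u (-t) (-x)) M c' Δ') (a b : ℝ) : BddL1 u a b := by
  obtain ⟨V, b0, V0, b00, h⟩ := two_sided_tail hu ho hi
  obtain ⟨C, C0, hC⟩ := h b0 b00 le_rfl
  have hg : BddL1 (fun _ x => exp (-(b0 * |x|))) a b :=
    ⟨∫ x, |exp (-(b0 * |x|))|, fun t _ => ⟨integrable_exp_abs b00, le_rfl⟩⟩
  refine hg.of_le (fun t => (sol_sm hu).cont_x t) (C * exp (b0 * (V * (|a| + |b|)))) fun t ht x => ?_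
  refine (hC t x).trans ?_
  rw [abs_of_pos (exp_pos _), mul_assoc, ← exp_add]
  refine mul_le_mul_of_nonneg_left (exp_le_exp.2 ?_) C0.le
  have : |t| ≤ |a| + |b| := abs_le.2
    ⟨by linarith [ht.1, neg_abs_le a, abs_nonneg b], by linarith [ht.2, le_abs_self b, abs_nonneg a]⟩
  linarith [mul_le_mul_of_nonneg_left this (mul_pos b00 V0).le]

lemma integrable_of_outs (hu : IsGKdVSolution u) (ho : Out u N c Δ)
    (hi : Out (fun t x => u (-t) (-x)) M c' Δ') (t : ℝ) : Integrable (u t) := by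
  obtain ⟨C, hC⟩ := bddL1_of_outs hu ho hi t t
  exact (hC t ⟨le_rfl, le_rfl⟩).1

lemma integral_conserved (hu : IsGKdVSolution u) (ho : Out u N c Δ)
    (hi : Out (fun t x => u (-t) (-x)) M c' Δ') {a b : ℝ} (hab : a ≤ b) :
    ∫ x, u b x = ∫ x, u a x := by
  obtain ⟨B, B0, hB⟩ := exists_HB hu
  have h := bddL1_of_outs hu ho hi a b
  refine (integral_law hu).conserved hab (integrable_of_outs hu ho hi a) (integrable_of_outs hu ho hi b)
    (h.of_le (fun t => ((sol_sm hu).cont_x t |>.pow 4).const_mul _) ((1 + B) ^ 3) fun t ht x => ?_)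
    (BddL1.zero a b) (h.of_le (fun t => ((sol_sm hu).cont_x t).const_mul _) 1 fun t ht x => by simp)
  rw [abs_mul, abs_neg, abs_one, one_mul, abs_pow, pow_succ]
  exact mul_le_mul_of_nonneg_right (pow_le_pow_left₀ (abs_nonneg _) ((hB a b).ptw hu ht x) 3)
    (abs_nonneg _)

end GKdV

namespace GKdV

variable {u : ℝ → ℝ → ℝ} {N M : ℕ} {c Δ c' Δ' : ℕ → ℝ}

/-- A fixed exponential profile dominates the solution for large times. -/
lemma Out.sq_dom (hu : IsGKdVSolution u) (ho : Out u N c Δ)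
    (hi : Out (fun t x => u (-t) (-x)) M c' Δ') (hN : 0 < N) :
    ∃ K ν b T, 0 < K ∧ 0 < ν ∧ 0 < b ∧ ∀ t, T ≤ t → ∀ x, u t x ^ 2 ≤
      K * ((∑ i ∈ Finset.Ioc 0 N, exp (-(ν * |x - (c i * t + Δ i)|))) + exp (-(b * |x|))) := by
  obtain ⟨K, ν, μ, T, K0, ν0, μ0, T0, h⟩ := ho.gap_pointwise hu hN
  obtain ⟨V, b0, V0, b00, h'⟩ := two_sided_tail hu ho hi
  set b := min b0 (μ / (2 * V)) with hb
  have hb0 : 0 < b := lt_min b00 (by positivity)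
  obtain ⟨C, C0, hC⟩ := h' b hb0 (min_le_left _ _)
  have bV : b * V ≤ μ / 2 := by
    have : b ≤ μ / (2 * V) := min_le_right _ _
    rw [le_div_iff₀ (by positivity)] at this; linarith
  refine ⟨2 * K + (2 * K + 1) * C, ν, b, T, by positivity, ν0, hb0, fun t ht x => ?_⟩
  have t0 := T0.trans ht
  have e1 := h t ht x
  set Y := ∑ i ∈ Finset.Ioc 0 N, exp (-(ν * |x - (c i * t + Δ i)|)) with hY
  have Y0 : 0 ≤ Y := Finset.sum_nonneg fun i _ => (exp_pos _).le
  have s0 := exp_pos (-(b * |x|))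
  rcases le_total (exp (-(μ * t))) Y with q | q
  · calc u t x ^ 2 ≤ 2 * K * Y := by
          refine e1.trans ?_
          rw [mul_comm 2 K, mul_assoc]
          exact mul_le_mul_of_nonneg_left (by linarith) K0.le
      _ ≤ _ := mul_le_mul (le_add_of_nonneg_right (by positivity)) (by linarith) Y0 (by positivity)
  · have e2 : u t x ^ 2 ≤ (2 * K + 1) ^ 2 * exp (-(μ / 2 * t)) ^ 2 := by
      rw [← exp_nat_mul, show ((2 : ℕ) : ℝ) * -(μ / 2 * t) = -(μ * t) by push_cast; ring]
      have q2 := exp_pos (-(μ * t))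
      refine e1.trans (le_trans (mul_le_mul_of_nonneg_left (by linarith : _ ≤ 2 * exp (-(μ * t))) K0.le) ?_)
      rw [← mul_assoc]
      refine mul_le_mul_of_nonneg_right ?_ q2.le
      nlinarith
    rw [← mul_pow] at e2
    have e3 : |u t x| ≤ (2 * K + 1) * exp (-(μ / 2 * t)) := abs_le_of_sq_le_sq e2 (by positivity)
    have e4 := hC t x
    rw [← _root_.sq_abs, _root_.sq]
    calc |u t x| * |u t x| ≤ ((2 * K + 1) * exp (-(μ / 2 * t))) * (C * exp (b * (V * |t| - |x|))) :=
          mul_le_mul e3 e4 (abs_nonneg _) (by positivity)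
      _ = (2 * K + 1) * C * (exp (-(μ / 2 * t)) * exp (b * (V * |t| - |x|))) := by ring
      _ ≤ (2 * K + 1) * C * exp (-(b * |x|)) := by
          refine mul_le_mul_of_nonneg_left ?_ (by positivity)
          rw [← exp_add, exp_le_exp, abs_of_nonneg t0]
          linarith [mul_le_mul_of_nonneg_right bV t0]
      _ ≤ _ := mul_le_mul (le_add_of_nonneg_left (by positivity)) (by linarith) s0.le (by positivity)

lemma exp_pow_four_le {ν d w : ℝ} (hd : 0 ≤ d) (h : w ≤ ν / 4) : exp (-(ν * d)) ≤ exp (-(w * d)) ^ 4 := by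
  rw [← exp_nat_mul, exp_le_exp]
  push_cast
  linarith [mul_le_mul_of_nonneg_right h hd]

/-- The remainder is dominated by an integrable profile, to the fourth power. -/
lemma Out.rem_dom (hu : IsGKdVSolution u) (ho : Out u N c Δ)
    (hi : Out (fun t x => u (-t) (-x)) M c' Δ') (hN : 0 < N) :
    ∃ K w T, 0 < K ∧ 0 < w ∧ ∀ t, T ≤ t → ∀ x, rem u N c Δ t x ^ 2 ≤
      K * ((∑ i ∈ Finset.Ioc 0 N, exp (-(w * |x - (c i * t + Δ i)|))) + exp (-(w * |x|))) ^ 4 := by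
  obtain ⟨K, ν, b, T, K0, ν0, b0, h⟩ := ho.sq_dom hu hi hN
  obtain ⟨k, k0, hk⟩ := exists_pos_le_of_finset (Finset.Ioc 0 N) (fun i => √(c i))
    fun i hi => sqrt_pos.2 (ho.pos i hi)
  set w := min (min ν b) k / 4 with hw
  have w0 : 0 < w := by positivity
  have w1 : w ≤ ν / 4 := by
    have := (min_le_left (min ν b) k).trans (min_le_left _ _); linarith
  have w2 : w ≤ b / 4 := by
    have := (min_le_left (min ν b) k).trans (min_le_right _ _); linarith
  have w3 : w ≤ k / 2 := by
    have := min_le_right (min ν b) k; linarith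
  set S := ∑ i ∈ Finset.Ioc 0 N, 3 * rt (c i) ^ 2 with hS
  have S0 : 0 ≤ S := Finset.sum_nonneg fun i hi => by positivity
  refine ⟨2 * K + 2 * S ^ 2, w, T, by positivity, w0, fun t ht x => ?_⟩
  set G := (∑ i ∈ Finset.Ioc 0 N, exp (-(w * |x - (c i * t + Δ i)|))) + exp (-(w * |x|)) with hG
  have gi : ∀ i ∈ Finset.Ioc 0 N, exp (-(w * |x - (c i * t + Δ i)|)) ≤
      ∑ i ∈ Finset.Ioc 0 N, exp (-(w * |x - (c i * t + Δ i)|)) := fun i hi =>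
    Finset.single_le_sum (f := fun i => exp (-(w * |x - (c i * t + Δ i)|)))
      (fun i _ => (exp_pos _).le) hi
  have Y0 : 0 ≤ ∑ i ∈ Finset.Ioc 0 N, exp (-(w * |x - (c i * t + Δ i)|)) :=
    Finset.sum_nonneg fun i _ => (exp_pos _).le
  have G0 : 0 ≤ G := add_nonneg Y0 (exp_pos _).le
  have e1 : u t x ^ 2 ≤ K * G ^ 4 := by
    refine (h t ht x).trans (mul_le_mul_of_nonneg_left ?_ K0.le)
    set Y := ∑ i ∈ Finset.Ioc 0 N, exp (-(w * |x - (c i * t + Δ i)|)) with hY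
    have q1 : ∑ i ∈ Finset.Ioc 0 N, exp (-(ν * |x - (c i * t + Δ i)|)) ≤ Y ^ 3 * Y := by
      rw [hY, Finset.mul_sum, ← hY]
      refine Finset.sum_le_sum fun i hi => (exp_pow_four_le (abs_nonneg _) w1).trans ?_
      rw [pow_succ]
      exact mul_le_mul_of_nonneg_right (pow_le_pow_left₀ (exp_pos _).le (gi i hi) 3) (exp_pos _).le
    have q2 : exp (-(b * |x|)) ≤ exp (-(w * |x|)) ^ 4 := exp_pow_four_le (abs_nonneg _) w2
    have q3 : 0 < exp (-(w * |x|)) := exp_pos _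
    rw [hG]
    set e := exp (-(w * |x|))
    calc _ ≤ Y ^ 3 * Y + e ^ 4 := add_le_add q1 q2
      _ ≤ (Y + e) ^ 4 := by
        have : 0 ≤ 4 * Y ^ 3 * e + 6 * Y ^ 2 * e ^ 2 + 4 * Y * e ^ 3 := by positivity
        linarith
  have e2 : ∑ j ∈ Finset.Icc 1 N, Qc (c j) (x - (c j * t + Δ j)) ≤ S * G ^ 2 := by
    rw [hS, Finset.sum_mul]
    refine Finset.sum_le_sum fun i hi => (Qc_le_exp (ho.pos i hi) _).trans ?_
    refine mul_le_mul_of_nonneg_left ?_ (by positivity)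
    calc exp (-(√(c i) * |x - (c i * t + Δ i)|)) ≤ exp (-(w * |x - (c i * t + Δ i)|)) ^ 2 := by
          rw [← exp_nat_mul, exp_le_exp]
          push_cast
          have := mul_le_mul_of_nonneg_right (by linarith [hk i hi] : 2 * w ≤ √(c i))
            (abs_nonneg (x - (c i * t + Δ i)))
          linarith
      _ ≤ G ^ 2 := pow_le_pow_left₀ (exp_pos _).le ((gi i hi).trans
          (le_add_of_nonneg_right (exp_pos _).le)) 2
  have e3 : 0 ≤ ∑ j ∈ Finset.Icc 1 N, Qc (c j) (x - (c j * t + Δ j)) :=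
    Finset.sum_nonneg fun j hj => (Qc_pos (ho.pos j hj) _).le
  have e4 := pow_le_pow_left₀ e3 e2 2
  unfold rem
  set P := ∑ j ∈ Finset.Icc 1 N, Qc (c j) (x - (c j * t + Δ j))
  linarith [sq_nonneg (u t x + P)]

/-- The integral of the solution converges to the sum of the integrals of its solitons. -/
lemma Out.integral_eq (hu : IsGKdVSolution u) (ho : Out u N c Δ)
    (hi : Out (fun t x => u (-t) (-x)) M c' Δ') (hN : 0 < N) :
    ∫ x, u 0 x = ∑ j ∈ Finset.Icc 1 N, qint / rt (c j) := by
  obtain ⟨K, w, T, K0, w0, h⟩ := ho.rem_dom hu hi hN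
  set I := ∫ x, exp (-(w * |x|)) with hI
  have I0 : 0 ≤ I := integral_nonneg fun x => (exp_pos _).le
  have iQ : ∀ t, ∀ j ∈ Finset.Icc 1 N, Integrable fun x => Qc (c j) (x - (c j * t + Δ j)) :=
    fun t j hj => (prof_Qc (ho.pos j hj)).int.comp_sub_right _
  have iR : ∀ t, Integrable (rem u N c Δ t) := fun t =>
    (integrable_of_outs hu ho hi t).sub (integrable_finsetSum _ (iQ t))
  have split : ∀ t, 0 ≤ t →
      ∫ x, u 0 x = (∑ j ∈ Finset.Icc 1 N, qint / rt (c j)) + ∫ x, rem u N c Δ t x := fun t t0 => by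
    rw [← integral_conserved hu ho hi t0]
    unfold rem
    rw [integral_sub (integrable_of_outs hu ho hi t) (integrable_finsetSum _ (iQ t)),
      integral_finsetSum _ (iQ t)]
    have : ∀ j ∈ Finset.Icc 1 N, ∫ x, Qc (c j) (x - (c j * t + Δ j)) = qint / rt (c j) :=
      fun j hj => by rw [integral_sub_right_eq_self (Qc (c j)), integral_Qc (ho.pos j hj)]
    rw [Finset.sum_congr rfl this]; ring
  set D := (1 + K) * ((N + 1) * I) with hD
  have D0 : 0 ≤ D := by positivity
  have key : ∀ δ, 0 < δ → |(∫ x, u 0 x) - ∑ j ∈ Finset.Icc 1 N, qint / rt (c j)| ≤ δ * D := by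
    intro δ δ0
    obtain ⟨t, ht, hT, t0⟩ := ((ho.rem_small hu (by positivity : 0 < δ ^ 2)).and
      ((eventually_ge_atTop T).and (eventually_ge_atTop 0))).exists
    rw [split t t0, add_sub_cancel_left]
    have iG : ∀ i ∈ Finset.Ioc 0 N, Integrable fun x => exp (-(w * |x - (c i * t + Δ i)|)) :=
      fun i _ => (integrable_exp_abs w0).comp_sub_right _
    have eG : ∫ x, ((∑ i ∈ Finset.Ioc 0 N, exp (-(w * |x - (c i * t + Δ i)|))) + exp (-(w * |x|))) =
        (N + 1) * I := by
      rw [integral_add (integrable_finsetSum _ iG) (integrable_exp_abs w0), integral_finsetSum _ iG]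
      have : ∀ i ∈ Finset.Ioc 0 N, ∫ x, exp (-(w * |x - (c i * t + Δ i)|)) = I := fun i _ =>
        integral_sub_right_eq_self (fun x => exp (-(w * |x|))) _
      rw [Finset.sum_congr rfl this, Finset.sum_const, Nat.card_Ioc, nsmul_eq_mul, tsub_zero, ← hI]
      ring
    have iS : Integrable fun x => δ * (1 + K) *
        ((∑ i ∈ Finset.Ioc 0 N, exp (-(w * |x - (c i * t + Δ i)|))) + exp (-(w * |x|))) :=
      ((integrable_finsetSum _ iG).add (integrable_exp_abs w0)).const_mul _
    calc |∫ x, rem u N c Δ t x|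
        ≤ ∫ x, δ * (1 + K) *
          ((∑ i ∈ Finset.Ioc 0 N, exp (-(w * |x - (c i * t + Δ i)|))) + exp (-(w * |x|))) := by
          refine norm_integral_le_of_norm_le (f := rem u N c Δ t) iS (Eventually.of_forall fun x => ?_)
          have r1 := h t hT x
          have r2 := ht x
          rw [norm_eq_abs]
          set R := rem u N c Δ t x
          set G := (∑ i ∈ Finset.Ioc 0 N, exp (-(w * |x - (c i * t + Δ i)|))) + exp (-(w * |x|))
          have G0 : 0 ≤ G := add_nonneg (Finset.sum_nonneg fun i _ => (exp_pos _).le) (exp_pos _).le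
          refine (pow_le_pow_iff_left₀ (abs_nonneg R) (by positivity) (by norm_num : 4 ≠ 0)).1 ?_
          calc |R| ^ 4 = |R| ^ 2 * R ^ 2 := by rw [← _root_.sq_abs R]; ring
            _ ≤ (δ ^ 2) ^ 2 * (K * G ^ 4) :=
              mul_le_mul (pow_le_pow_left₀ (abs_nonneg _) r2 2) r1 (sq_nonneg _) (by positivity)
            _ = K * (δ * G) ^ 4 := by ring
            _ ≤ (1 + K) ^ 4 * (δ * G) ^ 4 := by
              refine mul_le_mul_of_nonneg_right ?_ (by positivity)
              have : 1 ≤ (1 + K) ^ 3 := one_le_pow₀ (by linarith)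
              have := mul_le_mul_of_nonneg_right this (by positivity : 0 ≤ 1 + K)
              linarith
            _ = (δ * (1 + K) * G) ^ 4 := by ring
      _ = δ * D := by rw [integral_const_mul, eG, hD]; ring
  by_contra hne
  have pos : 0 < |(∫ x, u 0 x) - ∑ j ∈ Finset.Icc 1 N, qint / rt (c j)| := abs_pos.2 (sub_ne_zero.2 hne)
  set X := |(∫ x, u 0 x) - ∑ j ∈ Finset.Icc 1 N, qint / rt (c j)|
  have := key (X / (2 * (D + 1))) (by positivity)
  rw [div_mul_eq_mul_div, le_div_iff₀ (by positivity)] at this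
  linarith [mul_nonneg pos.le D0]

/-- The invariants of the incoming and outgoing solitons agree. -/
lemma sums_eq (hu : IsGKdVSolution u) (ho : Out u N c Δ)
    (hi : Out (fun t x => u (-t) (-x)) M c' Δ') (hN : 0 < N) (hM : 0 < M) :
    ∑ j ∈ Finset.Icc 1 N, 1 / rt (c j) = ∑ j ∈ Finset.Icc 1 M, 1 / rt (c' j) ∧
    ∑ j ∈ Finset.Icc 1 N, rt (c j) = ∑ j ∈ Finset.Icc 1 M, rt (c' j) ∧
    ∑ j ∈ Finset.Icc 1 N, rt (c j) ^ 7 = ∑ j ∈ Finset.Icc 1 M, rt (c' j) ^ 7 := by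
  have hu' := reflect_sol hu
  have ho' : Out (fun t x => (fun t x => u (-t) (-x)) (-t) (-x)) N c Δ := by simpa using ho
  have e1 := ho.integral_eq hu hi hN
  have e2 := hi.integral_eq hu' ho' hM
  simp only [neg_zero] at e2
  rw [integral_neg_eq_self (u 0) volume, e1] at e2
  have e : ∀ x, en (fun t x => u (-t) (-x)) 0 x = en u 0 (-x) := fun x => by
    simp only [en, reflect_px (sol_sm hu), neg_zero]; ring
  have tot : ∀ l, ∑ j ∈ Finset.Icc 1 N, sol1 l (c j) = ∑ j ∈ Finset.Icc 1 M, sol1 l (c' j) := fun l => by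
    rw [← ho.total hu l 0, ← hi.total hu' l 0]
    simp only [e, neg_zero]
    exact (integral_neg_eq_self (fun x => en u 0 x + l * u 0 x ^ 2) volume).symm
  have ex : ∀ (n : ℕ) (d : ℕ → ℝ) l, ∑ j ∈ Finset.Icc 1 n, sol1 l (d j) =
      -(qmass / 14) * ∑ j ∈ Finset.Icc 1 n, rt (d j) ^ 7 +
        l * (qmass * ∑ j ∈ Finset.Icc 1 n, rt (d j)) := fun n d l => by
    simp only [sol1, Finset.sum_add_distrib, Finset.mul_sum]
  have t0 := tot 0
  have t1 := tot 1
  rw [ex, ex] at t0 t1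
  have q0 := qmass_pos
  have q1 := qint_pos
  refine ⟨?_, ?_, ?_⟩
  · refine mul_left_cancel₀ q1.ne' ?_
    simpa [Finset.mul_sum, div_eq_mul_inv] using e2
  · refine mul_left_cancel₀ q0.ne' ?_
    linarith
  · refine mul_left_cancel₀ q0.ne' ?_
    linarith

end GKdV

namespace GKdV

/-- Invariants close to those of unit solitons force all sizes to be close to one. -/
lemma sizes_near_one {N M : ℕ} {a b : ℕ → ℝ} (ha : ∀ j ∈ Finset.Icc 1 N, 3 / 4 ≤ a j ^ 6)
    (ha0 : ∀ j ∈ Finset.Icc 1 N, 0 < a j) (ha1 : ∀ j ∈ Finset.Icc 1 N, a j ≤ 1)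
    (hs : ∑ j ∈ Finset.Icc 1 N, (1 - a j ^ 6) ^ 2 ≤ 1 / 16) (hb0 : ∀ j ∈ Finset.Icc 1 M, 0 < b j)
    (hinv : ∑ j ∈ Finset.Icc 1 N, 1 / a j = ∑ j ∈ Finset.Icc 1 M, 1 / b j)
    (hmass : ∑ j ∈ Finset.Icc 1 N, a j = ∑ j ∈ Finset.Icc 1 M, b j)
    (hen : ∑ j ∈ Finset.Icc 1 N, a j ^ 7 = ∑ j ∈ Finset.Icc 1 M, b j ^ 7)
    {k : ℕ} (hk : k ∈ Finset.Icc 1 M) : 9 / 10 < b k := by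
  have fact : ∀ z : ℝ, 6 - 7 * z + z ^ 7 =
      (1 - z) ^ 2 * (z ^ 5 + 2 * z ^ 4 + 3 * z ^ 3 + 4 * z ^ 2 + 5 * z + 6) := fun z => by ring
  have sq_a : ∀ j ∈ Finset.Icc 1 N, (1 - a j) ^ 2 ≤ 4 / 81 * (1 - a j ^ 6) ^ 2 := fun j hj => by
    have h0 := ha0 j hj
    have h1 := ha1 j hj
    have h6 := ha j hj
    have p : ∀ n ≤ 6, 3 / 4 ≤ a j ^ n := fun n hn => h6.trans (pow_le_pow_of_le_one h0.le h1 hn)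
    have e : 1 - a j ^ 6 = (1 - a j) * (1 + a j ^ 1 + a j ^ 2 + a j ^ 3 + a j ^ 4 + a j ^ 5) := by ring
    have e2 : 9 / 2 * (1 - a j) ≤ 1 - a j ^ 6 := by
      rw [e, mul_comm (9 / 2)]
      refine mul_le_mul_of_nonneg_left ?_ (by linarith)
      have p1 := p 1 (by norm_num)
      have p2 := p 2 (by norm_num)
      have p3 := p 3 (by norm_num)
      have p4 := p 4 (by norm_num)
      have p5 := p 5 (by norm_num)
      linarith
    have := pow_le_pow_left₀ (by linarith) e2 2
    linarith
  have sum_sq : ∑ j ∈ Finset.Icc 1 N, (1 - a j) ^ 2 ≤ 1 / 324 := by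
    refine (Finset.sum_le_sum sq_a).trans ?_
    rw [← Finset.mul_sum]; linarith
  have cardN : ∑ j ∈ Finset.Icc 1 N, (1 : ℝ) = N := by simp
  have cardM : ∑ j ∈ Finset.Icc 1 M, (1 : ℝ) = M := by simp
  have low : 6 * (N : ℝ) - 21 / 324 ≤ 7 * ∑ j ∈ Finset.Icc 1 N, a j - ∑ j ∈ Finset.Icc 1 N, a j ^ 7 := by
    have : ∑ j ∈ Finset.Icc 1 N, (6 * 1 - 21 * (1 - a j) ^ 2) ≤
        ∑ j ∈ Finset.Icc 1 N, (7 * a j - a j ^ 7) := Finset.sum_le_sum fun j hj => by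
      have h0 := ha0 j hj
      have p : ∀ n, a j ^ n ≤ 1 := fun n => pow_le_one₀ h0.le (ha1 j hj)
      have := mul_le_mul_of_nonneg_left (by linarith [p 5, p 4, p 3, p 2, ha1 j hj] :
        a j ^ 5 + 2 * a j ^ 4 + 3 * a j ^ 3 + 4 * a j ^ 2 + 5 * a j + 6 ≤ 21) (sq_nonneg (1 - a j))
      linarith [fact (a j)]
    rw [Finset.sum_sub_distrib, Finset.sum_sub_distrib, ← Finset.mul_sum, ← Finset.mul_sum,
      ← Finset.mul_sum, cardN] at this
    linarith
  have high : 7 * ∑ j ∈ Finset.Icc 1 M, b j - ∑ j ∈ Finset.Icc 1 M, b j ^ 7 ≤ 6 * (M : ℝ) := by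
    have : ∑ j ∈ Finset.Icc 1 M, (7 * b j - b j ^ 7) ≤ ∑ j ∈ Finset.Icc 1 M, (6 * 1 : ℝ) :=
      Finset.sum_le_sum fun j hj => by
        have h0 := hb0 j hj
        have : 0 ≤ (1 - b j) ^ 2 * (b j ^ 5 + 2 * b j ^ 4 + 3 * b j ^ 3 + 4 * b j ^ 2 + 5 * b j + 6) := by
          positivity
        linarith [fact (b j)]
    rw [Finset.sum_sub_distrib, ← Finset.mul_sum, ← Finset.mul_sum, cardM] at this
    exact this
  have hNM : (N : ℝ) ≤ M := by
    have : (N : ℝ) < M + 1 := by rw [hmass, hen] at low; linarith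
    exact_mod_cast Nat.lt_succ_iff.1 (by exact_mod_cast this)
  have expand : ∀ (n : ℕ) (d : ℕ → ℝ), (∀ j ∈ Finset.Icc 1 n, 0 < d j) →
      ∑ j ∈ Finset.Icc 1 n, (1 - d j) ^ 2 / d j =
        ∑ j ∈ Finset.Icc 1 n, 1 / d j - 2 * n + ∑ j ∈ Finset.Icc 1 n, d j := fun n d hd => by
    have c1 : ∑ j ∈ Finset.Icc 1 n, (1 : ℝ) = n := by simp
    rw [← c1, Finset.mul_sum, ← Finset.sum_sub_distrib, ← Finset.sum_add_distrib]
    refine Finset.sum_congr rfl fun j hj => ?_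
    have := (hd j hj).ne'
    field_simp
    ring
  have hA : ∑ j ∈ Finset.Icc 1 N, (1 - a j) ^ 2 / a j ≤ 1 / 243 := by
    have : ∑ j ∈ Finset.Icc 1 N, (1 - a j) ^ 2 / a j ≤ ∑ j ∈ Finset.Icc 1 N, 4 / 3 * (1 - a j) ^ 2 :=
      Finset.sum_le_sum fun j hj => by
        have h0 := ha0 j hj
        have : 3 / 4 ≤ a j := by
          simpa using (ha j hj).trans (pow_le_pow_of_le_one h0.le (ha1 j hj) (by norm_num : 1 ≤ 6))
        rw [div_le_iff₀ h0]
        linarith [mul_le_mul_of_nonneg_left this (sq_nonneg (1 - a j))]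
    rw [← Finset.mul_sum] at this
    linarith
  have hB : (1 - b k) ^ 2 / b k ≤ ∑ j ∈ Finset.Icc 1 M, (1 - b j) ^ 2 / b j :=
    Finset.single_le_sum (f := fun j => (1 - b j) ^ 2 / b j)
      (fun j hj => div_nonneg (sq_nonneg _) (hb0 j hj).le) hk
  rw [expand M b hb0] at hB
  rw [expand N a ha0] at hA
  have : (1 - b k) ^ 2 / b k ≤ 1 / 243 := by linarith
  have h0 := hb0 k hk
  rw [div_le_iff₀ h0] at this
  nlinarith

lemma strictAnti_of_succ {N : ℕ} {c : ℕ → ℝ} (h : ∀ j, 1 ≤ j → j < N → c (j + 1) < c j) :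
    ∀ i ∈ Finset.Icc 1 N, ∀ j ∈ Finset.Icc 1 N, i < j → c j < c i := by
  intro i hi j hj hij
  have h1 := (Finset.mem_Icc.1 hi).1
  have h2 := (Finset.mem_Icc.1 hj).2
  clear hi hj
  induction j, hij using Nat.le_induction with
  | base => exact h i h1 h2
  | succ j hij ih => exact (h j (by omega) h2).trans (ih (by omega))

/-- The speed of the moving point compared with the decay rate. -/
lemma rate_le {a b σ γ : ℝ} (hb : 3 / 4 ≤ b) (hab : b < a) (ha : a ≤ 1) (hσ : σ = √b * (a - b))
    (hγ : γ = √(a - 3 / 4 * b) - 1 / 2 * √b) :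
    2 * σ + 1 / 40 ≤ 7 / 10 * (σ / γ + a - 1) := by
  have p0 : 0 < √b := sqrt_pos.2 (by linarith)
  have p2 : √b ^ 2 = b := sq_sqrt (by linarith)
  have p1 : √b ≤ 1 := sqrt_le_one.2 (by linarith)
  have q2 : √(a - 3 / 4 * b) ^ 2 = a - 3 / 4 * b := sq_sqrt (by linarith)
  have q0 : 1 / 2 * √b < √(a - 3 / 4 * b) := lt_sqrt_of_sq_lt (by rw [mul_pow, p2]; linarith)
  have γ0 : 0 < γ := by linarith
  have e : σ = (√b * γ + b) * γ := by
    have : a - b = γ * (γ + √b) := by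
      rw [hγ]; linear_combination p2 / 4 - q2
    rw [hσ, this]; linear_combination γ * p2
  have e2 : b ≤ σ / γ := by
    rw [e, mul_div_cancel_right₀ _ γ0.ne']
    linarith [mul_pos p0 γ0]
  have e3 : σ ≤ a - b := by
    rw [hσ]; exact mul_le_of_le_one_left (by linarith) p1
  linarith

end GKdV

open GKdV

/-- Pointwise exponential decay of a pure multi-soliton along the line
`x = x₀(t) = (σ₀/γ₀ + c_{j₀}) t − K₀`, for any `K₀ > 1` and `t` large. -/
theorem decay_on_the_right
    (N : ℕ) (hN : 2 ≤ N) (c Δ : ℕ → ℝ)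
    (hc1 : c 1 = 1)
    (hcpos : ∀ j, 1 ≤ j → j ≤ N → 0 < c j)
    (hcdec : ∀ j, 1 ≤ j → j < N → c (j + 1) < c j)
    (hspeeds : ∑ j ∈ Finset.Icc 2 N, (1 - c j) ^ 2 ≤ 1 / 16)
    (u : ℝ → ℝ → ℝ) (hu : IsGKdVSolution u)
    (hout : Tendsto
      (fun t => H1norm (fun x =>
        u t x - ∑ j ∈ Finset.Icc 1 N, Qc (c j) (x - c j * t - Δ j)))
      atTop (nhds 0))
    (M : ℕ) (hM : 2 ≤ M) (c' Δ' : ℕ → ℝ)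
    (hc'pos : ∀ j, 1 ≤ j → j ≤ M → 0 < c' j)
    (hc'dec : ∀ j, 1 ≤ j → j < M → c' (j + 1) < c' j)
    (hin : Tendsto
      (fun t => H1norm (fun x =>
        u t x - ∑ j ∈ Finset.Icc 1 M, Qc (c' j) (x - c' j * t - Δ' j)))
      atBot (nhds 0))
    (j₀ : ℕ) (hj₀1 : 1 ≤ j₀) (hj₀N : j₀ < N)
    (σ₀ γ₀ : ℝ)
    (hσ₀ : σ₀ = Real.sqrt (c (j₀ + 1)) * (c j₀ - c (j₀ + 1)))
    (hmin : ∀ j, 1 ≤ j → j < N → σ₀ ≤ Real.sqrt (c (j + 1)) * (c j - c (j + 1)))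
    (hγ₀ : γ₀ = Real.sqrt (c j₀ - 3 / 4 * c (j₀ + 1)) - 1 / 2 * Real.sqrt (c (j₀ + 1))) :
    ∀ K₀ : ℝ, 1 < K₀ → ∃ t₀ : ℝ, 0 < t₀ ∧ ∀ t : ℝ, t₀ < t →
      |u t ((σ₀ / γ₀ + c j₀) * t - K₀)| ≤ Real.exp (-2 * σ₀ * t) := by
  intro K₀ hK₀
  have pos : ∀ j ∈ Finset.Icc 1 N, 0 < c j := fun j hj =>
    hcpos j (Finset.mem_Icc.1 hj).1 (Finset.mem_Icc.1 hj).2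
  have pos' : ∀ j ∈ Finset.Icc 1 M, 0 < c' j := fun j hj =>
    hc'pos j (Finset.mem_Icc.1 hj).1 (Finset.mem_Icc.1 hj).2
  have dec := strictAnti_of_succ hcdec
  have ho : Out u N c Δ := ⟨pos, dec, hout⟩
  have hi : Out (fun t x => u (-t) (-x)) M c' (fun j => -Δ' j) := by
    refine ⟨pos', strictAnti_of_succ hc'dec, (hin.comp tendsto_neg_atTop_atBot).congr fun t => ?_⟩
    set f : ℝ → ℝ := fun x => u (-t) x - ∑ j ∈ Finset.Icc 1 M, Qc (c' j) (x - c' j * -t - Δ' j)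
      with hf
    have e : (fun x => u (-t) (-x) - ∑ j ∈ Finset.Icc 1 M, Qc (c' j) (x - c' j * t - -Δ' j)) =
        fun x => f (-x) := by
      funext x
      simp only [hf]
      congr 1
      refine Finset.sum_congr rfl fun j _ => ?_
      rw [← Qc_neg]; congr 1; ring
    rw [e]
    change H1norm f = _
    unfold H1norm
    simp only [deriv_comp_neg, neg_sq]
    rw [integral_neg_eq_self (fun x => f x ^ 2 + deriv f x ^ 2) volume]
  have one_mem : 1 ∈ Finset.Icc 1 N := Finset.mem_Icc.2 ⟨le_rfl, by omega⟩
  have le1 : ∀ j ∈ Finset.Icc 1 N, c j ≤ 1 := fun j hj => by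
    rcases (Finset.mem_Icc.1 hj).1.eq_or_lt with h | h
    · rw [← h, hc1]
    · rw [← hc1]; exact (dec 1 one_mem j hj h).le
  have hs : ∑ j ∈ Finset.Icc 1 N, (1 - c j) ^ 2 ≤ 1 / 16 := by
    refine le_of_eq_of_le (Finset.sum_subset (Finset.Icc_subset_Icc_left (by norm_num)) fun j hj h => ?_).symm
      hspeeds
    have : j = 1 := by
      simp only [Finset.mem_Icc] at hj h; omega
    rw [this, hc1]; norm_num
  have ge : ∀ j ∈ Finset.Icc 1 N, 3 / 4 ≤ c j := fun j hj => by
    have h : (1 - c j) ^ 2 ≤ ∑ j ∈ Finset.Icc 1 N, (1 - c j) ^ 2 :=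
      Finset.single_le_sum (f := fun j => (1 - c j) ^ 2) (fun j _ => sq_nonneg _) hj
    have h2 : 1 - c j ≤ 1 / 4 := le_of_sq_le_sq (by linarith) (by norm_num)
    linarith
  have c6 : ∀ j ∈ Finset.Icc 1 N, rt (c j) ^ 6 = c j := fun j hj => rt_pow (pos j hj)
  obtain ⟨s1, s2, s3⟩ := sums_eq hu ho hi (by omega) (by omega)
  have near : ∀ k ∈ Finset.Icc 1 M, 53 / 100 ≤ c' k := fun k hk => by
    have h := sizes_near_one (fun j hj => by rw [c6 j hj]; exact ge j hj)
      (fun j hj => rt_pos (pos j hj))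
      (fun j hj => (pow_le_one_iff_of_nonneg (rt_pos (pos j hj)).le (by norm_num : 6 ≠ 0)).1
        (by rw [c6 j hj]; exact le1 j hj))
      (by rwa [Finset.sum_congr rfl fun j hj => by rw [c6 j hj]])
      (fun j hj => rt_pos (pos' j hj)) s1 s2 s3 hk
    rw [← rt_pow (pos' k hk)]
    have := pow_le_pow_left₀ (by norm_num) h.le 6
    norm_num at this ⊢
    linarith
  obtain ⟨C, C0, hC⟩ := right_tail hu ho hi (m := 1 / 2) (β := 7 / 5) (v := 53 / 100) (V := 1)
    (by norm_num) (by norm_num) (by norm_num) near (by norm_num) le1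
  have hr := rate_le (ge (j₀ + 1) (Finset.mem_Icc.2 ⟨by omega, hj₀N⟩)) (hcdec j₀ hj₀1 hj₀N)
    (le1 j₀ (Finset.mem_Icc.2 ⟨hj₀1, hj₀N.le⟩)) hσ₀ hγ₀
  refine ⟨40 * (|log C| + 7 / 10 * K₀), by positivity, fun t ht => ?_⟩
  have t0 : 0 < t := lt_trans (by positivity) ht
  refine (hC t _).trans ?_
  rw [max_eq_left t0.le]
  nth_rewrite 1 [← exp_log C0]
  rw [← exp_add, exp_le_exp]
  linarith [mul_le_mul_of_nonneg_right hr t0.le, le_abs_self (log C)]
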